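/- The set S of possible ordered spectra of sums g Λ_A g⁻¹ + h Λ_B h⁻¹ over g, h ∈ SU(p,q) is a convex subset of ℝⁿ. -/

import Mathlib

open Matrix Polynomial

noncomputable section

/-- The signature matrix `J = diag(1,…,1,−1,…,−1)` with `p` ones and `q` minus ones. -/
def Jmat (p q : ℕ) : Matrix (Fin (p + q)) (Fin (p + q)) ℂ :=
  Matrix.diagonal fun i => if (i : ℕ) < p then 1 else -1

/-- The group `SU(p,q)` of complex `(p+q)×(p+q)` matrices `g` with `det g = 1` and
`gᴴ J g = J`. -/
def SUpq (p q : ℕ) : Set (Matrix (Fin (p + q)) (Fin (p + q)) ℂ) :=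
  { g | g.det = 1 ∧ g.conjTranspose * Jmat p q * g = Jmat p q }

/-- `x` is the ordered spectrum of `M`: the entries of `x` are non-increasing within the
first `p` coordinates and within the last `q` coordinates, every entry of the first block
is strictly greater than every entry of the second block, and the eigenvalues of `M`
counted with multiplicity are exactly the entries of `x` (its characteristic polynomial is
`∏ i (X - x i)`). -/
def IsOrderedSpectrum (p q : ℕ) (M : Matrix (Fin (p + q)) (Fin (p + q)) ℂ)
    (x : Fin (p + q) → ℝ) : Prop :=
  (∀ i j : Fin (p + q), i ≤ j → ((j : ℕ) < p ∨ p ≤ (i : ℕ)) → x j ≤ x i) ∧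
  (∀ i j : Fin (p + q), (i : ℕ) < p → p ≤ (j : ℕ) → x j < x i) ∧
  M.charpoly = ∏ i, (X - Polynomial.C ((x i : ℂ)))

namespace SpectraConvex

open scoped ComplexOrder Topology

section Slope

/-- The weighted sum of the increments of `r` along `0, 1, …, m`. -/
def slope {m : ℕ} (w : Fin m → ℝ) (r : ℕ → ℝ) : ℝ := ∑ i, w i * (r (i + 1) - r i)

lemma slope_add_right {m : ℕ} (w : Fin m → ℝ) (r s : ℕ → ℝ) :
    slope w (fun k => r k + s k) = slope w r + slope w s := by
  simp only [slope, ← Finset.sum_add_distrib]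
  exact Finset.sum_congr rfl fun i _ => by ring

lemma slope_sub_right {m : ℕ} (w : Fin m → ℝ) (r s : ℕ → ℝ) :
    slope w (fun k => r k - s k) = slope w r - slope w s := by
  simp only [slope, ← Finset.sum_sub_distrib]
  exact Finset.sum_congr rfl fun i _ => by ring

lemma slope_add_left {m : ℕ} (w v : Fin m → ℝ) (r : ℕ → ℝ) :
    slope (w + v) r = slope w r + slope v r := by
  simp only [slope, ← Finset.sum_add_distrib]
  exact Finset.sum_congr rfl fun i _ => by simp; ring

lemma slope_smul_left {m : ℕ} (t : ℝ) (w : Fin m → ℝ) (r : ℕ → ℝ) :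
    slope (t • w) r = t * slope w r := by
  simp only [slope, Finset.mul_sum]
  exact Finset.sum_congr rfl fun i _ => by simp; ring

lemma slope_const {m : ℕ} (t : ℝ) (r : ℕ → ℝ) :
    slope (fun _ : Fin m => t) r = t * (r m - r 0) := by
  rw [slope, ← Finset.mul_sum, Fin.sum_univ_eq_sum_range (fun i => r (i + 1) - r i),
    Finset.sum_range_sub]

lemma slope_congr {m : ℕ} (w : Fin m → ℝ) {r s : ℕ → ℝ} (h : ∀ k ≤ m, r k = s k) :
    slope w r = slope w s :=
  Finset.sum_congr rfl fun i _ => by rw [h _ i.isLt, h _ i.isLt.le]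

lemma slope_lower {m : ℕ} (w : Fin m → ℝ) (hw : Antitone w) (d : ℕ → ℝ) (h0 : d 0 = 0)
    (hd : ∀ k ≤ m, 0 ≤ d k) (l : ℝ) (hl : ∀ i, l ≤ w i) : l * d m ≤ slope w d := by
  induction m generalizing l with
  | zero => simp [slope, h0]
  | succ m ih =>
    have h1 := ih (fun i => w i.castSucc) (fun i j h => hw (by simpa using h))
      (fun k hk => hd k (by omega)) (w (Fin.last m)) (fun i => hw (Fin.le_last _))
    have h2 : slope w d = slope (fun i => w i.castSucc) d + w (Fin.last m) * (d (m + 1) - d m) := by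
      simp [slope, Fin.sum_univ_castSucc]
    have h3 := mul_le_mul_of_nonneg_right (hl (Fin.last m)) (hd (m + 1) le_rfl)
    linarith

/-- Abel summation: the slope along an antitone weight is monotone in the interior values. -/
lemma slope_mono {m : ℕ} (w : Fin m → ℝ) (hw : Antitone w) (r s : ℕ → ℝ) (h0 : r 0 = s 0)
    (hm : r m = s m) (h : ∀ k ≤ m, r k ≤ s k) : slope w r ≤ slope w s := by
  have hd : 0 ≤ slope w (fun k => s k - r k) := by
    rcases m with _ | m
    · simp [slope]
    · have := slope_lower w hw (fun k => s k - r k) (by simp [h0])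
        (fun k hk => sub_nonneg.2 (h k hk)) (w (Fin.last m)) (fun i => hw (Fin.le_last _))
      simpa [hm] using this
  rw [slope_sub_right] at hd
  linarith

lemma abs_slope_le {m : ℕ} (w : Fin m → ℝ) (r : ℕ → ℝ) (K : ℝ) (h : ∀ k ≤ m, |r k| ≤ K) :
    |slope w r| ≤ 2 * K * ∑ i, |w i| := by
  rw [slope, Finset.mul_sum]
  refine (Finset.abs_sum_le_sum_abs _ _).trans (Finset.sum_le_sum fun i _ => ?_)
  rw [abs_mul, mul_comm]
  refine mul_le_mul_of_nonneg_right ?_ (abs_nonneg _)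
  have h1 := abs_le.1 (h _ i.isLt)
  have h2 := abs_le.1 (h _ i.isLt.le)
  exact abs_le.2 ⟨by linarith, by linarith⟩

/-- Abel summation with a bounded error. -/
lemma slope_mono_of_bounded {m : ℕ} (w : Fin m → ℝ) (hw : Antitone w) (r s : ℕ → ℝ) (K : ℝ)
    (hK : 0 ≤ K) (h0 : |r 0 - s 0| ≤ K) (hm : |r m - s m| ≤ K) (h : ∀ k ≤ m, r k ≤ s k + K) :
    slope w r - 2 * K * ∑ i, |w i| ≤ slope w s := by
  set e : ℕ → ℝ := fun k => if k = 0 ∨ k = m then r k - s k else K with he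
  have h1 : slope w r ≤ slope w (fun k => s k + e k) := by
    refine slope_mono w hw _ _ (by simp [he]) (by simp [he]) fun k hk => ?_
    by_cases hk' : k = 0 ∨ k = m
    · simp [he, hk']
    · simp only [he, hk', if_false]; exact h k hk
  have h2 : |slope w e| ≤ 2 * K * ∑ i, |w i| := by
    refine abs_slope_le w e K fun k _ => ?_
    by_cases hk' : k = 0 ∨ k = m
    · simp only [he, hk', if_true]; rcases hk' with rfl | rfl <;> assumption
    · simp only [he, hk', if_false]; exact (abs_of_nonneg hK).le
  rw [slope_add_right] at h1
  have := (abs_le.1 h2).2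
  linarith

end Slope

section PrefixRank

variable {m : Type*} {n : ℕ}

/-- The inclusion of the first `k` indices. -/
abbrev pre (n k : ℕ) : {j : Fin n // j.val < k} → Fin n := Subtype.val

/-- The rank of the first `k` columns. -/
def preRank (M : Matrix m (Fin n) ℂ) (k : ℕ) : ℕ := (M.submatrix id (pre n k)).rank

/-- The slope of the prefix ranks. -/
def sl (w : Fin n → ℝ) (M : Matrix m (Fin n) ℂ) : ℝ := slope w fun k => (preRank M k : ℝ)

lemma preRank_zero (M : Matrix m (Fin n) ℂ) : preRank M 0 = 0 := by
  have : (M.submatrix id (pre n 0)).rank ≤ Fintype.card {j : Fin n // j.val < 0} :=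
    rank_le_card_width _
  simpa [preRank] using this

lemma preRank_self (M : Matrix m (Fin n) ℂ) : preRank M n = M.rank := by
  have e : Function.Bijective (pre n n) :=
    ⟨Subtype.val_injective, fun j => ⟨⟨j, j.isLt⟩, rfl⟩⟩
  exact rank_submatrix M (Equiv.refl m) (Equiv.ofBijective _ e)

lemma preRank_mul_left [Fintype m] [DecidableEq m] (L : Matrix m m ℂ) (hL : IsUnit L.det)
    (M : Matrix m (Fin n) ℂ) (k : ℕ) : preRank (L * M) k = preRank M k := by
  have : (L * M).submatrix id (pre n k) = L * M.submatrix id (pre n k) := by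
    ext i j; simp [Matrix.mul_apply]
  rw [preRank, this, preRank]
  exact rank_mul_eq_right_of_isUnit_det L _ hL

lemma sl_mul_left [Fintype m] [DecidableEq m] (w : Fin n → ℝ) (L : Matrix m m ℂ) (hL : IsUnit L.det)
    (M : Matrix m (Fin n) ℂ) : sl w (L * M) = sl w M := by
  simp [sl, preRank_mul_left L hL]

end PrefixRank

section Orthonormal

variable {m : Type*} [Fintype m] [DecidableEq m]

lemma trace_le_rank_of_le_one {κ : Type*} [Fintype κ] [DecidableEq κ] (A : Matrix κ κ ℂ)
    (hA : A.PosSemidef) (h1 : (1 - A).PosSemidef) : A.trace.re ≤ A.rank := by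
  have hh := hA.isHermitian
  rw [hh.trace_eq_sum_eigenvalues, hh.rank_eq_card_non_zero_eigs, Fintype.card_subtype]
  simp only [Complex.coe_algebraMap, ← Complex.ofReal_sum, Complex.ofReal_re]
  rw [Finset.card_eq_sum_ones, Nat.cast_sum, Finset.sum_filter]
  refine Finset.sum_le_sum fun i _ => ?_
  split_ifs with h
  · have hv := hh.mulVec_eigenvectorBasis i
    have hpos := h1.dotProduct_mulVec_nonneg (hh.eigenvectorBasis i)
    have hnorm : star (⇑(hh.eigenvectorBasis i)) ⬝ᵥ ⇑(hh.eigenvectorBasis i) = 1 := by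
      have := hh.eigenvectorBasis.orthonormal.1 i
      have h2 := inner_self_eq_norm_sq_to_K (𝕜 := ℂ) (hh.eigenvectorBasis i)
      rw [this] at h2
      rw [EuclideanSpace.inner_eq_star_dotProduct] at h2
      rw [dotProduct_comm]
      simpa using h2
    rw [sub_mulVec, one_mulVec, hv, dotProduct_sub, dotProduct_smul, hnorm] at hpos
    have : (0:ℝ) ≤ 1 - hh.eigenvalues i := by
      have h3 := (Complex.le_def.1 hpos).1
      simpa using h3
    simp; linarith
  · push Not at h; simp [h]

lemma sum_pre_eq {n : ℕ} (f : Fin n → ℝ) (k : ℕ) :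
    ∑ j : {j : Fin n // j.val < k}, f j = ∑ j, if j.val < k then f j else 0 := by
  rw [← Finset.sum_filter]
  exact (Finset.sum_subtype _ (by simp) f).symm

lemma slope_partial_sums {n : ℕ} (w f : Fin n → ℝ) :
    slope w (fun k => ∑ j, if j.val < k then f j else 0) = ∑ i, w i * f i := by
  refine Finset.sum_congr rfl fun i _ => ?_
  dsimp only
  rw [← Finset.sum_sub_distrib, Finset.sum_eq_single i]
  · simp
  · intro j _ hj
    have : (j.val < i.val + 1) ↔ (j.val < i.val) := by
      have := Fin.val_ne_of_ne hj; omega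
    simp [this]
  · simp

/-- The squared column norms of a matrix with orthonormal rows pair with an antitone weight to at
most the slope of its prefix ranks. -/
lemma sum_le_sl_of_orthonormal {n : ℕ} (w : Fin n → ℝ) (hw : Antitone w)
    (M : Matrix m (Fin n) ℂ) (hM : M * Mᴴ = 1) :
    ∑ j, w j * ((Mᴴ * M) j j).re ≤ sl w M := by
  have hproj : (1 - Mᴴ * M).PosSemidef := by
    have h : 1 - Mᴴ * M = (1 - Mᴴ * M)ᴴ * (1 - Mᴴ * M) := by
      have h2 : Mᴴ * M * (Mᴴ * M) = Mᴴ * M := by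
        rw [Matrix.mul_assoc, ← Matrix.mul_assoc M, hM, Matrix.one_mul]
      simp [sub_mul, mul_sub, h2]
    rw [h]; exact posSemidef_conjTranspose_mul_self _
  rw [← slope_partial_sums, sl]
  refine slope_mono w hw _ _ ?_ ?_ fun k _ => ?_
  · simp [preRank_zero]
  · have h1 : (∑ j : Fin n, if j.val < n then ((Mᴴ * M) j j).re else 0) = (Mᴴ * M).trace.re := by
      simp [Matrix.trace]
    rw [h1, preRank_self, Matrix.trace_mul_comm, hM, ← rank_self_mul_conjTranspose, hM]
    simp
  · set E := M.submatrix id (pre n k) with hE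
    have h1 : Eᴴ * E = (Mᴴ * M).submatrix (pre n k) (pre n k) := by
      ext i j; simp [hE, Matrix.mul_apply]
    have h2 : (1 - Eᴴ * E).PosSemidef := by
      have := hproj.submatrix (pre n k)
      rwa [Matrix.submatrix_sub, Pi.sub_apply, Pi.sub_apply,
        Matrix.submatrix_one _ Subtype.val_injective, ← h1] at this
    have h3 := trace_le_rank_of_le_one (Eᴴ * E) (posSemidef_conjTranspose_mul_self _) h2
    rw [rank_conjTranspose_mul_self, h1] at h3
    rw [← sum_pre_eq (fun j => ((Mᴴ * M) j j).re)]
    simpa [Matrix.trace, preRank] using h3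

end Orthonormal

section PosDefTools

variable {m n : Type*} [Fintype m] [DecidableEq m] [Fintype n] [DecidableEq n]

lemma PosDef.exists_isUnit_factor {M : Matrix m m ℂ} (hM : M.PosDef) :
    ∃ B : Matrix m m ℂ, IsUnit B.det ∧ M = Bᴴ * B := by
  obtain ⟨B, hB⟩ : ∃ B : Matrix m m ℂ, M = Bᴴ * B := by
    open scoped MatrixOrder in
    exact CStarAlgebra.nonneg_iff_eq_star_mul_self.1 (nonneg_iff_posSemidef.2 hM.posSemidef)
  refine ⟨B, ?_, hB⟩
  have h := (Matrix.isUnit_iff_isUnit_det _).1 hM.isUnit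
  rw [hB, det_mul] at h
  exact isUnit_of_mul_isUnit_right h

lemma PosDef.exists_normalizer {M : Matrix m m ℂ} (hM : M.PosDef) :
    ∃ L : Matrix m m ℂ, IsUnit L.det ∧ L * M * Lᴴ = 1 := by
  obtain ⟨B, hB, rfl⟩ := PosDef.exists_isUnit_factor hM
  have hB' : IsUnit Bᴴ.det := by rw [det_conjTranspose]; exact hB.star
  refine ⟨Bᴴ⁻¹, ?_, ?_⟩
  · exact isUnit_nonsing_inv_det _ hB'
  · rw [conjTranspose_nonsing_inv, conjTranspose_conjTranspose, ← Matrix.mul_assoc,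
      nonsing_inv_mul _ hB', Matrix.one_mul, mul_nonsing_inv _ hB]

lemma posSemidef_one_sub_comm {A : Matrix m n ℂ} (h : (1 - A * Aᴴ).PosSemidef) :
    (1 - Aᴴ * A).PosSemidef := by
  have h1 : (fromBlocks 1 A Aᴴ 1).PosSemidef := by
    haveI : Invertible (1 : Matrix n n ℂ) := invertibleOne
    rw [Matrix.PosDef.fromBlocks₂₂ (D := 1) 1 A PosDef.one]
    simpa using h
  haveI : Invertible (1 : Matrix m m ℂ) := invertibleOne
  rw [Matrix.PosDef.fromBlocks₁₁ (A := 1) A 1 PosDef.one] at h1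
  simpa using h1

lemma posDef_conj_of_rows {M : Matrix n n ℂ} (hM : M.PosDef) {N : Matrix m n ℂ}
    (hN : LinearIndependent ℂ N.row) : (N * M * Nᴴ).PosDef :=
  hM.mul_mul_conjTranspose_same (vecMul_injective_iff.2 hN)

end PosDefTools

section Signature

variable (p q : Type*) [Fintype p] [DecidableEq p] [Fintype q] [DecidableEq q]

/-- The signature matrix in block form. -/
def sgn : Matrix (p ⊕ q) (p ⊕ q) ℂ := fromBlocks 1 0 0 (-1)

variable {p q}

/-- The product of the diagonal matrix with blocks `a₁`, `a₂` and the signature matrix. -/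
def dJ (a₁ : p → ℝ) (a₂ : q → ℝ) : Matrix (p ⊕ q) (p ⊕ q) ℂ :=
  fromBlocks (diagonal fun i => (a₁ i : ℂ)) 0 0 (diagonal fun i => -(a₂ i : ℂ))

@[simp] lemma sgn_mul_sgn : sgn p q * sgn p q = 1 := by
  simp [sgn, fromBlocks_multiply, fromBlocks_one]

@[simp] lemma sgn_conjTranspose : (sgn p q)ᴴ = sgn p q := by
  simp [sgn, fromBlocks_conjTranspose]

lemma isUnit_det_of_isometry {k : Matrix (p ⊕ q) (p ⊕ q) ℂ} (hk : kᴴ * sgn p q * k = sgn p q) :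
    IsUnit k.det := by
  have h : (sgn p q * kᴴ * sgn p q) * k = 1 := by
    rw [Matrix.mul_assoc, Matrix.mul_assoc, ← Matrix.mul_assoc kᴴ, hk, sgn_mul_sgn]
  have := congrArg det h
  rw [det_mul, det_one] at this
  exact IsUnit.of_mul_eq_one_right _ this

lemma isometry_conjTranspose {k : Matrix (p ⊕ q) (p ⊕ q) ℂ} (hk : kᴴ * sgn p q * k = sgn p q) :
    k * sgn p q * kᴴ = sgn p q := by
  have h : (sgn p q * kᴴ * sgn p q) * k = 1 := by
    rw [Matrix.mul_assoc, Matrix.mul_assoc, ← Matrix.mul_assoc kᴴ, hk, sgn_mul_sgn]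
  have h2 := mul_eq_one_comm.1 h
  have h3 : k * sgn p q * kᴴ = (k * (sgn p q * kᴴ * sgn p q)) * sgn p q := by
    simp only [Matrix.mul_assoc, sgn_mul_sgn, Matrix.mul_one]
  rw [h3, h2, Matrix.one_mul]

/-- Every element of `U(p,q)` is block unipotent times block lower triangular. -/
lemma isometry_decomp {k : Matrix (p ⊕ q) (p ⊕ q) ℂ} (hk : kᴴ * sgn p q * k = sgn p q) :
    ∃ (T : Matrix p q ℂ) (f : Matrix p p ℂ) (h : Matrix q p ℂ) (g : Matrix q q ℂ),
      fromBlocks 1 (-T) 0 1 * k = fromBlocks f 0 h g ∧ (1 - T * Tᴴ).PosDef ∧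
      f * fᴴ = 1 - T * Tᴴ ∧ g * gᴴ - h * hᴴ = 1 := by
  have hdet := isUnit_det_of_isometry hk
  have hk' := isometry_conjTranspose hk
  obtain ⟨k₁₁, k₁₂, k₂₁, k₂₂, rfl⟩ : ∃ k₁₁ k₁₂ k₂₁ k₂₂, k = fromBlocks k₁₁ k₁₂ k₂₁ k₂₂ :=
    ⟨_, _, _, _, (fromBlocks_toBlocks k).symm⟩
  have h22 : IsUnit k₂₂.det := by
    simp only [sgn, fromBlocks_conjTranspose, fromBlocks_multiply, fromBlocks_inj] at hk
    have h1 : k₂₂ᴴ * k₂₂ = 1 + k₁₂ᴴ * k₁₂ := by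
      have := hk.2.2.2
      simp at this
      rw [← sub_eq_zero] at this ⊢
      rw [← neg_eq_zero, ← this]; abel
    have h2 : (k₂₂ᴴ * k₂₂).PosDef := by
      rw [h1]; exact PosDef.one.add_posSemidef (posSemidef_conjTranspose_mul_self _)
    have h3 := (Matrix.isUnit_iff_isUnit_det _).1 h2.isUnit
    rw [det_mul] at h3
    exact isUnit_of_mul_isUnit_right h3
  set T := k₁₂ * k₂₂⁻¹ with hT
  have hTk : T * k₂₂ = k₁₂ := by rw [hT, Matrix.mul_assoc, nonsing_inv_mul _ h22, Matrix.mul_one]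
  have heq : fromBlocks 1 (-T) 0 1 * fromBlocks k₁₁ k₁₂ k₂₁ k₂₂
      = fromBlocks (k₁₁ - T * k₂₁) 0 k₂₁ k₂₂ := by
    simp [fromBlocks_multiply, hTk, sub_eq_add_neg]
  have hG : fromBlocks (k₁₁ - T * k₂₁) 0 k₂₁ k₂₂ * sgn p q * (fromBlocks (k₁₁ - T * k₂₁) 0 k₂₁ k₂₂)ᴴ
      = fromBlocks 1 (-T) 0 1 * sgn p q * (fromBlocks 1 (-T) 0 1)ᴴ := by
    rw [← heq, conjTranspose_mul]
    conv_rhs => rw [← hk']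
    simp only [Matrix.mul_assoc]
  have hf : IsUnit (k₁₁ - T * k₂₁).det := by
    have := congrArg det heq
    rw [det_mul, det_fromBlocks_zero₂₁, det_fromBlocks_zero₁₂] at this
    simp only [det_one, one_mul] at this
    rw [this] at hdet
    exact isUnit_of_mul_isUnit_left hdet
  simp only [sgn, fromBlocks_conjTranspose, fromBlocks_multiply, fromBlocks_inj] at hG
  have hff : (k₁₁ - T * k₂₁) * (k₁₁ - T * k₂₁)ᴴ = 1 - T * Tᴴ := by
    have := hG.1
    simpa [sub_eq_add_neg] using this
  refine ⟨T, _, k₂₁, k₂₂, heq, ?_, hff, ?_⟩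
  · rw [← hff]
    exact PosDef.mul_conjTranspose_self _
      (vecMul_injective_iff_isUnit.2 ((Matrix.isUnit_iff_isUnit_det _).2 hf))
  · have := hG.2.2.2
    simp at this
    rw [← sub_eq_zero] at this ⊢
    rw [← neg_eq_zero, ← this]; abel

end Signature

section Necessity

variable {p q : ℕ} {m₁ m₂ : Type*} [Fintype m₁] [DecidableEq m₁] [Fintype m₂] [DecidableEq m₂]

lemma sum_le_sl_of_expanding {w : Fin p → ℝ} (hw : Antitone w) (hw0 : ∀ i, w i ≤ 0)
    {z : Matrix m₁ (Fin p) ℂ} (hz : (z * zᴴ - 1).PosSemidef) :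
    ∑ j, w j * ((zᴴ * z) j j).re ≤ sl w z := by
  have hpd : (z * zᴴ).PosDef := by
    have := PosDef.one.add_posSemidef hz
    simpa using this
  obtain ⟨L, hL, hLz⟩ := PosDef.exists_normalizer hpd
  have h1 : (1 - L * Lᴴ).PosSemidef := by
    have := hz.mul_mul_conjTranspose_same L
    rwa [mul_sub, sub_mul, hLz, Matrix.mul_one] at this
  have h2 := (posSemidef_one_sub_comm h1).conjTranspose_mul_mul_same z
  have h3 := sum_le_sl_of_orthonormal w hw (L * z) (by
    rw [conjTranspose_mul, ← hLz]; simp only [Matrix.mul_assoc])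
  rw [sl_mul_left w L hL] at h3
  refine le_trans (Finset.sum_le_sum fun j _ => ?_) h3
  have h4 := (Complex.le_def.1 (h2.diag_nonneg (i := j))).1
  have h5 : zᴴ * (1 - Lᴴ * L) * z = zᴴ * z - (L * z)ᴴ * (L * z) := by
    rw [conjTranspose_mul]; simp only [Matrix.mul_sub, Matrix.sub_mul, Matrix.mul_one,
      Matrix.mul_assoc]
  rw [h5] at h4
  simp only [Complex.zero_re, Matrix.sub_apply, Complex.sub_re] at h4
  exact mul_le_mul_of_nonpos_left (by linarith) (hw0 j)

lemma trace_diagonal_conj (w : Fin p → ℝ) (n : Matrix m₁ (Fin p) ℂ) :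
    (n * diagonal (fun i => (w i : ℂ)) * nᴴ).trace.re = ∑ j, w j * ((nᴴ * n) j j).re := by
  rw [Matrix.mul_assoc, Matrix.trace_mul_comm, Matrix.mul_assoc, Matrix.trace]
  simp [diagonal_mul]

lemma diag_conjTranspose_mul_self_nonneg (n : Matrix m₁ (Fin p) ℂ) (j : Fin p) :
    0 ≤ ((nᴴ * n) j j).re :=
  (Complex.le_def.1 ((posSemidef_conjTranspose_mul_self n).diag_nonneg (i := j))).1

lemma trace_le_sl_lower {a₁ : Fin p → ℝ} {a₂ : Fin q → ℝ} (ha₁ : Antitone a₁) (ha₂ : Antitone a₂)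
    (hp : ∀ i, 0 ≤ a₁ i) (hn : ∀ i, a₂ i ≤ 0) (n₁ : Matrix m₁ (Fin p) ℂ)
    (n₂₁ : Matrix m₂ (Fin p) ℂ) (n₂ : Matrix m₂ (Fin q) ℂ) (h₁ : (n₁ * n₁ᴴ).PosDef)
    (h₂ : (n₂ * n₂ᴴ - n₂₁ * n₂₁ᴴ).PosDef) {M : Matrix (m₁ ⊕ m₂) (Fin p ⊕ Fin q) ℂ}
    (hM : M = fromBlocks n₁ 0 n₂₁ n₂) {G : Matrix (m₁ ⊕ m₂) (m₁ ⊕ m₂) ℂ}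
    (hG : G = M * sgn (Fin p) (Fin q) * Mᴴ) :
    IsUnit G.det ∧ (G⁻¹ * (M * dJ a₁ a₂ * Mᴴ)).trace.re ≤ sl a₁ n₁ + sl a₂ n₂ := by
  obtain ⟨l₁, hl₁, hl₁'⟩ := PosDef.exists_normalizer h₁
  set v := l₁ * n₁ with hv
  have hvv : v * vᴴ = 1 := by rw [hv, conjTranspose_mul, ← hl₁']; simp only [Matrix.mul_assoc]
  have hpd : (n₂ * n₂ᴴ - n₂₁ * n₂₁ᴴ + (n₂₁ * vᴴ) * (n₂₁ * vᴴ)ᴴ).PosDef :=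
    h₂.add_posSemidef (posSemidef_self_mul_conjTranspose _)
  obtain ⟨l₂, hl₂, hl₂'⟩ := PosDef.exists_normalizer hpd
  set y := l₂ * (n₂₁ - n₂₁ * vᴴ * v) with hy
  set z := l₂ * n₂ with hz
  set L : Matrix (m₁ ⊕ m₂) (m₁ ⊕ m₂) ℂ := fromBlocks l₁ 0 (-(l₂ * n₂₁ * vᴴ * l₁)) l₂ with hL
  have hLM : L * M = fromBlocks v 0 y z := by
    rw [hM, hL, fromBlocks_multiply]
    congr 1
    · simp [hv]
    · simp
    · simp only [hy, Matrix.mul_sub, Matrix.mul_assoc, hv, Matrix.neg_mul]; abel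
    · simp [hz]
  have hvy : v * yᴴ = 0 := by
    have : v * vᴴ * v = v := by rw [hvv, Matrix.one_mul]
    simp only [hy, conjTranspose_mul, conjTranspose_sub, conjTranspose_conjTranspose]
    rw [← Matrix.mul_assoc, Matrix.mul_sub, ← Matrix.mul_assoc v vᴴ, hvv,
      Matrix.one_mul, sub_self, Matrix.zero_mul]
  have hyz : z * zᴴ - y * yᴴ = 1 := by
    rw [← hl₂', hz, hy]
    simp only [conjTranspose_mul, conjTranspose_sub, conjTranspose_conjTranspose]
    have e1 : (n₂₁ - n₂₁ * vᴴ * v) * (n₂₁ᴴ - vᴴ * (v * n₂₁ᴴ)) =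
        n₂₁ * n₂₁ᴴ - n₂₁ * vᴴ * (v * n₂₁ᴴ) := by
      have e2 : n₂₁ * vᴴ * v * (vᴴ * (v * n₂₁ᴴ)) = n₂₁ * vᴴ * (v * n₂₁ᴴ) := by
        rw [Matrix.mul_assoc (n₂₁ * vᴴ), ← Matrix.mul_assoc v vᴴ, hvv, Matrix.one_mul]
      rw [Matrix.sub_mul, Matrix.mul_sub, Matrix.mul_sub, e2]
      simp only [Matrix.mul_assoc]; abel
    have e3 : l₂ * (n₂₁ - n₂₁ * vᴴ * v) * ((n₂₁ᴴ - vᴴ * (v * n₂₁ᴴ)) * l₂ᴴ) =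
        l₂ * ((n₂₁ - n₂₁ * vᴴ * v) * (n₂₁ᴴ - vᴴ * (v * n₂₁ᴴ))) * l₂ᴴ := by
      simp only [Matrix.mul_assoc]
    rw [e3, e1]
    simp only [Matrix.mul_sub, Matrix.sub_mul, Matrix.mul_add, Matrix.add_mul, Matrix.mul_assoc]
    abel
  have hLG : L * G * Lᴴ = sgn m₁ m₂ := by
    have : L * G * Lᴴ = (L * M) * sgn (Fin p) (Fin q) * (L * M)ᴴ := by
      rw [hG, conjTranspose_mul]; simp only [Matrix.mul_assoc]
    rw [this, hLM]
    have hyv : y * vᴴ = 0 := by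
      have := congrArg conjTranspose hvy
      simpa using this
    have : y * yᴴ - z * zᴴ = -1 := by rw [← hyz]; abel
    simp [sgn, fromBlocks_conjTranspose, fromBlocks_multiply, hvv, hvy, hyv, ← sub_eq_add_neg, this]
  have hGi : (Lᴴ * sgn m₁ m₂ * L) * G = 1 := by
    have e1 : L * (G * Lᴴ * sgn m₁ m₂) = 1 := by
      rw [← Matrix.mul_assoc, ← Matrix.mul_assoc, hLG, sgn_mul_sgn]
    have e2 := mul_eq_one_comm.1 e1
    have e3 : G * (Lᴴ * sgn m₁ m₂ * L) = 1 := by rw [← e2]; simp only [Matrix.mul_assoc]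
    exact mul_eq_one_comm.1 e3
  have hdet : IsUnit G.det := by
    have := congrArg det hGi
    rw [det_mul, det_one] at this
    exact IsUnit.of_mul_eq_one_right _ this
  refine ⟨hdet, ?_⟩
  rw [inv_eq_left_inv hGi]
  have e1 : (Lᴴ * sgn m₁ m₂ * L * (M * dJ a₁ a₂ * Mᴴ)).trace =
      (sgn m₁ m₂ * ((L * M) * dJ a₁ a₂ * (L * M)ᴴ)).trace := by
    rw [Matrix.mul_assoc, Matrix.mul_assoc, Matrix.trace_mul_comm, conjTranspose_mul]
    simp only [Matrix.mul_assoc]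
  rw [e1, hLM]
  have e2 : (sgn m₁ m₂ * (fromBlocks v 0 y z * dJ a₁ a₂ * (fromBlocks v 0 y z)ᴴ)).trace.re =
      ∑ j, a₁ j * ((vᴴ * v) j j).re - ∑ j, a₁ j * ((yᴴ * y) j j).re
        + ∑ j, a₂ j * ((zᴴ * z) j j).re := by
    rw [← trace_diagonal_conj, ← trace_diagonal_conj, ← trace_diagonal_conj]
    have : (diagonal fun i => -(a₂ i : ℂ)) = - diagonal fun i => (a₂ i : ℂ) := by
      rw [← diagonal_neg]
    simp only [sgn, dJ, fromBlocks_conjTranspose, fromBlocks_multiply, this]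
    simp [-diagonal_neg, Matrix.trace, Fintype.sum_sum_type, Finset.sum_add_distrib]
    ring
  rw [e2]
  have b1 := sum_le_sl_of_orthonormal a₁ ha₁ v hvv
  have b2 : ∑ j, a₂ j * ((zᴴ * z) j j).re ≤ sl a₂ z := by
    refine sum_le_sl_of_expanding ha₂ hn ?_
    have : z * zᴴ - 1 = y * yᴴ := by rw [← hyz]; abel
    rw [this]; exact posSemidef_self_mul_conjTranspose _
  have b3 : 0 ≤ ∑ j, a₁ j * ((yᴴ * y) j j).re :=
    Finset.sum_nonneg fun j _ => mul_nonneg (hp j) (diag_conjTranspose_mul_self_nonneg y j)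
  rw [hv, sl_mul_left _ _ hl₁] at b1
  rw [hz, sl_mul_left _ _ hl₂] at b2
  linarith

lemma trace_le_sl_upper {c₁ : Fin p → ℝ} {c₂ : Fin q → ℝ} (hc₁ : Antitone c₁) (hc₂ : Antitone c₂)
    (hn : ∀ i, c₁ i ≤ 0) (hp : ∀ i, 0 ≤ c₂ i) (n₁ : Matrix m₁ (Fin p) ℂ)
    (n₁₂ : Matrix m₁ (Fin q) ℂ) (n₂ : Matrix m₂ (Fin q) ℂ)
    (h₁ : (n₁ * n₁ᴴ - n₁₂ * n₁₂ᴴ).PosDef) (h₂ : (n₂ * n₂ᴴ).PosDef)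
    {M : Matrix (m₁ ⊕ m₂) (Fin p ⊕ Fin q) ℂ}
    (hM : M = fromBlocks n₁ n₁₂ 0 n₂) {G : Matrix (m₁ ⊕ m₂) (m₁ ⊕ m₂) ℂ}
    (hG : G = M * sgn (Fin p) (Fin q) * Mᴴ) :
    (G⁻¹ * (M * dJ c₁ c₂ * Mᴴ)).trace.re ≤ sl c₁ n₁ + sl c₂ n₂ := by
  obtain ⟨hdet, h⟩ := trace_le_sl_lower hc₂ hc₁ hp hn n₂ n₁₂ n₁ h₂ h₁ rfl rfl
  set M' := fromBlocks n₂ 0 n₁₂ n₁ with hM'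
  set G' := M' * sgn (Fin q) (Fin p) * M'ᴴ with hG'
  have eM : M = M'.submatrix Sum.swap Sum.swap := by
    rw [hM, hM', fromBlocks_submatrix_sum_swap_sum_swap]
  have eS : sgn (Fin p) (Fin q) = -(sgn (Fin q) (Fin p)).submatrix Sum.swap Sum.swap := by
    rw [sgn, sgn, fromBlocks_submatrix_sum_swap_sum_swap, fromBlocks_neg]; simp
  have eD : dJ c₁ c₂ = -(dJ c₂ c₁).submatrix Sum.swap Sum.swap := by
    rw [dJ, dJ, fromBlocks_submatrix_sum_swap_sum_swap, fromBlocks_neg]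
    simp [← diagonal_neg]
  have key : ∀ A : Matrix (Fin q ⊕ Fin p) (Fin q ⊕ Fin p) ℂ,
      M * (-A.submatrix Sum.swap Sum.swap) * Mᴴ = -(M' * A * M'ᴴ).submatrix Sum.swap Sum.swap := by
    intro A
    rw [eM, conjTranspose_submatrix, Matrix.mul_neg, Matrix.neg_mul,
      show (Sum.swap : Fin p ⊕ Fin q → Fin q ⊕ Fin p) = Equiv.sumComm _ _ from rfl,
      submatrix_mul_equiv, submatrix_mul_equiv]
  have eG : G = -G'.submatrix Sum.swap Sum.swap := by rw [hG, eS, key]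
  have eGi : G⁻¹ = -(G'⁻¹).submatrix Sum.swap Sum.swap := by
    refine inv_eq_left_inv ?_
    rw [eG, neg_mul_neg, show (Sum.swap : m₁ ⊕ m₂ → m₂ ⊕ m₁) = Equiv.sumComm _ _ from rfl,
      submatrix_mul_equiv, nonsing_inv_mul _ hdet, submatrix_one_equiv]
  rw [eGi, eD, key, Matrix.neg_mul, Matrix.mul_neg, neg_neg,
    show (Sum.swap : m₁ ⊕ m₂ → m₂ ⊕ m₁) = Equiv.sumComm _ _ from rfl,
      submatrix_mul_equiv]
  have etr : ∀ A : Matrix (m₂ ⊕ m₁) (m₂ ⊕ m₁) ℂ,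
      (A.submatrix (Equiv.sumComm m₁ m₂) (Equiv.sumComm m₁ m₂)).trace = A.trace := fun A =>
    Equiv.sum_comp (Equiv.sumComm m₁ m₂) fun i => A i i
  rw [etr]
  linarith

end Necessity

/-- A configuration: two block lower triangular frames relative to each other. -/
structure Config (p q : ℕ) where
  /-- the first frame of the first block -/
  fA : Matrix (Fin p) (Fin p) ℂ
  /-- the second frame of the first block -/
  fB : Matrix (Fin p) (Fin p) ℂ
  /-- the first frame of the second block -/
  gA : Matrix (Fin q) (Fin q) ℂ
  /-- the second frame of the second block -/
  gB : Matrix (Fin q) (Fin q) ℂ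
  /-- the relative position -/
  X : Matrix (Fin p) (Fin q) ℂ

section

variable {p q : ℕ}

/-- The numerical function of a configuration. -/
def Config.num (D : Config p q) (a₁ b₁ c₁ : Fin p → ℝ) (a₂ b₂ c₂ : Fin q → ℝ) {m₁ m₂ : Type}
    (N₁ : Matrix m₁ (Fin p) ℂ) (N₂ : Matrix m₂ (Fin q) ℂ) : ℝ :=
  sl a₁ (N₁ * D.fA) + sl b₁ (N₁ * D.fB) + sl c₁ N₁ +
    (sl a₂ (N₂ * D.gA) + sl b₂ (N₂ * D.gB) + sl c₂ N₂)

/-- Semistability of a configuration with respect to weights. -/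
def Config.Numeric (D : Config p q) (a₁ b₁ c₁ : Fin p → ℝ) (a₂ b₂ c₂ : Fin q → ℝ) : Prop :=
  ∀ (m₁ m₂ : Type) [Fintype m₁] [Fintype m₂] (N₁ : Matrix m₁ (Fin p) ℂ)
    (N₂ : Matrix m₂ (Fin q) ℂ) (R : Matrix m₁ m₂ ℂ), LinearIndependent ℂ N₁.row →
    LinearIndependent ℂ N₂.row → N₁ * D.X = R * N₂ → 0 ≤ D.num a₁ b₁ c₁ a₂ b₂ c₂ N₁ N₂

/-- All frames of a configuration are invertible. -/
structure Config.Invertible (D : Config p q) : Prop where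
  fA : D.fA.det ≠ 0
  fB : D.fB.det ≠ 0
  gA : D.gA.det ≠ 0
  gB : D.gB.det ≠ 0

/-- The additive spectral problem in homogeneous form. -/
def Sol (a₁ b₁ c₁ : Fin p → ℝ) (a₂ b₂ c₂ : Fin q → ℝ) : Prop :=
  ∃ kA kB : Matrix (Fin p ⊕ Fin q) (Fin p ⊕ Fin q) ℂ,
    kAᴴ * sgn (Fin p) (Fin q) * kA = sgn (Fin p) (Fin q) ∧
    kBᴴ * sgn (Fin p) (Fin q) * kB = sgn (Fin p) (Fin q) ∧
    kA * dJ a₁ a₂ * kAᴴ + kB * dJ b₁ b₂ * kBᴴ + dJ c₁ c₂ = 0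

/-- Solutions of the spectral problem are semistable. -/
lemma Sol.exists_numeric {a₁ b₁ c₁ : Fin p → ℝ} {a₂ b₂ c₂ : Fin q → ℝ}
    (ha₁ : Antitone a₁) (hb₁ : Antitone b₁) (hc₁ : Antitone c₁)
    (ha₂ : Antitone a₂) (hb₂ : Antitone b₂) (hc₂ : Antitone c₂)
    (pa₁ : ∀ i, 0 ≤ a₁ i) (pb₁ : ∀ i, 0 ≤ b₁ i) (nc₁ : ∀ i, c₁ i ≤ 0)
    (na₂ : ∀ i, a₂ i ≤ 0) (nb₂ : ∀ i, b₂ i ≤ 0) (pc₂ : ∀ i, 0 ≤ c₂ i)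
    (h : Sol a₁ b₁ c₁ a₂ b₂ c₂) : 
    ∃ D : Config p q, D.Invertible ∧ D.Numeric a₁ b₁ c₁ a₂ b₂ c₂ := by
  obtain ⟨kA, kB, hA, hB, heq⟩ := h
  obtain ⟨TA, fA, hA₂₁, gA, eA, pdA, ffA, ggA⟩ := isometry_decomp hA
  obtain ⟨TB, fB, hB₂₁, gB, eB, pdB, ffB, ggB⟩ := isometry_decomp hB
  have inv₁ : ∀ {n : ℕ} {f S : Matrix (Fin n) (Fin n) ℂ}, S.PosDef → f * fᴴ = S → f.det ≠ 0 := by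
    intro n f S hS hf h0
    have := hS.isUnit
    rw [isUnit_iff_isUnit_det, ← hf, det_mul, h0, zero_mul] at this
    exact not_isUnit_zero this
  have inv₂ : ∀ {g : Matrix (Fin q) (Fin q) ℂ} {h : Matrix (Fin q) (Fin p) ℂ},
      g * gᴴ - h * hᴴ = 1 → g.det ≠ 0 := fun {g h} hg =>
    inv₁ (PosDef.one.add_posSemidef (posSemidef_self_mul_conjTranspose h))
      (sub_eq_iff_eq_add.1 hg)
  refine ⟨⟨fA, fB, gA, gB, TA - TB⟩, ⟨inv₁ pdA ffA, inv₁ pdB ffB, inv₂ ggA, inv₂ ggB⟩, ?_⟩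
  intro m₁ m₂ _ _ N₁ N₂ R hN₁ hN₂ hR
  classical
  set J := sgn (Fin p) (Fin q) with hJ
  set MA : Matrix (m₁ ⊕ m₂) (Fin p ⊕ Fin q) ℂ := fromBlocks N₁ (-(N₁ * TA)) 0 N₂ with hMA
  set MB : Matrix (m₁ ⊕ m₂) (Fin p ⊕ Fin q) ℂ := fromBlocks N₁ (-(N₁ * TB)) 0 N₂ with hMB
  set U : Matrix (m₁ ⊕ m₂) (m₁ ⊕ m₂) ℂ := fromBlocks 1 R 0 1 with hU
  have hUM : MB = U * MA := by
    have : R * N₂ = N₁ * TA - N₁ * TB := by rw [← hR, Matrix.mul_sub]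
    simp [hMA, hMB, hU, fromBlocks_multiply, this]
    abel
  have hUdet : IsUnit U.det := by simp [hU]
  have frame : ∀ (T : Matrix (Fin p) (Fin q) ℂ) (f : Matrix (Fin p) (Fin p) ℂ)
      (h : Matrix (Fin q) (Fin p) ℂ) (g : Matrix (Fin q) (Fin q) ℂ)
      (k : Matrix (Fin p ⊕ Fin q) (Fin p ⊕ Fin q) ℂ),
      fromBlocks 1 (-T) 0 1 * k = fromBlocks f 0 h g →
      fromBlocks N₁ (-(N₁ * T)) 0 N₂ * k = fromBlocks (N₁ * f) 0 (N₂ * h) (N₂ * g) := by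
    intro T f h g k hk
    have e1 : fromBlocks N₁ (-(N₁ * T)) 0 N₂ =
        fromBlocks N₁ 0 0 N₂ * (fromBlocks 1 (-T) 0 1 : Matrix (Fin p ⊕ Fin q) _ ℂ) := by
      simp [fromBlocks_multiply]
    rw [e1, Matrix.mul_assoc, hk, fromBlocks_multiply]
    simp
  have main : ∀ (T : Matrix (Fin p) (Fin q) ℂ) (f : Matrix (Fin p) (Fin p) ℂ)
      (h : Matrix (Fin q) (Fin p) ℂ) (g : Matrix (Fin q) (Fin q) ℂ)
      (k : Matrix (Fin p ⊕ Fin q) (Fin p ⊕ Fin q) ℂ) (w₁ : Fin p → ℝ) (w₂ : Fin q → ℝ)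
      (M : Matrix (m₁ ⊕ m₂) (Fin p ⊕ Fin q) ℂ),
      M = fromBlocks N₁ (-(N₁ * T)) 0 N₂ → kᴴ * J * k = J →
      fromBlocks 1 (-T) 0 1 * k = fromBlocks f 0 h g → (1 - T * Tᴴ).PosDef →
      f * fᴴ = 1 - T * Tᴴ → g * gᴴ - h * hᴴ = 1 →
      Antitone w₁ → Antitone w₂ → (∀ i, 0 ≤ w₁ i) → (∀ i, w₂ i ≤ 0) →
      IsUnit (M * J * Mᴴ).det ∧ ((M * J * Mᴴ)⁻¹ * (M * (k * dJ w₁ w₂ * kᴴ) * Mᴴ)).trace.re ≤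
        sl w₁ (N₁ * f) + sl w₂ (N₂ * g) := by
    intro T f h g k w₁ w₂ M hM hk hdec hpd hff hgg hw₁ hw₂ pw nw
    have h1 : (N₁ * f * (N₁ * f)ᴴ).PosDef := by
      have := posDef_conj_of_rows hpd hN₁
      rw [← hff] at this
      rw [conjTranspose_mul]; simpa only [Matrix.mul_assoc] using this
    have h2 : (N₂ * g * (N₂ * g)ᴴ - N₂ * h * (N₂ * h)ᴴ).PosDef := by
      have := posDef_conj_of_rows PosDef.one hN₂
      rw [← hgg, Matrix.mul_sub, Matrix.sub_mul] at this
      rw [conjTranspose_mul, conjTranspose_mul]; simpa only [Matrix.mul_assoc] using this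
    have hG : M * J * Mᴴ = M * k * J * (M * k)ᴴ := by
      have h3 : k * J * kᴴ = J := isometry_conjTranspose hk
      conv_lhs => rw [← h3]
      rw [conjTranspose_mul]; simp only [Matrix.mul_assoc]
    have := trace_le_sl_lower hw₁ hw₂ pw nw (N₁ * f) (N₂ * h) (N₂ * g) h1 h2
      (by rw [hM]; exact frame T f h g k hdec) hG
    refine ⟨this.1, ?_⟩
    have e : M * (k * dJ w₁ w₂ * kᴴ) * Mᴴ = M * k * dJ w₁ w₂ * (M * k)ᴴ := by
      rw [conjTranspose_mul]; simp only [Matrix.mul_assoc]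
    rw [e]; exact this.2
  obtain ⟨hGdet, tA⟩ := main TA fA hA₂₁ gA kA a₁ a₂ MA rfl hA eA pdA ffA ggA ha₁ ha₂ pa₁ na₂
  obtain ⟨-, tB⟩ := main TB fB hB₂₁ gB kB b₁ b₂ MB rfl hB eB pdB ffB ggB hb₁ hb₂ pb₁ nb₂
  set G := MA * J * MAᴴ with hG
  have tB' : ((MB * J * MBᴴ)⁻¹ * (MB * (kB * dJ b₁ b₂ * kBᴴ) * MBᴴ)).trace =
      (G⁻¹ * (MA * (kB * dJ b₁ b₂ * kBᴴ) * MAᴴ)).trace := by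
    have e1 : ∀ W : Matrix (Fin p ⊕ Fin q) (Fin p ⊕ Fin q) ℂ, MB * W * MBᴴ =
        U * (MA * W * MAᴴ) * Uᴴ := by
      intro W
      rw [hUM, conjTranspose_mul]; simp only [Matrix.mul_assoc]
    have hUd : IsUnit Uᴴ.det := by rw [det_conjTranspose]; exact hUdet.star
    rw [e1, e1, ← hG, Matrix.mul_inv_rev, Matrix.mul_inv_rev]
    rw [show ∀ W : Matrix (m₁ ⊕ m₂) (m₁ ⊕ m₂) ℂ, Uᴴ⁻¹ * (G⁻¹ * U⁻¹) * (U * W * Uᴴ) =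
      Uᴴ⁻¹ * (G⁻¹ * (U⁻¹ * U) * W * Uᴴ) from fun W => by simp only [Matrix.mul_assoc],
      nonsing_inv_mul _ hUdet, Matrix.mul_one, Matrix.trace_mul_comm, Matrix.mul_assoc,
      mul_nonsing_inv _ hUd, Matrix.mul_one]
  rw [tB'] at tB
  have tC : (G⁻¹ * (MA * dJ c₁ c₂ * MAᴴ)).trace.re ≤ sl c₁ N₁ + sl c₂ N₂ := by
    refine trace_le_sl_upper hc₁ hc₂ nc₁ pc₂ N₁ (-(N₁ * TA)) N₂ ?_ ?_ rfl rfl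
    · have := posDef_conj_of_rows pdA hN₁
      rw [Matrix.mul_sub, Matrix.sub_mul, Matrix.mul_one] at this
      rw [conjTranspose_neg, Matrix.neg_mul, Matrix.mul_neg, neg_neg, conjTranspose_mul]
      simpa only [Matrix.mul_assoc] using this
    · have := posDef_conj_of_rows PosDef.one hN₂
      rwa [Matrix.mul_one] at this
  have hsum : (G⁻¹ * (MA * (kA * dJ a₁ a₂ * kAᴴ) * MAᴴ)).trace +
      (G⁻¹ * (MA * (kB * dJ b₁ b₂ * kBᴴ) * MAᴴ)).trace +
      (G⁻¹ * (MA * dJ c₁ c₂ * MAᴴ)).trace = 0 := by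
    rw [← trace_add, ← trace_add, ← Matrix.mul_add, ← Matrix.mul_add, ← Matrix.add_mul,
      ← Matrix.add_mul, ← Matrix.mul_add, ← Matrix.mul_add, heq]
    simp
  have := congrArg Complex.re hsum
  simp only [Complex.add_re, Complex.zero_re] at this
  simp only [Config.num]
  linarith

end

section Specialization

/-- An algebraically closed field containing a transcendental over `ℂ`. -/
abbrev Big : Type := AlgebraicClosure (RatFunc ℂ)

lemma big_isAlgebraic : Algebra.IsAlgebraic ℂ[X] Big :=
  (IsFractionRing.comap_isAlgebraic_iff (A := ℂ[X]) (K := RatFunc ℂ) (C := Big)).2 inferInstance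

lemma algebraMap_big_injective : Function.Injective (algebraMap ℂ[X] Big) := by
  rw [IsScalarTower.algebraMap_eq ℂ[X] (RatFunc ℂ) Big]
  exact (algebraMap (RatFunc ℂ) Big).injective.comp (IsFractionRing.injective ℂ[X] (RatFunc ℂ))

lemma nonempty_big_equiv : Nonempty (Big ≃+* ℂ) := by
  have hc : Cardinal.mk Big = Cardinal.mk ℂ := by
    refine le_antisymm ?_ ?_
    · haveI := big_isAlgebraic
      haveI : FaithfulSMul ℂ[X] Big :=
        (faithfulSMul_iff_algebraMap_injective _ _).2 algebraMap_big_injective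
      refine (Algebra.IsAlgebraic.cardinalMk_le_max ℂ[X] Big).trans ?_
      refine max_le (Polynomial.cardinalMk_le_max.trans (max_le le_rfl ?_)) ?_ <;>
      exact Cardinal.aleph0_le_mk ℂ
    · exact Cardinal.mk_le_of_injective (f := fun x : ℂ => algebraMap ℂ[X] Big (C x))
        (algebraMap_big_injective.comp C_injective)
  haveI : CharZero Big := inferInstance
  refine IsAlgClosed.ringEquiv_of_equiv_of_charZero ?_ (Cardinal.eq.1 hc)
  rw [hc, Cardinal.mk_complex]
  exact Cardinal.aleph0_lt_continuum

lemma exists_valuationSubring_big (c : ℂ) : ∃ (V : ValuationSubring Big) (π : V →+* ℂ)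
    (j : ℂ[X] →+* V), (∀ P, (j P : Big) = algebraMap ℂ[X] Big P) ∧
      ∀ P, π (j P) = P.eval c := by
  set φ := algebraMap ℂ[X] Big with hφ
  set e : ℂ[X] ≃+* φ.range := RingEquiv.ofBijective φ.rangeRestrict
    ⟨fun x y h => algebraMap_big_injective (congrArg Subtype.val h), φ.rangeRestrict_surjective⟩
  set I : Ideal φ.range := (RingHom.ker (evalRingHom c)).comap (e.symm : φ.range →+* ℂ[X]) with hI
  have hIt : I ≠ ⊤ := Ideal.comap_ne_top _ (RingHom.ker_ne_top _)
  obtain ⟨V, hV, hVI⟩ := Ideal.image_subset_nonunits_valuationSubring I hIt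
  set j : ℂ[X] →+* V := φ.codRestrict V.toSubring (fun P => hV ⟨P, rfl⟩) with hj
  have hjc : ∀ P, (j P : Big) = φ P := fun P => rfl
  set res := IsLocalRing.residue V with hres
  have hj0 : ∀ P : ℂ[X], P.eval c = 0 → res (j P) = 0 := by
    intro P hP
    rw [hres, IsLocalRing.residue_eq_zero_iff, ← ValuationSubring.coe_mem_nonunits_iff]
    refine hVI ⟨e P, ?_, rfl⟩
    simp [hI, hP]
  set ι : ℂ →+* IsLocalRing.ResidueField V := (res.comp j).comp C with hι
  have hιj : ∀ P : ℂ[X], res (j P) = ι (P.eval c) := by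
    intro P
    have h := hj0 (P - C (P.eval c)) (by simp)
    rw [map_sub, map_sub, sub_eq_zero] at h
    exact h
  letI := ι.toAlgebra
  have hint : Algebra.IsIntegral ℂ (IsLocalRing.ResidueField V) := by
    refine ⟨fun y => ?_⟩
    obtain ⟨x, rfl⟩ := IsLocalRing.residue_surjective y
    obtain ⟨P, hP0, hP⟩ := big_isAlgebraic.isAlgebraic (x : Big)
    haveI : FaithfulSMul ℂ[X] Big :=
      (faithfulSMul_iff_algebraMap_injective _ _).2 algebraMap_big_injective
    classical
    letI : NormalizedGCDMonoid ℂ[X] := Classical.choice inferInstance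
    have hQ := aeval_primPart_eq_zero hP0 hP
    have hprim := P.isPrimitive_primPart
    set Q := P.primPart
    rw [← isAlgebraic_iff_isIntegral]
    refine ⟨Q.map (evalRingHom c), ?_, ?_⟩
    · intro h0
      have hd : C (X - C c : ℂ[X]) ∣ Q := by
        rw [C_dvd_iff_dvd_coeff]
        intro i
        rw [dvd_iff_isRoot, IsRoot]
        have := congrArg (fun R => R.coeff i) h0
        simpa [coeff_map] using this
      exact not_isUnit_X_sub_C c (hprim _ hd)
    · have h1 : eval₂ j x Q = 0 := by
        apply Subtype.val_injective
        have : V.subtype (eval₂ j x Q) = eval₂ φ (x : Big) Q := by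
          rw [hom_eval₂]; rfl
        exact this.trans hQ
      have h2 := congrArg res h1
      rw [hom_eval₂, map_zero] at h2
      rw [aeval_def, eval₂_map, ← h2]
      congr 1
      exact RingHom.ext fun R => (hιj R).symm
  have hbij := IsAlgClosed.algebraMap_bijective_of_isIntegral (k := ℂ)
    (K := IsLocalRing.ResidueField V)
  set E := RingEquiv.ofBijective (algebraMap ℂ (IsLocalRing.ResidueField V)) hbij
  refine ⟨V, (E.symm : _ →+* ℂ).comp res, j, hjc, fun P => ?_⟩
  simp only [RingHom.comp_apply, RingHom.coe_coe]
  rw [RingEquiv.symm_apply_eq]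
  exact hιj P

/-- The field `ℂ` embeds into itself in such a way that some complex number can be specialized
to any value. -/
theorem exists_specialization : ∃ (ι : ℂ →+* ℂ) (t : ℂ), ∀ c : ℂ, ∃ (V : ValuationSubring ℂ)
    (π : V →+* ℂ) (j : ℂ →+* V) (s : V), (∀ x, (j x : ℂ) = ι x) ∧ (s : ℂ) = t ∧
      (∀ x, π (j x) = x) ∧ π s = c := by
  obtain ⟨e⟩ := nonempty_big_equiv
  refine ⟨(e : Big →+* ℂ).comp ((algebraMap ℂ[X] Big).comp C), e (algebraMap ℂ[X] Big X),
    fun c => ?_⟩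
  obtain ⟨V, π, j, hj, hπ⟩ := exists_valuationSubring_big c
  set W := V.comap (e.symm : ℂ →+* Big) with hW
  let dn : W →+* V := ((e.symm : ℂ →+* Big).comp W.subtype).codRestrict V.toSubring fun x => x.2
  let up : V →+* W := ((e : Big →+* ℂ).comp V.subtype).codRestrict W.toSubring fun x => by
    change e.symm (e x) ∈ V; simp
  have hdn : ∀ x, dn (up x) = x := fun x => Subtype.ext (e.symm_apply_apply _)
  refine ⟨W, π.comp dn, up.comp (j.comp C), up (j X), fun x => ?_, ?_, fun x => ?_, ?_⟩
  · change e (j (C x)) = _; rw [hj]; rfl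
  · change e (j X) = _; rw [hj]
  · simp [hdn, hπ]
  · simp [hdn, hπ]

end Specialization

section Transfer

lemma exists_isUnit_minor {m n : Type*} [Fintype m] [DecidableEq m] [Fintype n]
    {N : Matrix m n ℂ} (hN : LinearIndependent ℂ N.row) :
    ∃ ι : m → n, IsUnit (N.submatrix id ι).det := by
  obtain ⟨κ, a, ha, hsp, hli⟩ := exists_linearIndependent' ℂ N.col
  have h1 : Submodule.span ℂ (Set.range N.col) = ⊤ := by
    apply Submodule.eq_top_of_finrank_eq
    rw [← rank_eq_finrank_span_cols, hN.rank_matrix, Module.finrank_fintype_fun_eq_card]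
  haveI : Finite κ := Finite.of_injective a ha
  haveI := Fintype.ofFinite κ
  have h2 : Fintype.card m = Fintype.card κ := by
    rw [← finrank_span_eq_card hli, hsp, h1, finrank_top, Module.finrank_fintype_fun_eq_card]
  set e := Fintype.equivOfCardEq h2
  refine ⟨a ∘ e, (isUnit_iff_isUnit_det _).1 ((linearIndependent_cols_iff_isUnit).1 ?_)⟩
  exact hli.comp e e.injective

variable (V : ValuationSubring ℂ) (π : V →+* ℂ)

lemma rank_map_specialization_le {m n : Type*} [Fintype m] [Fintype n] (M : Matrix m n V) :
    (M.map π).rank ≤ (M.map V.subtype).rank := by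
  obtain ⟨κ, a, ha, hsp, hli⟩ := exists_linearIndependent' ℂ (M.map π).col
  haveI : Finite κ := Finite.of_injective a ha
  haveI := Fintype.ofFinite κ
  have hli' : LinearIndependent ℂ ((M.map V.subtype).col ∘ a) := by
    rw [Fintype.linearIndependent_iff]
    intro g hg
    by_contra! hne
    obtain ⟨i0, hi0⟩ := hne
    haveI : Nonempty κ := ⟨i0⟩
    obtain ⟨i1, hi1⟩ := Finite.exists_max fun i => V.valuation (g i)
    have hg1 : g i1 ≠ 0 := by
      intro h
      have := hi1 i0
      rw [h, map_zero, le_zero_iff, Valuation.zero_iff] at this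
      exact hi0 this
    have hmem : ∀ i, g i / g i1 ∈ V := by
      intro i
      rw [← V.valuation_le_one_iff, map_div₀]
      exact div_le_one_of_le₀ (hi1 i) zero_le
    set g' : κ → V := fun i => ⟨g i / g i1, hmem i⟩ with hg'
    have hsum : ∀ x, ∑ i, g' i * M x (a i) = 0 := by
      intro x
      apply Subtype.val_injective
      have := congrFun hg x
      simp only [Finset.sum_apply, Pi.smul_apply, Function.comp_apply, smul_eq_mul,
        Pi.zero_apply] at this
      have h2 : V.subtype (∑ i, g' i * M x (a i)) =
          (∑ i, g i * (M.map V.subtype).col (a i) x) / g i1 := by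
        rw [map_sum, Finset.sum_div]
        refine Finset.sum_congr rfl fun i _ => ?_
        simp [hg', Matrix.col]; ring
      rw [this, zero_div] at h2
      exact h2
    have h3 := Fintype.linearIndependent_iff.1 hli (fun i => π (g' i)) (by
      funext x
      have := congrArg π (hsum x)
      rw [map_sum, map_zero] at this
      simpa only [map_mul, Finset.sum_apply, Pi.smul_apply, smul_eq_mul] using! this) i1
    have h4 : g' i1 = 1 := Subtype.ext (div_self hg1)
    rw [h4, map_one] at h3
    exact one_ne_zero h3
  rw [rank_eq_finrank_span_cols, rank_eq_finrank_span_cols, ← hsp, finrank_span_eq_card hli,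
    ← finrank_span_eq_card hli']
  exact Submodule.finrank_mono (Submodule.span_mono (Set.range_comp_subset_range _ _))

/-- Rows can be normalized to have an identity block and entries in a valuation ring. -/
lemma exists_integral_normal_form {m n : Type*} [Fintype m] [DecidableEq m] [Fintype n]
    {N : Matrix m n ℂ} (hN : LinearIndependent ℂ N.row) :
    ∃ (L : Matrix m m ℂ) (N' : Matrix m n V) (ι : m → n), IsUnit L.det ∧
      L * N = N'.map V.subtype ∧ N'.submatrix id ι = 1 := by
  obtain ⟨ι0, hι0⟩ := exists_isUnit_minor hN
  haveI : Nonempty (m → n) := ⟨ι0⟩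
  obtain ⟨ι, hι⟩ := Finite.exists_max fun ι : m → n => V.valuation (N.submatrix id ι).det
  set M := N.submatrix id ι with hM
  have hM0 : M.det ≠ 0 := by
    intro h
    have := hι ι0
    rw [h, map_zero, le_zero_iff, Valuation.zero_iff] at this
    exact hι0.ne_zero this
  have hMu : IsUnit M.det := isUnit_iff_ne_zero.2 hM0
  have hmem : ∀ i j, (M⁻¹ * N) i j ∈ V := by
    intro i j
    have h1 : (M⁻¹ * N) i j = (N.submatrix id (Function.update ι i j)).det / M.det := by
      have h2 : (M⁻¹ * N) i j = (M⁻¹ *ᵥ N.col j) i := rfl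
      have h3 : N.submatrix id (Function.update ι i j) = M.updateCol i (N.col j) := by
        ext x y
        by_cases hy : y = i
        · subst hy; simp [Matrix.col]
        · simp [hy, hM]
      rw [h2, h3, Matrix.inv_def, Matrix.smul_mulVec, ← cramer_eq_adjugate_mulVec, Pi.smul_apply,
        cramer_apply, Ring.inverse_eq_inv', smul_eq_mul, div_eq_inv_mul]
    rw [h1, ← V.valuation_le_one_iff, map_div₀]
    exact div_le_one_of_le₀ (hι _) zero_le
  refine ⟨M⁻¹, fun i j => ⟨_, hmem i j⟩, ι, ?_, rfl, ?_⟩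
  · rw [det_nonsing_inv]; exact hMu.ringInverse
  · ext i j
    have h : (M⁻¹ * N) i (ι j) = (1 : Matrix m m ℂ) i j := by
      rw [← nonsing_inv_mul M hMu]; rfl
    refine h.trans ?_
    simp only [Matrix.one_apply]
    split_ifs <;> rfl

lemma sl_specialization_le {m : Type*} [Fintype m] [DecidableEq m] {n : ℕ} {w : Fin n → ℝ}
    (hw : Antitone w) (N : Matrix m (Fin n) V) {ι : m → Fin n} (hN : N.submatrix id ι = 1)
    (f : Matrix (Fin n) (Fin n) V) (hf : (f.map π).det ≠ 0) :
    sl w (N.map π * f.map π) ≤ sl w (N.map V.subtype * f.map V.subtype) := by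
  have hf' : (f.map V.subtype).det ≠ 0 := by
    have e1 : (f.map π).det = π f.det := (RingHom.map_det π f).symm
    have e2 : (f.map V.subtype).det = V.subtype f.det := (RingHom.map_det V.subtype f).symm
    rw [e2]
    intro h
    have : f.det = 0 := Subtype.val_injective h
    rw [e1, this, map_zero] at hf
    exact hf rfl
  have hrank : ∀ (ρ : V →+* ℂ), (f.map ρ).det ≠ 0 →
      (N.map ρ * f.map ρ).rank = Fintype.card m := by
    intro ρ hρ
    rw [rank_mul_eq_left_of_isUnit_det _ _ (isUnit_iff_ne_zero.2 hρ)]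
    refine le_antisymm (rank_le_card_height _) ?_
    have h1 := rank_submatrix_le (N.map ρ) id ι
    have h2 : (N.map ρ).submatrix id ι = 1 := by
      rw [submatrix_map, hN, Matrix.map_one _ (map_zero ρ) (map_one ρ)]
    rwa [h2, rank_one] at h1
  refine slope_mono w hw _ _ ?_ ?_ fun k _ => ?_
  · simp [preRank_zero]
  · simp only [preRank_self, hrank π hf, hrank V.subtype hf']
  · have key : ∀ ρ : V →+* ℂ, (N.map ρ * f.map ρ).submatrix id (pre n k) =
        ((N * f).submatrix id (pre n k)).map ρ := by
      intro ρ
      rw [← Matrix.map_mul, submatrix_map]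
    simp only [preRank, key, Nat.cast_le]
    exact rank_map_specialization_le V π _

end Transfer

section Config

variable {p q : ℕ}

/-- Semistability lifts along specializations. -/
lemma Config.Numeric.of_specialization (V : ValuationSubring ℂ) (π : V →+* ℂ)
    {fA fB : Matrix (Fin p) (Fin p) V} {gA gB : Matrix (Fin q) (Fin q) V}
    {X : Matrix (Fin p) (Fin q) V}
    {a₁ b₁ c₁ : Fin p → ℝ} {a₂ b₂ c₂ : Fin q → ℝ}
    (ha₁ : Antitone a₁) (hb₁ : Antitone b₁) (hc₁ : Antitone c₁)
    (ha₂ : Antitone a₂) (hb₂ : Antitone b₂) (hc₂ : Antitone c₂)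
    (hinv : Config.Invertible ⟨fA.map π, fB.map π, gA.map π, gB.map π, X.map π⟩)
    (h : Config.Numeric ⟨fA.map π, fB.map π, gA.map π, gB.map π, X.map π⟩ a₁ b₁ c₁ a₂ b₂ c₂) :
    Config.Numeric ⟨fA.map V.subtype, fB.map V.subtype, gA.map V.subtype, gB.map V.subtype,
      X.map V.subtype⟩ a₁ b₁ c₁ a₂ b₂ c₂ := by
  intro m₁ m₂ _ _ N₁ N₂ R hN₁ hN₂ hR
  classical
  obtain ⟨L₁, N₁', ι₁, hL₁, e₁, i₁⟩ := exists_integral_normal_form V hN₁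
  obtain ⟨L₂, N₂', ι₂, hL₂, e₂, i₂⟩ := exists_integral_normal_form V hN₂
  dsimp only at hR
  have hR' : N₁' * X = (N₁' * X).submatrix id ι₂ * N₂' := by
    have h1 : N₁'.map V.subtype * X.map V.subtype = (L₁ * R * L₂⁻¹) * N₂'.map V.subtype := by
      rw [← e₁, ← e₂, Matrix.mul_assoc, hR, Matrix.mul_assoc _ _ (L₂ * N₂), ← Matrix.mul_assoc L₂⁻¹,
        nonsing_inv_mul _ hL₂, Matrix.one_mul, Matrix.mul_assoc]
    have h2 : ((N₁' * X).submatrix id ι₂).map V.subtype = L₁ * R * L₂⁻¹ := by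
      rw [← submatrix_map, Matrix.map_mul, h1]
      have : (L₁ * R * L₂⁻¹ * N₂'.map V.subtype).submatrix id ι₂ =
        L₁ * R * L₂⁻¹ * ((N₂'.submatrix id ι₂).map V.subtype) := rfl
      rw [this, i₂, Matrix.map_one _ (map_zero _) (map_one _), Matrix.mul_one]
    apply Matrix.map_injective (f := V.subtype) Subtype.val_injective
    dsimp only
    rw [Matrix.map_mul, Matrix.map_mul, h2, h1]
  have hindep : ∀ {m : Type} {n : ℕ} [Fintype m] [DecidableEq m] (N : Matrix m (Fin n) V)
      (ι : m → Fin n), N.submatrix id ι = 1 → LinearIndependent ℂ (N.map π).row := by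
    intro m n _ _ N ι hN
    have h2 : (N.map π).submatrix id ι = 1 := by
      rw [submatrix_map, hN, Matrix.map_one _ (map_zero π) (map_one π)]
    have h3 : LinearIndependent ℂ ((N.map π).submatrix id ι).row :=
      linearIndependent_rows_iff_isUnit.2 (by rw [h2]; exact isUnit_one)
    exact LinearIndependent.of_comp (LinearMap.funLeft ℂ ℂ ι) h3
  have h0 := h m₁ m₂ (N₁'.map π) (N₂'.map π) (((N₁' * X).submatrix id ι₂).map π)
    (hindep _ _ i₁) (hindep _ _ i₂) (by
      dsimp only; rw [← Matrix.map_mul, ← Matrix.map_mul, ← hR'])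
  refine h0.trans ?_
  simp only [Config.num]
  have one : ∀ n : ℕ, ((1 : Matrix (Fin n) (Fin n) V).map π).det ≠ 0 := by
    intro n; rw [Matrix.map_one _ (map_zero _) (map_one _)]; simp
  have s1 := sl_specialization_le V π hc₁ N₁' i₁ 1 (one p)
  have s2 := sl_specialization_le V π hc₂ N₂' i₂ 1 (one q)
  rw [Matrix.map_one _ (map_zero _) (map_one _), Matrix.map_one _ (map_zero _) (map_one _),
    Matrix.mul_one, Matrix.mul_one] at s1 s2
  have t : ∀ {m : Type} {n : ℕ} [Fintype m] [DecidableEq m] (L : Matrix m m ℂ) (_ : IsUnit L.det)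
      (N : Matrix m (Fin n) ℂ) (N' : Matrix m (Fin n) V) (_ : L * N = N'.map V.subtype)
      (w : Fin n → ℝ) (F : Matrix (Fin n) (Fin n) ℂ),
      sl w (N * F) = sl w (N'.map V.subtype * F) := by
    intro m n _ _ L hL N N' e w F
    rw [← e, Matrix.mul_assoc, sl_mul_left w L hL]
  have t1 := t L₁ hL₁ N₁ N₁' e₁ c₁ 1
  have t2 := t L₂ hL₂ N₂ N₂' e₂ c₂ 1
  rw [Matrix.mul_one, Matrix.mul_one] at t1 t2
  rw [t L₁ hL₁ N₁ N₁' e₁, t L₁ hL₁ N₁ N₁' e₁, t L₂ hL₂ N₂ N₂' e₂, t L₂ hL₂ N₂ N₂' e₂, t1, t2]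
  have u1 := sl_specialization_le V π ha₁ N₁' i₁ fA hinv.fA
  have u2 := sl_specialization_le V π hb₁ N₁' i₁ fB hinv.fB
  have u3 := sl_specialization_le V π ha₂ N₂' i₂ gA hinv.gA
  have u4 := sl_specialization_le V π hb₂ N₂' i₂ gB hinv.gB
  linarith

lemma sl_combo {m : Type*} {n : ℕ} (s t : ℝ) (v w : Fin n → ℝ) (M : Matrix m (Fin n) ℂ) :
    sl (s • v + t • w) M = s * sl v M + t * sl w M := by
  simp only [sl, slope_add_left, slope_smul_left]

/-- Semistability for two sets of weights can be realized on a single configuration, which is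
then semistable for all intermediate weights. -/
theorem exists_numeric_combo {a₁ b₁ c₁ c₁' : Fin p → ℝ} {a₂ b₂ c₂ c₂' : Fin q → ℝ}
    (ha₁ : Antitone a₁) (hb₁ : Antitone b₁) (hc₁ : Antitone c₁) (hc₁' : Antitone c₁')
    (ha₂ : Antitone a₂) (hb₂ : Antitone b₂) (hc₂ : Antitone c₂) (hc₂' : Antitone c₂')
    {D D' : Config p q} (hD : D.Invertible) (hD' : D'.Invertible)
    (h : D.Numeric a₁ b₁ c₁ a₂ b₂ c₂) (h' : D'.Numeric a₁ b₁ c₁' a₂ b₂ c₂')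
    {s t : ℝ} (hs : 0 ≤ s) (ht : 0 ≤ t) (hst : s + t = 1) :
    ∃ E : Config p q, E.Invertible ∧
      E.Numeric a₁ b₁ (s • c₁ + t • c₁') a₂ b₂ (s • c₂ + t • c₂') := by
  obtain ⟨ι, τ, H⟩ := exists_specialization
  let mix : ∀ {m n : ℕ} (_ _ : Matrix (Fin m) (Fin n) ℂ), Matrix (Fin m) (Fin n) ℂ :=
    fun M M' => M.map ι + τ • (M'.map ι - M.map ι)
  let E : Config p q := ⟨mix D.fA D'.fA, mix D.fB D'.fB, mix D.gA D'.gA, mix D.gB D'.gB,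
    mix D.X D'.X⟩
  have lift : ∀ c : ℂ, ∃ (V : ValuationSubring ℂ) (π : V →+* ℂ), ∀ {m n : ℕ}
      (M M' : Matrix (Fin m) (Fin n) ℂ), ∃ Z : Matrix (Fin m) (Fin n) V,
      mix M M' = Z.map V.subtype ∧ Z.map π = M + c • (M' - M) := by
    intro c
    obtain ⟨V, π, j, σ, h1, h2, h3, h4⟩ := H c
    refine ⟨V, π, fun M M' => ⟨M.map j + σ • (M'.map j - M.map j), ?_, ?_⟩⟩
    · ext x y; simp [mix, h1, h2]
    · ext x y; simp [h3, h4]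
  have key : ∀ (c : ℂ) (D₀ : Config p q) (e₁ : Fin p → ℝ) (e₂ : Fin q → ℝ), Antitone e₁ →
      Antitone e₂ → D₀ = ⟨D.fA + c • (D'.fA - D.fA), D.fB + c • (D'.fB - D.fB),
        D.gA + c • (D'.gA - D.gA), D.gB + c • (D'.gB - D.gB), D.X + c • (D'.X - D.X)⟩ →
      D₀.Invertible → D₀.Numeric a₁ b₁ e₁ a₂ b₂ e₂ →
        E.Invertible ∧ E.Numeric a₁ b₁ e₁ a₂ b₂ e₂ := by
    intro c D₀ e₁ e₂ he₁ he₂ hD₀ hinv hnum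
    obtain ⟨V, π, hV⟩ := lift c
    obtain ⟨fA, hfA, hfA'⟩ := hV D.fA D'.fA
    obtain ⟨fB, hfB, hfB'⟩ := hV D.fB D'.fB
    obtain ⟨gA, hgA, hgA'⟩ := hV D.gA D'.gA
    obtain ⟨gB, hgB, hgB'⟩ := hV D.gB D'.gB
    obtain ⟨X, hX, hX'⟩ := hV D.X D'.X
    rw [← hfA', ← hfB', ← hgA', ← hgB', ← hX'] at hD₀
    subst hD₀
    have hE : E = ⟨fA.map V.subtype, fB.map V.subtype, gA.map V.subtype, gB.map V.subtype,
      X.map V.subtype⟩ := by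
      simp only [E, hfA, hfB, hgA, hgB, hX]
    rw [hE]
    refine ⟨?_, Config.Numeric.of_specialization V π ha₁ hb₁ he₁ ha₂ hb₂ he₂ hinv hnum⟩
    have hdet : ∀ {n : ℕ} (M : Matrix (Fin n) (Fin n) V), (M.map π).det ≠ 0 →
        (M.map V.subtype).det ≠ 0 := by
      intro n M hM h0
      have e1 : (M.map π).det = π M.det := (RingHom.map_det π M).symm
      have e2 : (M.map V.subtype).det = V.subtype M.det := (RingHom.map_det V.subtype M).symm
      rw [e2] at h0
      have : M.det = 0 := Subtype.val_injective h0
      rw [e1, this, map_zero] at hM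
      exact hM rfl
    exact ⟨hdet _ hinv.fA, hdet _ hinv.fB, hdet _ hinv.gA, hdet _ hinv.gB⟩
  obtain ⟨hE, h1⟩ := key 0 D c₁ c₂ hc₁ hc₂ (by simp) hD h
  obtain ⟨-, h2⟩ := key 1 D' c₁' c₂' hc₁' hc₂' (by simp) hD' h'
  refine ⟨E, hE, fun m₁ m₂ _ _ N₁ N₂ R hN₁ hN₂ hR => ?_⟩
  have n1 := h1 m₁ m₂ N₁ N₂ R hN₁ hN₂ hR
  have n2 := h2 m₁ m₂ N₁ N₂ R hN₁ hN₂ hR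
  have n3 := add_nonneg (mul_nonneg hs n1) (mul_nonneg ht n2)
  simp only [Config.num, sl_combo] at n3 ⊢
  refine n3.trans_eq ?_
  obtain rfl : t = 1 - s := by linarith
  ring

end Config

section Minors

variable {n : ℕ}

/-- The leading principal minors. -/
def minor (M : Matrix (Fin n) (Fin n) ℂ) (k : ℕ) : ℂ := (M.submatrix (pre n k) (pre n k)).det

/-- The weighted sum of the increments of the logarithms of the leading principal minors. -/
def ell (w : Fin n → ℝ) (M : Matrix (Fin n) (Fin n) ℂ) : ℝ :=
  slope w fun k => Real.log ‖minor M k‖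

/-- The product of the first diagonal entries. -/
def diagProd (b : Matrix (Fin n) (Fin n) ℂ) (k : ℕ) : ℂ := ∏ i : {j : Fin n // j.val < k}, b i i

lemma submatrix_mul_of_upper {b : Matrix (Fin n) (Fin n) ℂ} (hb : b.IsUpperTriangular)
    {m : Type*} (M : Matrix m (Fin n) ℂ) (k : ℕ) :
    (M * b).submatrix id (pre n k) =
      M.submatrix id (pre n k) * b.submatrix (pre n k) (pre n k) := by
  ext i j
  simp only [submatrix_apply, Matrix.mul_apply, id]
  rw [← Finset.sum_subset (Finset.subset_univ (Finset.univ.filter fun l : Fin n => l.val < k))]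
  · exact Finset.sum_subtype _ (by simp) (fun l => M i l * b l j.1)
  · intro l _ hl
    have : (j : Fin n) < l := by
      have := j.2
      simp only [Finset.mem_filter, Finset.mem_univ, true_and, not_lt] at hl
      exact Fin.lt_def.2 (by omega)
    rw [show b l j.1 = 0 from hb this, mul_zero]

lemma submatrix_conj_of_upper {b : Matrix (Fin n) (Fin n) ℂ} (hb : b.IsUpperTriangular)
    (M : Matrix (Fin n) (Fin n) ℂ) (k : ℕ) :
    (bᴴ * M * b).submatrix (pre n k) (pre n k) = (b.submatrix (pre n k) (pre n k))ᴴ *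
      M.submatrix (pre n k) (pre n k) * b.submatrix (pre n k) (pre n k) := by
  have h1 : (bᴴ * M * b).submatrix (pre n k) (pre n k) =
      (((Mᴴ * b).submatrix id (pre n k))ᴴ * b).submatrix id (pre n k) := by
    ext i j
    simp only [submatrix_apply, id, Matrix.mul_apply, conjTranspose_apply, star_sum, star_mul',
      star_star]
    exact Finset.sum_congr rfl fun x _ => by
      congr 1; exact Finset.sum_congr rfl fun y _ => mul_comm _ _
  rw [h1, submatrix_mul_of_upper hb, submatrix_mul_of_upper hb]
  congr 1
  ext i j
  simp only [submatrix_apply, id, Matrix.mul_apply, conjTranspose_apply, star_sum, star_mul',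
      star_star]
  exact Finset.sum_congr rfl fun x _ => mul_comm _ _

lemma minor_upper {b : Matrix (Fin n) (Fin n) ℂ} (hb : b.IsUpperTriangular) (k : ℕ) :
    minor b k = diagProd b k :=
  det_of_isUpperTriangular fun _ _ h => hb h

lemma minor_conj_of_upper {b : Matrix (Fin n) (Fin n) ℂ} (hb : b.IsUpperTriangular)
    (M : Matrix (Fin n) (Fin n) ℂ) (k : ℕ) :
    minor (bᴴ * M * b) k = star (diagProd b k) * minor M k * diagProd b k := by
  rw [← minor_upper hb, minor, submatrix_conj_of_upper hb, det_mul, det_mul, det_conjTranspose]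
  rfl

lemma diagProd_ne_zero {b : Matrix (Fin n) (Fin n) ℂ} (hb : ∀ i, b i i ≠ 0) (k : ℕ) :
    diagProd b k ≠ 0 := Finset.prod_ne_zero_iff.2 fun i _ => hb i

lemma log_diagProd {b : Matrix (Fin n) (Fin n) ℂ} (hb : ∀ i, b i i ≠ 0) (k : ℕ) :
    Real.log ‖diagProd b k‖ = ∑ j, if j.val < k then Real.log ‖b j j‖ else 0 := by
  rw [diagProd, norm_prod, Real.log_prod (f := fun i : {j : Fin n // j.val < k} => ‖b i i‖)
    fun i _ => norm_ne_zero_iff.2 (hb i)]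
  exact sum_pre_eq (fun j => Real.log ‖b j j‖) k

lemma ell_conj_of_upper (w : Fin n → ℝ) {b : Matrix (Fin n) (Fin n) ℂ} (hb : b.IsUpperTriangular)
    (hd : ∀ i, b i i ≠ 0) (M : Matrix (Fin n) (Fin n) ℂ) (hM : ∀ k, minor M k ≠ 0) :
    ell w (bᴴ * M * b) = ∑ i, w i * (2 * Real.log ‖b i i‖) + ell w M := by
  have h : ∀ k, Real.log ‖minor (bᴴ * M * b) k‖ =
      (∑ j, if j.val < k then 2 * Real.log ‖b j j‖ else 0) + Real.log ‖minor M k‖ := by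
    intro k
    have h0 := norm_ne_zero_iff.2 (diagProd_ne_zero hd k)
    rw [minor_conj_of_upper hb, norm_mul, norm_mul, norm_star,
      Real.log_mul (mul_ne_zero h0 (norm_ne_zero_iff.2 (hM k))) h0,
      Real.log_mul h0 (norm_ne_zero_iff.2 (hM k)), log_diagProd hd]
    have : (∑ j : Fin n, if j.val < k then 2 * Real.log ‖b j j‖ else 0) =
        2 * ∑ j : Fin n, if j.val < k then Real.log ‖b j j‖ else 0 := by
      rw [Finset.mul_sum]; exact Finset.sum_congr rfl fun j _ => by split_ifs <;> simp
    rw [this]; ring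
  rw [ell, ell, ← slope_partial_sums, ← slope_add_right]
  exact congrArg _ (funext h)

lemma minor_diagonal (d : Fin n → ℂ) (k : ℕ) : minor (diagonal d) k = diagProd (diagonal d) k :=
  minor_upper (blockTriangular_diagonal _) k

lemma norm_minor_sign {d : Fin n → ℂ} (hd : ∀ i, ‖d i‖ = 1) (k : ℕ) :
    ‖minor (diagonal d) k‖ = 1 := by
  rw [minor_diagonal, diagProd, norm_prod]
  exact Finset.prod_eq_one fun i _ => by simp [hd]

lemma ell_sign_conj (w : Fin n → ℝ) {b : Matrix (Fin n) (Fin n) ℂ} (hb : b.IsUpperTriangular)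
    (hd : ∀ i, b i i ≠ 0) {d : Fin n → ℂ} (hs : ∀ i, ‖d i‖ = 1) :
    ell w (bᴴ * diagonal d * b) = ∑ i, w i * (2 * Real.log ‖b i i‖) := by
  rw [ell_conj_of_upper w hb hd _ fun k h => by simpa [h] using norm_minor_sign hs k]
  have : ell w (diagonal d) = 0 := by simp [ell, norm_minor_sign hs, slope]
  rw [this, add_zero]

lemma minor_sign_conj_ne_zero {b : Matrix (Fin n) (Fin n) ℂ} (hb : b.IsUpperTriangular)
    (hd : ∀ i, b i i ≠ 0) {d : Fin n → ℂ} (hs : ∀ i, ‖d i‖ = 1) (k : ℕ) :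
    minor (bᴴ * diagonal d * b) k ≠ 0 := by
  rw [minor_conj_of_upper hb]
  have h1 := diagProd_ne_zero hd k
  have h2 : minor (diagonal d) k ≠ 0 := fun h => by simpa [h] using norm_minor_sign hs k
  exact mul_ne_zero (mul_ne_zero (star_ne_zero.2 h1) h2) h1

lemma ell_upper (w : Fin n → ℝ) {b : Matrix (Fin n) (Fin n) ℂ} (hb : b.IsUpperTriangular)
    (hd : ∀ i, b i i ≠ 0) : ell w (bᴴ * b) = ∑ i, w i * (2 * Real.log ‖b i i‖) := by
  have := ell_sign_conj w hb hd (d := fun _ => 1) (by simp)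
  simpa using this

lemma isUpper_inv {b : Matrix (Fin n) (Fin n) ℂ} (hb : b.IsUpperTriangular)
    (hd : IsUnit b.det) : b⁻¹.IsUpperTriangular := by
  haveI := b.invertibleOfIsUnitDet hd
  exact blockTriangular_inv_of_blockTriangular hb

lemma isUnit_det_of_upper {b : Matrix (Fin n) (Fin n) ℂ} (hb : b.IsUpperTriangular)
    (hd : ∀ i, b i i ≠ 0) : IsUnit b.det := by
  rw [det_of_isUpperTriangular hb]
  exact isUnit_iff_ne_zero.2 (Finset.prod_ne_zero_iff.2 fun i _ => hd i)

lemma diag_ne_zero_of_upper {b : Matrix (Fin n) (Fin n) ℂ} (hb : b.IsUpperTriangular)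
    (hd : IsUnit b.det) (i : Fin n) : b i i ≠ 0 := by
  rw [det_of_isUpperTriangular hb] at hd
  exact Finset.prod_ne_zero_iff.1 hd.ne_zero i (Finset.mem_univ i)

lemma upper_mul_diag {b c : Matrix (Fin n) (Fin n) ℂ} (hb : b.IsUpperTriangular)
    (hc : c.IsUpperTriangular) (i : Fin n) : (b * c) i i = b i i * c i i := by
  rw [Matrix.mul_apply, Finset.sum_eq_single i]
  · intro j _ hj
    rcases lt_or_gt_of_ne hj with h | h
    · rw [show b i j = 0 from hb h, zero_mul]
    · rw [show c j i = 0 from hc h, mul_zero]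
  · simp

/-- Cholesky decomposition. -/
lemma PosDef.exists_cholesky {M : Matrix (Fin n) (Fin n) ℂ} (hM : M.PosDef) :
    ∃ b : Matrix (Fin n) (Fin n) ℂ, b.IsUpperTriangular ∧ (∀ i, b i i ≠ 0) ∧ M = bᴴ * b := by
  set V := LDL.lowerInv hM with hV
  have hVu : IsUnit V.det := isUnit_det_of_invertible V
  have hD := LDL.diag_eq_lowerInv_conj hM
  have hpd : (LDL.diag hM).PosDef := by
    rw [hD]
    refine hM.mul_mul_conjTranspose_same (vecMul_injective_of_isUnit ?_)
    exact (isUnit_iff_isUnit_det _).2 hVu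
  have hpos : ∀ i, 0 < LDL.diagEntries hM i := by
    rw [LDL.diag, posDef_diagonal_iff] at hpd; exact hpd
  set r : Fin n → ℂ := fun i => ((Real.sqrt (LDL.diagEntries hM i).re : ℝ) : ℂ) with hr
  have hr2 : ∀ i, r i * r i = LDL.diagEntries hM i := by
    intro i
    have h := Complex.lt_def.1 (hpos i)
    rw [hr]
    simp only
    rw [← Complex.ofReal_mul, Real.mul_self_sqrt h.1.le]
    exact Complex.ext rfl h.2
  have hr0 : ∀ i, r i ≠ 0 := fun i h => (hpos i).ne' (by rw [← hr2, h, zero_mul])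
  have hrs : (diagonal r)ᴴ = diagonal r := by
    rw [diagonal_conjTranspose]; congr 1; funext i; simp [hr]
  have hup : Vᴴ.IsUpperTriangular := by
    intro i j hij
    have hij' : j < i := hij
    have h0 : V j i = 0 := LDL.lowerInv_triangular hM hij'
    rw [conjTranspose_apply, h0, star_zero]
  have hVHu : IsUnit Vᴴ.det := by rw [det_conjTranspose]; exact hVu.star
  have hb : (diagonal r * (Vᴴ)⁻¹).IsUpperTriangular :=
    (blockTriangular_diagonal _).mul (isUpper_inv hup hVHu)
  refine ⟨diagonal r * (Vᴴ)⁻¹, hb, diag_ne_zero_of_upper hb ?_, ?_⟩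
  · rw [det_mul]
    refine IsUnit.mul ?_ (isUnit_nonsing_inv_det _ hVHu)
    rw [det_diagonal]
    exact isUnit_iff_ne_zero.2 (Finset.prod_ne_zero_iff.2 fun i _ => hr0 i)
  · have h1 : diagonal r * diagonal r = LDL.diag hM := by
      rw [diagonal_mul_diagonal, LDL.diag]; congr 1; exact funext hr2
    have h2 : V⁻¹ * LDL.diag hM * (V⁻¹)ᴴ = M := LDL.lower_conj_diag hM
    rw [conjTranspose_mul, hrs, conjTranspose_nonsing_inv, conjTranspose_conjTranspose,
      Matrix.mul_assoc, ← Matrix.mul_assoc (diagonal r), h1, ← Matrix.mul_assoc,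
      ← conjTranspose_nonsing_inv, h2]

/-- Comparison of Cholesky factors. -/
lemma PosDef.exists_contraction {A B : Matrix (Fin n) (Fin n) ℂ} (hA : A.PosDef) (hB : B.PosDef)
    (hAB : (B - A).PosSemidef) : ∃ d : Fin n → ℝ, (∀ i, d i ≤ 0) ∧
      (∀ w : Fin n → ℝ, ell w A = ell w B + ∑ i, w i * d i) ∧
      (B⁻¹ * (B - A)).trace.re ≤ ∑ i, - d i := by
  obtain ⟨α, hα, hα0, rfl⟩ := PosDef.exists_cholesky hA
  obtain ⟨β, hβ, hβ0, rfl⟩ := PosDef.exists_cholesky hB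
  have hβu := isUnit_det_of_upper hβ hβ0
  have hβHu : IsUnit βᴴ.det := by rw [det_conjTranspose]; exact hβu.star
  set γ := α * β⁻¹ with hγ
  have hγβ : α = γ * β := by rw [hγ, Matrix.mul_assoc, nonsing_inv_mul _ hβu, Matrix.mul_one]
  have hγu : γ.IsUpperTriangular := hα.mul (isUpper_inv hβ hβu)
  have hdiag : ∀ i, α i i = γ i i * β i i := fun i => by rw [hγβ, upper_mul_diag hγu hβ]
  have hγ0 : ∀ i, γ i i ≠ 0 := fun i h => hα0 i (by rw [hdiag, h, zero_mul])
  have hcon : (1 - γᴴ * γ).PosSemidef := by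
    have h1 := hAB.conjTranspose_mul_mul_same β⁻¹
    have h2 : (β⁻¹)ᴴ * (βᴴ * β - αᴴ * α) * β⁻¹ = 1 - γᴴ * γ := by
      rw [Matrix.mul_sub, Matrix.sub_mul, hγ, conjTranspose_mul, ← Matrix.mul_assoc,
        ← conjTranspose_mul, mul_nonsing_inv _ hβu, conjTranspose_one, Matrix.one_mul,
        mul_nonsing_inv _ hβu]
      simp only [Matrix.mul_assoc]
    rwa [h2] at h1
  have hcol : ∀ i, (γᴴ * γ) i i = ((∑ j, ‖γ j i‖ ^ 2 : ℝ) : ℂ) := by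
    intro i
    rw [Matrix.mul_apply, Complex.ofReal_sum]
    refine Finset.sum_congr rfl fun j _ => ?_
    rw [conjTranspose_apply, Complex.ofReal_pow]
    exact Complex.conj_mul' _
  have hle : ∀ i, ‖γ i i‖ ^ 2 ≤ ∑ j, ‖γ j i‖ ^ 2 := fun i =>
    Finset.single_le_sum (f := fun j => ‖γ j i‖ ^ 2) (fun j _ => sq_nonneg _) (Finset.mem_univ i)
  have hone : ∀ i, ∑ j, ‖γ j i‖ ^ 2 ≤ 1 := by
    intro i
    have h := hcon.diag_nonneg (i := i)
    rw [Matrix.sub_apply, Matrix.one_apply_eq, hcol] at h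
    have := (Complex.le_def.1 h).1
    simp only [Complex.zero_re, Complex.sub_re, Complex.one_re, Complex.ofReal_re] at this
    linarith
  have hpos : ∀ i, 0 < ‖γ i i‖ := fun i => norm_pos_iff.2 (hγ0 i)
  refine ⟨fun i => 2 * Real.log ‖γ i i‖, fun i => ?_, fun w => ?_, ?_⟩
  · have h1 : ‖γ i i‖ ≤ 1 := by nlinarith [hle i, hone i, hpos i]
    have := Real.log_nonpos (hpos i).le h1
    linarith
  · rw [ell_upper w hα hα0, ell_upper w hβ hβ0, ← Finset.sum_add_distrib]
    refine Finset.sum_congr rfl fun i _ => ?_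
    rw [hdiag, norm_mul, Real.log_mul (hpos i).ne' (norm_ne_zero_iff.2 (hβ0 i))]
    ring
  · have h1 : ((βᴴ * β)⁻¹ * (βᴴ * β - αᴴ * α)).trace = (1 - γᴴ * γ).trace := by
      have : βᴴ * β - αᴴ * α = βᴴ * (1 - γᴴ * γ) * β := by
        rw [Matrix.mul_sub, Matrix.sub_mul, Matrix.mul_one]
        congr 1
        rw [hγβ, conjTranspose_mul]; simp only [Matrix.mul_assoc]
      rw [this, Matrix.mul_inv_rev, ← Matrix.mul_assoc, Matrix.trace_mul_comm]
      congr 1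
      rw [Matrix.mul_assoc, ← Matrix.mul_assoc (βᴴ)⁻¹, nonsing_inv_mul _ hβHu, Matrix.one_mul,
        ← Matrix.mul_assoc, mul_nonsing_inv _ hβu, Matrix.one_mul]
    rw [h1, Matrix.trace, Complex.re_sum]
    refine Finset.sum_le_sum fun i _ => ?_
    rw [diag_apply, Matrix.sub_apply, Matrix.one_apply_eq, hcol]
    simp only [Complex.sub_re, Complex.one_re, Complex.ofReal_re]
    have h3 := Real.log_le_sub_one_of_pos (pow_pos (hpos i) 2)
    rw [Real.log_pow] at h3
    have := hle i
    push_cast at h3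
    linarith

lemma ell_mono {w : Fin n → ℝ} (hw : ∀ i, 0 ≤ w i) {A B : Matrix (Fin n) (Fin n) ℂ}
    (hA : A.PosDef) (hB : B.PosDef) (hAB : (B - A).PosSemidef) : ell w A ≤ ell w B := by
  obtain ⟨d, hd, h, -⟩ := PosDef.exists_contraction hA hB hAB
  rw [h]
  have := Finset.sum_nonpos fun i (_ : i ∈ Finset.univ) =>
    mul_nonpos_of_nonneg_of_nonpos (hw i) (hd i)
  linarith

/-- The logarithm of the determinant. -/
def ld (M : Matrix (Fin n) (Fin n) ℂ) : ℝ := ell (fun _ => 1) M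

lemma ell_gap {w : Fin n → ℝ} {c : ℝ} (hw : ∀ i, w i ≤ -c) {A B : Matrix (Fin n) (Fin n) ℂ}
    (hA : A.PosDef) (hB : B.PosDef) (hAB : (B - A).PosSemidef) :
    ell w B + c * (ld B - ld A) ≤ ell w A := by
  obtain ⟨d, hd, h, -⟩ := PosDef.exists_contraction hA hB hAB
  rw [ld, ld, h, h]
  have := Finset.sum_nonneg fun i (_ : i ∈ Finset.univ) =>
    mul_nonneg_of_nonpos_of_nonpos (by linarith [hw i] : w i + c ≤ 0) (hd i)
  simp only [add_mul, Finset.sum_add_distrib, ← Finset.mul_sum] at this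
  simp only [one_mul]
  linarith

lemma trace_le_ld_sub {A B : Matrix (Fin n) (Fin n) ℂ}
    (hA : A.PosDef) (hB : B.PosDef) (hAB : (B - A).PosSemidef) :
    (B⁻¹ * (B - A)).trace.re ≤ ld B - ld A := by
  obtain ⟨d, hd, h, ht⟩ := PosDef.exists_contraction hA hB hAB
  rw [ld, ld, h]
  simp only [one_mul]
  rw [Finset.sum_neg_distrib] at ht
  linarith

lemma ld_eq_log_det (M : Matrix (Fin n) (Fin n) ℂ) : ld M = Real.log ‖M.det‖ := by
  have h0 : minor M 0 = 1 := by
    haveI : IsEmpty {j : Fin n // j.val < 0} := ⟨fun x => absurd x.2 (by omega)⟩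
    exact det_isEmpty
  have hn : minor M n = M.det := by
    set e : {j : Fin n // j.val < n} ≃ Fin n := ⟨Subtype.val, fun j => ⟨j, j.isLt⟩,
      fun _ => rfl, fun _ => rfl⟩
    exact det_submatrix_equiv_self e M
  rw [ld, ell, slope_const, h0, hn]
  simp

end Minors

section Derivative

variable {n : ℕ}

lemma hasDerivAt_log_norm {g : ℝ → ℂ} {g' : ℂ} {t : ℝ} (h : HasDerivAt g g' t) (h0 : g t ≠ 0) :
    HasDerivAt (fun t => Real.log ‖g t‖) (g' / g t).re t := by
  have h1 := h.norm_sq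
  have hne : ‖g t‖ ^ 2 ≠ 0 := pow_ne_zero _ (norm_ne_zero_iff.2 h0)
  have h2 := (h1.log hne).const_mul (1 / 2)
  have e : (fun t => Real.log ‖g t‖) = fun t => 1 / 2 * Real.log (‖g t‖ ^ 2) := by
    funext t; rw [Real.log_pow]; push_cast; ring
  rw [e]
  refine h2.congr_deriv ?_
  rw [Complex.inner, div_eq_mul_inv g', Complex.inv_def, Complex.normSq_eq_norm_sq,
    ← mul_assoc, mul_comm (g' * _) (Complex.ofReal _), Complex.re_ofReal_mul]
  field_simp

lemma hasDerivAt_det_one_add {m : Type*} [Fintype m] [DecidableEq m] (M : Matrix m m ℂ) :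
    HasDerivAt (fun t : ℝ => (1 + (t : ℂ) • M).det) M.trace 0 := by
  have hp : HasDerivAt (fun z : ℂ => (1 + z • M).det) M.trace ((0 : ℝ) : ℂ) := by
    have e : (fun z : ℂ => (1 + z • M).det) = fun z => 1 + M.trace * z +
        ((det (1 + (X : ℂ[X]) • M.map Polynomial.C)).divX.divX).eval z * z ^ 2 := by
      funext z; exact Matrix.det_one_add_smul z M
    rw [e]
    have h1 := ((hasDerivAt_id ((0 : ℝ) : ℂ)).const_mul M.trace).const_add 1
    have h2 := (((det (1 + (X : ℂ[X]) • M.map Polynomial.C)).divX.divX).hasDerivAt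
      ((0 : ℝ) : ℂ)).mul (hasDerivAt_pow 2 ((0 : ℝ) : ℂ))
    have h3 := h1.add h2
    refine h3.congr_deriv ?_
    simp
  exact hp.comp_ofReal

lemma hasDerivAt_minor {ε : Fin n → ℝ} (hε : ∀ i, ε i = 1 ∨ ε i = -1)
    (S : Matrix (Fin n) (Fin n) ℂ) (k : ℕ) :
    HasDerivAt (fun t : ℝ => minor (diagonal (fun i => (ε i : ℂ)) + (t : ℂ) • S) k)
      (minor (diagonal fun i => (ε i : ℂ)) k *
        ∑ j : {j : Fin n // j.val < k}, (ε j : ℂ) * S j j) 0 := by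
  set D : Matrix {j : Fin n // j.val < k} {j : Fin n // j.val < k} ℂ :=
    diagonal fun j => (ε j : ℂ) with hD
  have hDD : D * D = 1 := by
    rw [hD, diagonal_mul_diagonal, ← diagonal_one]
    congr 1; funext j
    rcases hε j with h | h <;> simp [h]
  have hsub : (diagonal fun i => (ε i : ℂ)).submatrix (pre n k) (pre n k) = D := by
    rw [hD, submatrix_diagonal _ _ Subtype.val_injective]; rfl
  have e : (fun t : ℝ => minor (diagonal (fun i => (ε i : ℂ)) + (t : ℂ) • S) k) = fun t : ℝ =>
      D.det * (1 + (t : ℂ) • (D * S.submatrix (pre n k) (pre n k))).det := by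
    funext t
    rw [minor, submatrix_add, submatrix_smul, ← det_mul, Matrix.mul_add, Matrix.mul_one,
      Matrix.mul_smul, ← Matrix.mul_assoc, hDD, Matrix.one_mul]
    simp only [Pi.add_apply, Pi.smul_apply, hsub]
  have htr : ∑ j : {j : Fin n // j.val < k}, (ε j : ℂ) * S j j =
      (D * S.submatrix (pre n k) (pre n k)).trace := by
    simp [Matrix.trace, hD, diagonal_mul]
  rw [e, htr, minor, hsub]
  exact (hasDerivAt_det_one_add _).const_mul _

lemma hasDerivAt_ell_sign (w : Fin n → ℝ) {b : Matrix (Fin n) (Fin n) ℂ}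
    (hb : b.IsUpperTriangular) (hd : ∀ i, b i i ≠ 0) {ε : Fin n → ℝ}
    (hε : ∀ i, ε i = 1 ∨ ε i = -1) (S : Matrix (Fin n) (Fin n) ℂ) :
    HasDerivAt (fun t : ℝ => ell w (bᴴ * (diagonal (fun i => (ε i : ℂ)) + (t : ℂ) • S) * b))
      (∑ i, w i * (ε i * (S i i).re)) 0 := by
  have hs : ∀ i, ‖((ε i : ℝ) : ℂ)‖ = 1 := fun i => by rcases hε i with h | h <;> simp [h]
  have key : ∀ k, HasDerivAt (fun t : ℝ =>
      Real.log ‖minor (bᴴ * (diagonal (fun i => (ε i : ℂ)) + (t : ℂ) • S) * b) k‖)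
      (∑ j : Fin n, if j.val < k then ε j * (S j j).re else 0) 0 := by
    intro k
    have h1 := ((hasDerivAt_minor hε S k).const_mul (star (diagProd b k))).mul_const (diagProd b k)
    have h2 := hasDerivAt_log_norm h1 (by
      have := minor_sign_conj_ne_zero hb hd hs k
      rw [minor_conj_of_upper hb] at this
      simpa using this)
    simp only [minor_conj_of_upper hb]
    convert h2 using 1
    have hne1 := diagProd_ne_zero hd k
    have hne2 : minor (diagonal fun i => (ε i : ℂ)) k ≠ 0 := fun h => by
      simpa [h] using norm_minor_sign hs k
    have : star (diagProd b k) * (minor (diagonal fun i => (ε i : ℂ)) k *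
        ∑ j : {j : Fin n // j.val < k}, (ε j : ℂ) * S j j) * diagProd b k /
        (star (diagProd b k) * minor (diagonal (fun i => (ε i : ℂ)) + ((0 : ℝ) : ℂ) • S) k *
          diagProd b k) = ∑ j : {j : Fin n // j.val < k}, (ε j : ℂ) * S j j := by
      have hne3 := star_ne_zero.2 hne1
      rw [Complex.ofReal_zero, zero_smul, add_zero]
      field_simp
    rw [this, Complex.re_sum]
    simp only [Complex.re_ofReal_mul]
    exact (sum_pre_eq (fun j => ε j * (S j j).re) k).symm
  have h := HasDerivAt.fun_sum (u := Finset.univ) (x := (0 : ℝ))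
    fun (i : Fin n) _ => ((key (i + 1)).sub (key i)).const_mul (w i)
  rw [← slope_partial_sums]
  exact h

lemma hasDerivAt_ell {m : Type*} [Fintype m] [DecidableEq m] (w : Fin n → ℝ)
    {F : Matrix m (Fin n) ℂ} {H : Matrix m m ℂ} {b : Matrix (Fin n) (Fin n) ℂ}
    (hb : b.IsUpperTriangular) (hd : ∀ i, b i i ≠ 0) {ε : Fin n → ℝ}
    (hε : ∀ i, ε i = 1 ∨ ε i = -1) (hN : Fᴴ * H * F = bᴴ * diagonal (fun i => (ε i : ℂ)) * b)
    (S : Matrix m m ℂ) :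
    HasDerivAt (fun t : ℝ => ell w (Fᴴ * (H + (t : ℂ) • S) * F))
      (F * b⁻¹ * diagonal (fun i => ((w i * ε i : ℝ) : ℂ)) * (F * b⁻¹)ᴴ * S).trace.re 0 := by
  have hbu := isUnit_det_of_upper hb hd
  set k := F * b⁻¹ with hk
  have hF : F = k * b := by rw [hk, Matrix.mul_assoc, nonsing_inv_mul _ hbu, Matrix.mul_one]
  have h := hasDerivAt_ell_sign w hb hd hε (kᴴ * S * k)
  have e : ∀ t : ℝ, bᴴ * (diagonal (fun i => (ε i : ℂ)) + (t : ℂ) • (kᴴ * S * k)) * b =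
      Fᴴ * (H + (t : ℂ) • S) * F := by
    intro t
    rw [Matrix.mul_add, Matrix.add_mul, ← hN, Matrix.mul_add, Matrix.add_mul]
    congr 1
    conv_rhs => rw [hF, conjTranspose_mul]
    simp only [Matrix.mul_smul, Matrix.smul_mul, Matrix.mul_assoc]
  simp only [e] at h
  convert h using 1
  rw [Matrix.mul_assoc, Matrix.mul_assoc, Matrix.trace_mul_comm, Matrix.mul_assoc, Matrix.trace,
    Complex.re_sum]
  refine Finset.sum_congr rfl fun i _ => ?_
  rw [diag_apply, diagonal_mul, Complex.re_ofReal_mul, mul_assoc]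

end Derivative

section Blocks

variable {m₁ m₂ : ℕ}

/-- The weighted sum of the increments of the logarithms of the leading principal minors of a
matrix in block form. -/
def bell (w₁ : Fin m₁ → ℝ) (w₂ : Fin m₂ → ℝ) (N : Matrix (Fin m₁ ⊕ Fin m₂) (Fin m₁ ⊕ Fin m₂) ℂ) :
    ℝ := ell (Fin.append w₁ w₂) (N.submatrix finSumFinEquiv.symm finSumFinEquiv.symm)

lemma upper_fromBlocks {β₁ : Matrix (Fin m₁) (Fin m₁) ℂ} {β₂ : Matrix (Fin m₂) (Fin m₂) ℂ}
    (h₁ : β₁.IsUpperTriangular) (h₂ : β₂.IsUpperTriangular) (Z : Matrix (Fin m₁) (Fin m₂) ℂ) :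
    ((fromBlocks β₁ Z 0 β₂).submatrix finSumFinEquiv.symm
      finSumFinEquiv.symm).IsUpperTriangular := by
  intro i j hij
  obtain ⟨i, rfl⟩ := finSumFinEquiv.surjective i
  obtain ⟨j, rfl⟩ := finSumFinEquiv.surjective j
  simp only [submatrix_apply, Equiv.symm_apply_apply]
  rcases i with i | i <;> rcases j with j | j <;>
    simp only [id, finSumFinEquiv_apply_left, finSumFinEquiv_apply_right, Fin.lt_def,
      Fin.val_castAdd, Fin.val_natAdd] at hij
  · exact h₁ hij
  · omega
  · rfl
  · exact h₂ (show j < i by rw [Fin.lt_def]; omega)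

lemma diag_fromBlocks_ne {β₁ : Matrix (Fin m₁) (Fin m₁) ℂ} {β₂ : Matrix (Fin m₂) (Fin m₂) ℂ}
    (h₁ : ∀ i, β₁ i i ≠ 0) (h₂ : ∀ i, β₂ i i ≠ 0) (Z : Matrix (Fin m₁) (Fin m₂) ℂ) (i) :
    ((fromBlocks β₁ Z 0 β₂).submatrix finSumFinEquiv.symm finSumFinEquiv.symm) i i ≠ 0 := by
  obtain ⟨i, rfl⟩ := finSumFinEquiv.surjective i
  simp only [submatrix_apply, Equiv.symm_apply_apply]
  rcases i with i | i
  · exact h₁ i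
  · exact h₂ i

/-- Signs of the signature. -/
def sg (m₁ m₂ : ℕ) (s : ℝ) : Fin (m₁ + m₂) → ℝ := Fin.append (fun _ => s) fun _ => -s

lemma sg_eq (s : ℝ) (hs : s = 1 ∨ s = -1) (i) : sg m₁ m₂ s i = 1 ∨ sg m₁ m₂ s i = -1 := by
  refine Fin.addCases (fun i => ?_) (fun i => ?_) i
  · simpa [sg] using hs
  · rcases hs with h | h <;> simp [sg, h]

lemma diagonal_sg (w₁ : Fin m₁ → ℝ) (w₂ : Fin m₂ → ℝ) (s : ℝ) :
    (diagonal fun i => ((Fin.append w₁ w₂ i * sg m₁ m₂ s i : ℝ) : ℂ)) =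
      ((s : ℂ) • dJ w₁ w₂).submatrix finSumFinEquiv.symm finSumFinEquiv.symm := by
  ext i j
  obtain ⟨i, rfl⟩ := finSumFinEquiv.surjective i
  obtain ⟨j, rfl⟩ := finSumFinEquiv.surjective j
  rcases i with i | i <;> rcases j with j | j <;>
    simp [diagonal_apply, dJ, sg, finSumFinEquiv, Fin.ext_iff, mul_comm] <;> omega

lemma diagonal_sg_one (s : ℝ) : (diagonal fun i => ((sg m₁ m₂ s i : ℝ) : ℂ)) =
      ((s : ℂ) • sgn (Fin m₁) (Fin m₂)).submatrix finSumFinEquiv.symm finSumFinEquiv.symm := by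
  have h := diagonal_sg (fun _ : Fin m₁ => 1) (fun _ : Fin m₂ => 1) s
  have h1 : ∀ i, Fin.append (fun _ : Fin m₁ => (1 : ℝ)) (fun _ : Fin m₂ => (1 : ℝ)) i = 1 :=
    fun i => by
    refine Fin.addCases (fun i => ?_) (fun i => ?_) i <;> simp
  simp only [h1, one_mul] at h
  rw [h]
  congr 2
  simp only [dJ, sgn, Complex.ofReal_one, diagonal_one]
  congr 1
  rw [← diagonal_one, diagonal_neg]

lemma conj_submatrix {m n : Type*} [Fintype m] [Fintype n] {N : Type*} [Fintype N] (e : N ≃ n)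
    (F : Matrix m n ℂ) (H : Matrix m m ℂ) :
    (Fᴴ * H * F).submatrix e e = (F.submatrix id e)ᴴ * H * F.submatrix id e := by
  ext i j; simp [Matrix.mul_apply]

lemma conj_submatrix' {n : Type*} [Fintype n] {N : Type*} [Fintype N] (e : N ≃ n)
    (F : Matrix n n ℂ) (H : Matrix n n ℂ) :
    (Fᴴ * H * F).submatrix e e = (F.submatrix e e)ᴴ * H.submatrix e e * F.submatrix e e := by
  rw [← submatrix_mul_equiv _ _ _ e, ← submatrix_mul_equiv _ _ _ e, conjTranspose_submatrix]

lemma bell_sign_block (w₁ : Fin m₁ → ℝ) (w₂ : Fin m₂ → ℝ) {β₁ : Matrix (Fin m₁) (Fin m₁) ℂ}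
    {β₂ : Matrix (Fin m₂) (Fin m₂) ℂ} (h₁ : β₁.IsUpperTriangular) (h₂ : β₂.IsUpperTriangular)
    (d₁ : ∀ i, β₁ i i ≠ 0) (d₂ : ∀ i, β₂ i i ≠ 0) (Z : Matrix (Fin m₁) (Fin m₂) ℂ) {s : ℝ}
    (hs : s = 1 ∨ s = -1) :
    bell w₁ w₂ ((fromBlocks β₁ Z 0 β₂)ᴴ * ((s : ℂ) • sgn (Fin m₁) (Fin m₂)) *
      fromBlocks β₁ Z 0 β₂) = ell w₁ (β₁ᴴ * β₁) + ell w₂ (β₂ᴴ * β₂) := by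
  rw [bell, conj_submatrix', ← diagonal_sg_one, ell_sign_conj _ (upper_fromBlocks h₁ h₂ Z)
    (diag_fromBlocks_ne d₁ d₂ Z), ell_upper w₁ h₁ d₁, ell_upper w₂ h₂ d₂, Fin.sum_univ_add]
  · simp [finSumFinEquiv]
  · intro i; rcases sg_eq s hs i with h | h <;> simp [h]

lemma bell_minor_ne_zero {β₁ : Matrix (Fin m₁) (Fin m₁) ℂ}
    {β₂ : Matrix (Fin m₂) (Fin m₂) ℂ} (h₁ : β₁.IsUpperTriangular) (h₂ : β₂.IsUpperTriangular)
    (d₁ : ∀ i, β₁ i i ≠ 0) (d₂ : ∀ i, β₂ i i ≠ 0) (Z : Matrix (Fin m₁) (Fin m₂) ℂ) {s : ℝ}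
    (hs : s = 1 ∨ s = -1) (k : ℕ) :
    minor (((fromBlocks β₁ Z 0 β₂)ᴴ * ((s : ℂ) • sgn (Fin m₁) (Fin m₂)) *
      fromBlocks β₁ Z 0 β₂).submatrix finSumFinEquiv.symm finSumFinEquiv.symm) k ≠ 0 := by
  rw [conj_submatrix', ← diagonal_sg_one]
  refine minor_sign_conj_ne_zero (upper_fromBlocks h₁ h₂ Z) (diag_fromBlocks_ne d₁ d₂ Z) ?_ k
  intro i; rcases sg_eq s hs i with h | h <;> simp [h]

lemma isUnit_det_blocks {β₁ : Matrix (Fin m₁) (Fin m₁) ℂ}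
    {β₂ : Matrix (Fin m₂) (Fin m₂) ℂ} (h₁ : β₁.IsUpperTriangular) (h₂ : β₂.IsUpperTriangular)
    (d₁ : ∀ i, β₁ i i ≠ 0) (d₂ : ∀ i, β₂ i i ≠ 0) (Z : Matrix (Fin m₁) (Fin m₂) ℂ) :
    IsUnit (fromBlocks β₁ Z 0 β₂).det := by
  rw [det_fromBlocks_zero₂₁]
  exact (isUnit_det_of_upper h₁ d₁).mul (isUnit_det_of_upper h₂ d₂)

lemma hasDerivAt_bell {m : Type*} [Fintype m] [DecidableEq m] (w₁ : Fin m₁ → ℝ) (w₂ : Fin m₂ → ℝ)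
    {β₁ : Matrix (Fin m₁) (Fin m₁) ℂ} {β₂ : Matrix (Fin m₂) (Fin m₂) ℂ}
    (h₁ : β₁.IsUpperTriangular) (h₂ : β₂.IsUpperTriangular)
    (d₁ : ∀ i, β₁ i i ≠ 0) (d₂ : ∀ i, β₂ i i ≠ 0) {Z : Matrix (Fin m₁) (Fin m₂) ℂ} {s : ℝ}
    (hs : s = 1 ∨ s = -1) {F : Matrix m (Fin m₁ ⊕ Fin m₂) ℂ} {H : Matrix m m ℂ}
    (hN : Fᴴ * H * F = (fromBlocks β₁ Z 0 β₂)ᴴ * ((s : ℂ) • sgn (Fin m₁) (Fin m₂)) *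
      fromBlocks β₁ Z 0 β₂) (S : Matrix m m ℂ) :
    HasDerivAt (fun t : ℝ => bell w₁ w₂ (Fᴴ * (H + (t : ℂ) • S) * F))
      (F * (fromBlocks β₁ Z 0 β₂)⁻¹ * ((s : ℂ) • dJ w₁ w₂) *
        (F * (fromBlocks β₁ Z 0 β₂)⁻¹)ᴴ * S).trace.re 0 := by
  set B := fromBlocks β₁ Z 0 β₂ with hB
  set e := (finSumFinEquiv (m := m₁) (n := m₂)).symm with he
  have h := hasDerivAt_ell (F := F.submatrix id e) (H := H) (Fin.append w₁ w₂)
    (upper_fromBlocks h₁ h₂ Z) (diag_fromBlocks_ne d₁ d₂ Z) (sg_eq s hs) (by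
      rw [← conj_submatrix, hN, diagonal_sg_one, ← conj_submatrix']) S
  simp only [← conj_submatrix] at h
  refine h.congr_deriv ?_
  congr 3
  have e1 : F.submatrix id e * ((fromBlocks β₁ Z 0 β₂).submatrix e e)⁻¹ =
      (F * B⁻¹).submatrix id e := by
    rw [inv_submatrix_equiv, submatrix_mul_equiv]
  rw [e1, diagonal_sg, conjTranspose_submatrix, submatrix_mul_equiv, submatrix_mul_equiv,
    submatrix_id_id]

lemma exists_signed_cholesky {s : ℝ} (hs : s = 1 ∨ s = -1) {M : Matrix (Fin m₁) (Fin m₁) ℂ}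
    {E : Matrix (Fin m₂) (Fin m₂) ℂ} (hM : M.PosDef) (hE : E.PosDef)
    (C : Matrix (Fin m₁) (Fin m₂) ℂ) :
    ∃ (β₁ : Matrix (Fin m₁) (Fin m₁) ℂ) (β₂ : Matrix (Fin m₂) (Fin m₂) ℂ)
      (Z : Matrix (Fin m₁) (Fin m₂) ℂ), β₁.IsUpperTriangular ∧ β₂.IsUpperTriangular ∧
      (∀ i, β₁ i i ≠ 0) ∧ (∀ i, β₂ i i ≠ 0) ∧ M = β₁ᴴ * β₁ ∧ E = β₂ᴴ * β₂ ∧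
      fromBlocks ((s : ℂ) • M) C Cᴴ ((s : ℂ) • (Cᴴ * M⁻¹ * C - E)) =
        (fromBlocks β₁ Z 0 β₂)ᴴ * ((s : ℂ) • sgn (Fin m₁) (Fin m₂)) * fromBlocks β₁ Z 0 β₂ := by
  obtain ⟨β₁, h₁, d₁, rfl⟩ := PosDef.exists_cholesky hM
  obtain ⟨β₂, h₂, d₂, rfl⟩ := PosDef.exists_cholesky hE
  have hu := isUnit_det_of_upper h₁ d₁
  have hu' : IsUnit β₁ᴴ.det := by rw [det_conjTranspose]; exact hu.star
  have hss : s * s = 1 := by rcases hs with h | h <;> simp [h]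
  have hst : star (s : ℂ) = s := Complex.conj_ofReal s
  refine ⟨β₁, β₂, (s : ℂ) • (β₁ᴴ⁻¹ * C), h₁, h₂, d₁, d₂, rfl, rfl, ?_⟩
  rw [fromBlocks_conjTranspose, sgn, fromBlocks_smul, fromBlocks_multiply, fromBlocks_multiply,
    fromBlocks_inj]
  have e1 : β₁ᴴ * (β₁ᴴ⁻¹ * C) = C := by
    rw [← Matrix.mul_assoc, mul_nonsing_inv _ hu', Matrix.one_mul]
  refine ⟨?_, ?_, ?_, ?_⟩
  · simp
  · simp [smul_smul, hss, e1]
  · have := congrArg conjTranspose e1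
    rw [conjTranspose_mul, conjTranspose_conjTranspose] at this
    simp [smul_smul, hss, this, -conjTranspose_mul]
  · have e2 : (β₁ᴴ⁻¹ * C)ᴴ * (β₁ᴴ⁻¹ * C) = Cᴴ * (β₁ᴴ * β₁)⁻¹ * C := by
      rw [Matrix.mul_inv_rev, conjTranspose_mul, conjTranspose_nonsing_inv,
        conjTranspose_conjTranspose]
      simp only [Matrix.mul_assoc]
    simp [smul_smul, hss, sub_eq_add_neg, e2, -conjTranspose_mul]

end Blocks

section Frames

variable {p q : ℕ}

/-- Hermitian forms on the sum of two spaces. -/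
abbrev Frm (p q : ℕ) := Matrix (Fin p ⊕ Fin q) (Fin p ⊕ Fin q) ℂ

/-- The frame adapted to the graph of `X`. -/
def frame (f : Matrix (Fin p) (Fin p) ℂ) (g : Matrix (Fin q) (Fin q) ℂ)
    (X : Matrix (Fin p) (Fin q) ℂ) : Matrix (Fin p ⊕ Fin q) (Fin q ⊕ Fin p) ℂ :=
  fromBlocks (X * g) f g 0

/-- The form with diagonal blocks `P`, `-Q` in the splitting given by the graph of `Y`. -/
def hmat (P : Matrix (Fin p) (Fin p) ℂ) (Y : Matrix (Fin p) (Fin q) ℂ)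
    (Q : Matrix (Fin q) (Fin q) ℂ) : Frm p q :=
  fromBlocks P (-(P * Y)) (-(Yᴴ * P)) (Yᴴ * P * Y - Q)

/-- The opposite of the restriction of a form to the graph of `X`. -/
def cmp (H : Frm p q) (X : Matrix (Fin p) (Fin q) ℂ) : Matrix (Fin q) (Fin q) ℂ :=
  -(Xᴴ * H.toBlocks₁₁ * X + Xᴴ * H.toBlocks₁₂ + H.toBlocks₂₁ * X + H.toBlocks₂₂)

lemma frame_conj (f : Matrix (Fin p) (Fin p) ℂ) (g : Matrix (Fin q) (Fin q) ℂ)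
    (X : Matrix (Fin p) (Fin q) ℂ) (H : Frm p q) :
    (frame f g X)ᴴ * H * frame f g X = fromBlocks (-(gᴴ * cmp H X * g))
      (gᴴ * (Xᴴ * H.toBlocks₁₁ + H.toBlocks₂₁) * f) (fᴴ * (H.toBlocks₁₁ * X + H.toBlocks₁₂) * g)
      (fᴴ * H.toBlocks₁₁ * f) := by
  conv_lhs => rw [← fromBlocks_toBlocks H]
  rw [frame, fromBlocks_conjTranspose, fromBlocks_multiply, fromBlocks_multiply, fromBlocks_inj]
  refine ⟨?_, ?_, ?_, ?_⟩
  all_goals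
    simp only [cmp, conjTranspose_mul, conjTranspose_zero, Matrix.mul_add, Matrix.add_mul,
      Matrix.mul_neg, Matrix.neg_mul, Matrix.mul_assoc, Matrix.zero_mul, Matrix.mul_zero, add_zero,
      neg_neg]
  all_goals abel

lemma cmp_hmat (P : Matrix (Fin p) (Fin p) ℂ) (Y X : Matrix (Fin p) (Fin q) ℂ)
    (Q : Matrix (Fin q) (Fin q) ℂ) : cmp (hmat P Y Q) X = Q - (X - Y)ᴴ * P * (X - Y) := by
  simp only [cmp, hmat, toBlocks_fromBlocks₁₁, toBlocks_fromBlocks₁₂, toBlocks_fromBlocks₂₁,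
    toBlocks_fromBlocks₂₂, conjTranspose_sub, Matrix.mul_sub, Matrix.sub_mul, Matrix.mul_neg,
      Matrix.neg_mul, Matrix.mul_assoc]
  abel

lemma exists_eq_hmat {H : Frm p q} (hH : H.IsHermitian) (hP : H.toBlocks₁₁.PosDef) :
    ∃ (Y : Matrix (Fin p) (Fin q) ℂ) (Q : Matrix (Fin q) (Fin q) ℂ),
      H = hmat H.toBlocks₁₁ Y Q := by
  obtain ⟨P, C, C', R, rfl⟩ : ∃ P C C' R, H = fromBlocks P C C' R :=
    ⟨_, _, _, _, (fromBlocks_toBlocks H).symm⟩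
  rw [toBlocks_fromBlocks₁₁] at hP ⊢
  have hPu : IsUnit P.det := (isUnit_iff_isUnit_det _).1 hP.isUnit
  have hPh : Pᴴ = P := hP.isHermitian
  have hC : Cᴴ = C' := by
    have h := hH.eq
    rw [fromBlocks_conjTranspose, fromBlocks_inj] at h
    exact h.2.2.1
  refine ⟨-(P⁻¹ * C), (-(P⁻¹ * C))ᴴ * P * -(P⁻¹ * C) - R, ?_⟩
  rw [hmat, fromBlocks_inj]
  refine ⟨rfl, ?_, ?_, by abel⟩
  · rw [Matrix.mul_neg, neg_neg, ← Matrix.mul_assoc, mul_nonsing_inv _ hPu, Matrix.one_mul]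
  · rw [conjTranspose_neg, Matrix.neg_mul, neg_neg, conjTranspose_mul, conjTranspose_nonsing_inv,
      hPh, Matrix.mul_assoc, nonsing_inv_mul _ hPu, Matrix.mul_one, hC]

lemma continuousAt_ell {n : ℕ} (w : Fin n → ℝ) {N : Matrix (Fin n) (Fin n) ℂ}
    (hN : ∀ k, minor N k ≠ 0) : ContinuousAt (ell w) N := by
  have h : ∀ k, ContinuousAt (fun M : Matrix (Fin n) (Fin n) ℂ => Real.log ‖minor M k‖) N := by
    intro k
    have hc : Continuous fun M : Matrix (Fin n) (Fin n) ℂ => minor M k :=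
      Continuous.matrix_det (continuous_id.matrix_submatrix _ _)
    exact hc.norm.continuousAt.log (norm_ne_zero_iff.2 (hN k))
  unfold ell slope
  exact tendsto_finsetSum _ fun i _ => ((h (i + 1)).sub (h i)).const_mul _

lemma continuousAt_bell {m₁ m₂ : ℕ} (w₁ : Fin m₁ → ℝ) (w₂ : Fin m₂ → ℝ)
    {N : Matrix (Fin m₁ ⊕ Fin m₂) (Fin m₁ ⊕ Fin m₂) ℂ}
    (hN : ∀ k, minor (N.submatrix finSumFinEquiv.symm finSumFinEquiv.symm) k ≠ 0) :
    ContinuousAt (bell w₁ w₂) N :=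
  (continuousAt_ell _ hN).comp
    (f := fun N : Matrix (Fin m₁ ⊕ Fin m₂) (Fin m₁ ⊕ Fin m₂) ℂ =>
      N.submatrix finSumFinEquiv.symm finSumFinEquiv.symm)
      (continuous_id.matrix_submatrix _ _).continuousAt

lemma posDef_of_sub_conj {P : Matrix (Fin p) (Fin p) ℂ} {Δ : Matrix (Fin p) (Fin q) ℂ}
    {Q : Matrix (Fin q) (Fin q) ℂ} (hP : P.PosDef) (hN : (Q - Δᴴ * P * Δ).PosDef) : Q.PosDef := by
  have := hN.add_posSemidef (hP.posSemidef.conjTranspose_mul_mul_same Δ)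
  rwa [sub_add_cancel] at this

lemma trace_inv_conj {g Q R : Matrix (Fin q) (Fin q) ℂ} (hg : IsUnit g.det) :
    ((gᴴ * Q * g)⁻¹ * (gᴴ * R * g)).trace = (Q⁻¹ * R).trace := by
  have hg' : IsUnit gᴴ.det := by rw [det_conjTranspose]; exact hg.star
  have e : (gᴴ * Q * g)⁻¹ * (gᴴ * R * g) = g⁻¹ * (Q⁻¹ * R * g) := by
    rw [Matrix.mul_inv_rev, Matrix.mul_inv_rev]
    have : (gᴴ)⁻¹ * (gᴴ * R * g) = R * g := by
      rw [Matrix.mul_assoc, ← Matrix.mul_assoc, nonsing_inv_mul _ hg', Matrix.one_mul]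
    simp only [Matrix.mul_assoc] at this ⊢
    rw [this]
  rw [e, trace_mul_comm, Matrix.mul_assoc, mul_nonsing_inv _ hg, Matrix.mul_one]

/-- The potential of a frame: value estimate, continuity and derivative. -/
lemma bell_frame {a₁ : Fin p → ℝ} {a₂ : Fin q → ℝ} {c : ℝ} (ha₁ : ∀ i, 0 ≤ a₁ i)
    (ha₂ : ∀ i, a₂ i ≤ -c) {f : Matrix (Fin p) (Fin p) ℂ} {g : Matrix (Fin q) (Fin q) ℂ}
    (hf : IsUnit f.det) (hg : IsUnit g.det) (X : Matrix (Fin p) (Fin q) ℂ) {H : Frm p q}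
    {P : Matrix (Fin p) (Fin p) ℂ} {Y : Matrix (Fin p) (Fin q) ℂ} {Q : Matrix (Fin q) (Fin q) ℂ}
    (hH : H = hmat P Y Q) (hP : P.PosDef) (hN : (cmp H X).PosDef) :
    Q.PosDef ∧
    ((Q⁻¹ * ((X - Y)ᴴ * P * (X - Y))).trace.re ≤ ld (gᴴ * Q * g) - ld (gᴴ * cmp H X * g)) ∧
    (ell a₁ (fᴴ * P * f) + ell a₂ (gᴴ * Q * g) + c * (ld (gᴴ * Q * g) - ld (gᴴ * cmp H X * g)) ≤
      bell a₂ a₁ ((frame f g X)ᴴ * H * frame f g X)) ∧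
    ContinuousAt (fun H : Frm p q => bell a₂ a₁ ((frame f g X)ᴴ * H * frame f g X)) H ∧
    ∃ k : Frm p q, kᴴ * H * k = sgn (Fin p) (Fin q) ∧ ∀ S : Frm p q, HasDerivAt (fun t : ℝ =>
      bell a₂ a₁ ((frame f g X)ᴴ * (H + (t : ℂ) • S) * frame f g X))
        (k * dJ a₁ a₂ * kᴴ * S).trace.re 0 := by
  set Δ := X - Y with hΔ
  set N := cmp H X with hNdef
  have hNe : N = Q - Δᴴ * P * Δ := by rw [hNdef, hH, cmp_hmat]
  have hPh : Pᴴ = P := hP.isHermitian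
  have hQ : Q.PosDef := posDef_of_sub_conj hP (Δ := Δ) (hNe ▸ hN)
  have hginj : Function.Injective g.mulVec := mulVec_injective_iff_isUnit.2
    ((isUnit_iff_isUnit_det _).2 hg)
  have hfinj : Function.Injective f.mulVec := mulVec_injective_iff_isUnit.2
    ((isUnit_iff_isUnit_det _).2 hf)
  have hgN : (gᴴ * N * g).PosDef := hN.conjTranspose_mul_mul_same hginj
  have hgQ : (gᴴ * Q * g).PosDef := hQ.conjTranspose_mul_mul_same hginj
  have hfP : (fᴴ * P * f).PosDef := hP.conjTranspose_mul_mul_same hfinj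
  have hdiff : gᴴ * Q * g - gᴴ * N * g = gᴴ * (Δᴴ * P * Δ) * g := by
    rw [hNe, Matrix.mul_sub, Matrix.sub_mul, sub_sub_cancel]
  have hdp : (gᴴ * Q * g - gᴴ * N * g).PosSemidef := by
    rw [hdiff]
    exact (hP.posSemidef.conjTranspose_mul_mul_same Δ).conjTranspose_mul_mul_same g
  set C := gᴴ * (Δᴴ * P) * f with hC
  set E := fᴴ * P * f + Cᴴ * (gᴴ * N * g)⁻¹ * C with hE
  have hsemi : (Cᴴ * (gᴴ * N * g)⁻¹ * C).PosSemidef :=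
    hgN.inv.posSemidef.conjTranspose_mul_mul_same C
  have hEp : E.PosDef := hfP.add_posSemidef hsemi
  obtain ⟨β₁, β₂, Z, h₁, h₂, d₁, d₂, hM₁, hM₂, hB⟩ :=
    exists_signed_cholesky (s := -1) (Or.inr rfl) hgN hEp C
  have hconj : (frame f g X)ᴴ * H * frame f g X = (fromBlocks β₁ Z 0 β₂)ᴴ *
      (((-1 : ℝ) : ℂ) • sgn (Fin q) (Fin p)) * fromBlocks β₁ Z 0 β₂ := by
    rw [← hB, frame_conj, ← hNdef, fromBlocks_inj]
    have e11 : H.toBlocks₁₁ = P := by rw [hH, hmat, toBlocks_fromBlocks₁₁]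
    have e21 : H.toBlocks₂₁ = -(Yᴴ * P) := by rw [hH, hmat, toBlocks_fromBlocks₂₁]
    have e12 : H.toBlocks₁₂ = -(P * Y) := by rw [hH, hmat, toBlocks_fromBlocks₁₂]
    rw [e11, e21, e12]
    refine ⟨by simp, ?_, ?_, ?_⟩
    · rw [hC, hΔ, conjTranspose_sub, Matrix.sub_mul]; congr 2
    · rw [hC, hΔ]
      simp only [conjTranspose_mul, conjTranspose_conjTranspose, hPh, Matrix.mul_sub,
        Matrix.mul_assoc, Matrix.sub_mul, Matrix.add_mul, Matrix.neg_mul, Matrix.mul_add,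
        Matrix.mul_neg]
      abel
    · rw [hE]; simp
  refine ⟨hQ, ?_, ?_, ?_, ?_⟩
  · have h := trace_le_ld_sub hgN hgQ hdp
    rwa [hdiff, trace_inv_conj hg] at h
  · rw [hconj, bell_sign_block a₂ a₁ h₁ h₂ d₁ d₂ Z (Or.inr rfl), ← hM₁, ← hM₂]
    have h1 := ell_gap ha₂ hgN hgQ hdp
    have h2 := ell_mono ha₁ hfP hEp (by rw [hE, add_sub_cancel_left]; exact hsemi)
    linarith
  · have h := continuousAt_bell a₂ a₁ (N := (frame f g X)ᴴ * H * frame f g X) (by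
      rw [hconj]; exact bell_minor_ne_zero h₁ h₂ d₁ d₂ Z (Or.inr rfl))
    have hc : Continuous fun H : Frm p q => (frame f g X)ᴴ * H * frame f g X := by fun_prop
    exact h.comp (f := fun H : Frm p q => (frame f g X)ᴴ * H * frame f g X) hc.continuousAt
  · set B := fromBlocks β₁ Z 0 β₂ with hBdef
    have hBu : IsUnit B.det := isUnit_det_blocks h₁ h₂ d₁ d₂ Z
    set k' := frame f g X * B⁻¹ with hk'
    have hk'H : k'ᴴ * H * k' = ((-1 : ℝ) : ℂ) • sgn (Fin q) (Fin p) := by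
      have : k'ᴴ * H * k' = (B⁻¹)ᴴ * ((frame f g X)ᴴ * H * frame f g X) * B⁻¹ := by
        rw [hk', conjTranspose_mul]; simp only [Matrix.mul_assoc]
      rw [this, hconj]
      have h3 : (B⁻¹)ᴴ * Bᴴ = 1 := by
        rw [← conjTranspose_mul, mul_nonsing_inv _ hBu, conjTranspose_one]
      rw [← Matrix.mul_assoc, ← Matrix.mul_assoc, h3, Matrix.one_mul, Matrix.mul_assoc,
        mul_nonsing_inv _ hBu, Matrix.mul_one]
    refine ⟨k'.submatrix id (Equiv.sumComm (Fin p) (Fin q)), ?_, fun S => ?_⟩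
    · rw [← conj_submatrix, hk'H]
      ext i j
      rcases i with i | i <;> rcases j with j | j <;> simp [sgn]
    · have h := hasDerivAt_bell a₂ a₁ h₁ h₂ d₁ d₂ (Or.inr rfl) hconj S
      refine h.congr_deriv ?_
      congr 3
      rw [← hBdef, ← hk']
      have : dJ a₁ a₂ = (((-1 : ℝ) : ℂ) • dJ a₂ a₁).submatrix (Equiv.sumComm (Fin p) (Fin q))
          (Equiv.sumComm (Fin p) (Fin q)) := by
        ext i j
        rcases i with i | i <;> rcases j with j | j <;>
          simp [dJ, diagonal_apply]
      rw [this, conjTranspose_submatrix, submatrix_mul_equiv, submatrix_mul_equiv, submatrix_id_id]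

end Frames

section LogDet

variable {m : Type*} [Fintype m] [DecidableEq m]

lemma hasDerivAt_log_det {M : Matrix m m ℂ} (hM : IsUnit M.det) (S : Matrix m m ℂ) :
    HasDerivAt (fun t : ℝ => Real.log ‖(M + (t : ℂ) • S).det‖) (M⁻¹ * S).trace.re 0 := by
  have e : (fun t : ℝ => (M + (t : ℂ) • S).det) = fun t : ℝ =>
      M.det * (1 + (t : ℂ) • (M⁻¹ * S)).det := by
    funext t
    rw [← det_mul, Matrix.mul_add, Matrix.mul_one, Matrix.mul_smul, ← Matrix.mul_assoc,
      mul_nonsing_inv _ hM, Matrix.one_mul]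
  have h1 : HasDerivAt (fun t : ℝ => (M + (t : ℂ) • S).det) (M.det * (M⁻¹ * S).trace) 0 := by
    rw [e]; exact (hasDerivAt_det_one_add _).const_mul _
  have h2 := hasDerivAt_log_norm h1 (by simpa using hM.ne_zero)
  refine h2.congr_deriv ?_
  have : M.det ≠ 0 := hM.ne_zero
  rw [Complex.ofReal_zero, zero_smul, add_zero]
  field_simp

lemma continuousAt_log_det {M : Matrix m m ℂ} (hM : IsUnit M.det) :
    ContinuousAt (fun M : Matrix m m ℂ => Real.log ‖M.det‖) M := by
  have hc : Continuous fun M : Matrix m m ℂ => M.det := continuous_id.matrix_det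
  exact hc.norm.continuousAt.log (norm_ne_zero_iff.2 hM.ne_zero)

end LogDet

section Regularizer

variable {p q : ℕ}

/-- The projection to the second summand. -/
def lowerProj (p q : ℕ) : Frm p q := fromBlocks 0 0 0 1

/-- A size function on positive definite matrices. -/
def size {n : ℕ} (P : Matrix (Fin n) (Fin n) ℂ) : ℝ :=
  Real.log ‖(P + 1).det‖ - 1 / 2 * Real.log ‖P.det‖

/-- The potential of a form with respect to the standard splitting, with regularization. -/
def stdPot (c₁ : Fin p → ℝ) (c₂ : Fin q → ℝ) (ε : ℝ) (H : Frm p q) : ℝ :=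
  bell (fun i => c₁ i - 3 / 2 * ε) (fun i => c₂ i - 1 / 2 * ε) H +
    ε * (Real.log ‖(H.toBlocks₁₁ + 1).det‖ + Real.log ‖(H - lowerProj p q).det‖)

lemma ell_sub_const {n : ℕ} (w : Fin n → ℝ) (t : ℝ) (M : Matrix (Fin n) (Fin n) ℂ) :
    ell (fun i => w i - t) M = ell w M - t * Real.log ‖M.det‖ := by
  have : (fun i => w i - t) = w + (-t) • fun _ => (1 : ℝ) := by
    funext i; simp [sub_eq_add_neg]
  rw [this, ell, slope_add_left, slope_smul_left, ← ld_eq_log_det, ld, ell, ell]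
  ring

lemma norm_inv_one_add_mul_conjTranspose_apply_le {n : ℕ} (K : Matrix (Fin n) (Fin n) ℂ) :
    ∀ i j, ‖(1 + K * Kᴴ)⁻¹ i j‖ ≤ 1 := by
  set W := (1 + K * Kᴴ)⁻¹ with hW
  have hpd : (1 + K * Kᴴ).PosDef := PosDef.one.add_posSemidef (posSemidef_self_mul_conjTranspose K)
  have hWp : W.PosDef := hpd.inv
  have hu : IsUnit (1 + K * Kᴴ).det := (isUnit_iff_isUnit_det _).1 hpd.isUnit
  have hWh : Wᴴ = W := hWp.isHermitian
  have h1 : W * (1 + K * Kᴴ) * Wᴴ = W := by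
    rw [hW, nonsing_inv_mul _ hu, Matrix.one_mul, ← hW, hWh]
  have h2 : (W - W * Wᴴ).PosSemidef := by
    have : W - W * Wᴴ = (W * K) * (W * K)ᴴ := by
      nth_rw 1 [← h1]
      rw [Matrix.mul_add, Matrix.add_mul, Matrix.mul_one, add_sub_cancel_left, conjTranspose_mul]
      simp only [Matrix.mul_assoc]
    rw [this]; exact posSemidef_self_mul_conjTranspose _
  intro i j
  have hd : ((W * Wᴴ) i i).re = ∑ l, ‖W i l‖ ^ 2 := by
    rw [Matrix.mul_apply, Complex.re_sum]
    refine Finset.sum_congr rfl fun l _ => ?_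
    rw [conjTranspose_apply]
    have := Complex.mul_conj' (W i l)
    rw [show W i l * star (W i l) = (‖W i l‖ : ℂ) ^ 2 from this, ← Complex.ofReal_pow,
      Complex.ofReal_re]
  have h3 := (Complex.le_def.1 (h2.diag_nonneg (i := i))).1
  rw [Matrix.sub_apply, Complex.sub_re, hd, Complex.zero_re] at h3
  have h4 : (W i i).re ≤ ‖W i i‖ := Complex.re_le_norm _
  have h5 : ∀ l, ‖W i l‖ ^ 2 ≤ ∑ l, ‖W i l‖ ^ 2 := fun l =>
    Finset.single_le_sum (f := fun l => ‖W i l‖ ^ 2) (fun _ _ => sq_nonneg _) (Finset.mem_univ l)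
  have h6 : ‖W i i‖ ≤ 1 := by nlinarith [h5 i, norm_nonneg (W i i)]
  have h7 := h5 j
  nlinarith [norm_nonneg (W i j)]

lemma stdPot_props (c₁ : Fin p → ℝ) (c₂ : Fin q → ℝ) (ε : ℝ) {H : Frm p q}
    {P : Matrix (Fin p) (Fin p) ℂ} {Y : Matrix (Fin p) (Fin q) ℂ} {Q : Matrix (Fin q) (Fin q) ℂ}
    (hH : H = hmat P Y Q) (hP : P.PosDef) (hQ : Q.PosDef) :
    stdPot c₁ c₂ ε H = ell c₁ P + ell c₂ Q + ε * (size P + size Q) ∧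
    ContinuousAt (stdPot c₁ c₂ ε) H ∧
    ∃ B ρ : Frm p q, IsUnit B.det ∧ H = Bᴴ * sgn (Fin p) (Fin q) * B ∧
      (∀ i j, ‖ρ i j‖ ≤ 2) ∧ ∀ S : Frm p q, HasDerivAt (fun t : ℝ =>
        stdPot c₁ c₂ ε (H + (t : ℂ) • S))
          (B⁻¹ * (dJ c₁ c₂ + (ε : ℂ) • ρ) * (B⁻¹)ᴴ * S).trace.re 0 := by
  have hPh : Pᴴ = P := hP.isHermitian
  have hPu : IsUnit P.det := (isUnit_iff_isUnit_det _).1 hP.isUnit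
  have hQu : IsUnit Q.det := (isUnit_iff_isUnit_det _).1 hQ.isUnit
  obtain ⟨β₁, β₂, Z, h₁, h₂, d₁, d₂, hM₁, hM₂, hB⟩ :=
    exists_signed_cholesky (s := 1) (Or.inl rfl) hP hQ (-(P * Y))
  set B := fromBlocks β₁ Z 0 β₂ with hBdef
  have hBu : IsUnit B.det := isUnit_det_blocks h₁ h₂ d₁ d₂ Z
  have hu₁ := isUnit_det_of_upper h₁ d₁
  have hu₂ := isUnit_det_of_upper h₂ d₂
  have hHB : H = Bᴴ * (((1 : ℝ) : ℂ) • sgn (Fin p) (Fin q)) * B := by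
    rw [← hB, hH, hmat, fromBlocks_inj]
    refine ⟨by simp, rfl, by simp [hPh], ?_⟩
    have : (-(P * Y))ᴴ * P⁻¹ = -Yᴴ := by
      rw [conjTranspose_neg, conjTranspose_mul, hPh, Matrix.neg_mul, Matrix.mul_assoc,
        mul_nonsing_inv _ hPu, Matrix.mul_one]
    rw [this, Complex.ofReal_one, one_smul, Matrix.neg_mul, Matrix.mul_neg, neg_neg,
      Matrix.mul_assoc]
  have hHB' : H = Bᴴ * sgn (Fin p) (Fin q) * B := by simpa using hHB
  have h11 : H.toBlocks₁₁ = P := by rw [hH, hmat, toBlocks_fromBlocks₁₁]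
  have hP1 : (P + 1).PosDef := hP.add_posSemidef PosSemidef.one
  have hQ1 : (Q + 1).PosDef := hQ.add_posSemidef PosSemidef.one
  have hP1u : IsUnit (P + 1).det := (isUnit_iff_isUnit_det _).1 hP1.isUnit
  have hQ1u : IsUnit (Q + 1).det := (isUnit_iff_isUnit_det _).1 hQ1.isUnit
  have hdet : ‖(H - lowerProj p q).det‖ = ‖P.det‖ * ‖(Q + 1).det‖ := by
    have : H - lowerProj p q = (fromBlocks 1 (-Y) 0 1)ᴴ * fromBlocks P 0 0 (-(Q + 1)) *
        fromBlocks 1 (-Y) 0 1 := by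
      rw [hH, hmat, lowerProj, fromBlocks_conjTranspose, fromBlocks_multiply, fromBlocks_multiply,
        sub_eq_add_neg, fromBlocks_neg, fromBlocks_add, fromBlocks_inj]
      refine ⟨by simp, by simp, by simp, ?_⟩
      simp only [Matrix.mul_neg, conjTranspose_neg, Matrix.mul_zero, Matrix.mul_one,
        conjTranspose_one, Matrix.one_mul, add_zero]
      rw [Matrix.neg_mul, Matrix.neg_mul, neg_neg]
      abel
    rw [this, det_mul, det_mul, det_conjTranspose, det_fromBlocks_zero₂₁, det_fromBlocks_zero₂₁,
      det_neg]
    simp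
  have hHeu : IsUnit (H - lowerProj p q).det := by
    rw [isUnit_iff_ne_zero, ← norm_ne_zero_iff, hdet]
    exact mul_ne_zero (norm_ne_zero_iff.2 hPu.ne_zero) (norm_ne_zero_iff.2 hQ1u.ne_zero)
  refine ⟨?_, ?_, B, ?_⟩
  · rw [stdPot, hdet, h11, Real.log_mul (norm_ne_zero_iff.2 hPu.ne_zero)
      (norm_ne_zero_iff.2 hQ1u.ne_zero)]
    nth_rw 1 [hHB]
    rw [bell_sign_block _ _ h₁ h₂ d₁ d₂ Z (Or.inl rfl), ← hM₁, ← hM₂, ell_sub_const,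
      ell_sub_const, size, size]
    ring
  · have hc1 : ContinuousAt (bell (fun i => c₁ i - 3 / 2 * ε) (fun i => c₂ i - 1 / 2 * ε)) H :=
      continuousAt_bell _ _ (by rw [hHB]; exact bell_minor_ne_zero h₁ h₂ d₁ d₂ Z (Or.inl rfl))
    have hc2 : ContinuousAt (fun H : Frm p q => Real.log ‖(H.toBlocks₁₁ + 1).det‖) H := by
      refine (continuousAt_log_det (by rwa [h11])).comp
        (f := fun H : Frm p q => H.toBlocks₁₁ + 1) (Continuous.continuousAt ?_)
      exact (continuous_id.matrix_submatrix Sum.inl Sum.inl).add continuous_const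
    have hc3 : ContinuousAt (fun H : Frm p q => Real.log ‖(H - lowerProj p q).det‖) H :=
      (continuousAt_log_det hHeu).comp (f := fun H : Frm p q => H - lowerProj p q)
        (continuous_id.sub continuous_const).continuousAt
    exact hc1.add ((hc2.add hc3).const_mul ε)
  · have hBHu : IsUnit Bᴴ.det := by rw [det_conjTranspose]; exact hBu.star
    set W₁ := (1 + β₁ * β₁ᴴ)⁻¹ with hW₁
    set W₂ := (1 + β₂ᴴ⁻¹ * (β₂ᴴ⁻¹)ᴴ)⁻¹ with hW₂
    have hW₁u : IsUnit (1 + β₁ * β₁ᴴ).det := (isUnit_iff_isUnit_det _).1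
      (PosDef.one.add_posSemidef (posSemidef_self_mul_conjTranspose β₁)).isUnit
    have hW₂u : IsUnit (1 + β₂ᴴ⁻¹ * (β₂ᴴ⁻¹)ᴴ).det := (isUnit_iff_isUnit_det _).1
      (PosDef.one.add_posSemidef (posSemidef_self_mul_conjTranspose β₂ᴴ⁻¹)).isUnit
    have hlow : β₁ * (P + 1)⁻¹ * β₁ᴴ = 1 - W₁ := by
      have h1 : (1 + β₁ * β₁ᴴ) * β₁ = β₁ * (P + 1) := by
        rw [hM₁, Matrix.add_mul, Matrix.mul_add, Matrix.one_mul, Matrix.mul_one, Matrix.mul_assoc,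
          add_comm]
      have h2 : β₁ * (P + 1)⁻¹ = W₁ * β₁ := by
        have h3 : W₁ * ((1 + β₁ * β₁ᴴ) * β₁) * (P + 1)⁻¹ = W₁ * β₁ := by
          rw [h1, Matrix.mul_assoc, Matrix.mul_assoc, mul_nonsing_inv _ hP1u, Matrix.mul_one]
        rw [← h3, ← Matrix.mul_assoc, nonsing_inv_mul _ hW₁u, Matrix.one_mul]
      have h4 : W₁ * (1 + β₁ * β₁ᴴ) = 1 := nonsing_inv_mul _ hW₁u
      rw [h2, Matrix.mul_assoc, ← h4, Matrix.mul_add, Matrix.mul_one, add_sub_cancel_left]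
    have hG1 : B * fromBlocks (P + 1)⁻¹ 0 0 0 * Bᴴ = fromBlocks (1 - W₁) 0 0 0 := by
      rw [hBdef, fromBlocks_conjTranspose, fromBlocks_multiply, fromBlocks_multiply, ← hlow]
      simp
    have hG2 : B⁻¹ * fromBlocks 1 0 0 (-W₂) * (B⁻¹)ᴴ = (H - lowerProj p q)⁻¹ := by
      have hT : H - lowerProj p q = Bᴴ * fromBlocks 1 0 0 (-(1 + β₂ᴴ⁻¹ * (β₂ᴴ⁻¹)ᴴ)) * B := by
        have h1 : (fromBlocks 1 0 0 (-(1 + β₂ᴴ⁻¹ * (β₂ᴴ⁻¹)ᴴ)) : Frm p q) =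
            sgn (Fin p) (Fin q) - fromBlocks 0 0 0 (β₂ᴴ⁻¹ * (β₂ᴴ⁻¹)ᴴ) := by
          rw [sgn, sub_eq_add_neg, fromBlocks_neg, fromBlocks_add, fromBlocks_inj]
          refine ⟨by simp, by simp, by simp, by abel⟩
        have hu₂' : IsUnit β₂ᴴ.det := by rw [det_conjTranspose]; exact hu₂.star
        have h2 : Bᴴ * fromBlocks 0 0 0 (β₂ᴴ⁻¹ * (β₂ᴴ⁻¹)ᴴ) * B = lowerProj p q := by
          rw [hBdef, fromBlocks_conjTranspose, fromBlocks_multiply, fromBlocks_multiply, lowerProj,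
            fromBlocks_inj]
          refine ⟨by simp, by simp, by simp, ?_⟩
          have h3 : (β₂ᴴ⁻¹)ᴴ * β₂ = 1 := by
            rw [conjTranspose_nonsing_inv, conjTranspose_conjTranspose, nonsing_inv_mul _ hu₂]
          simp only [Matrix.mul_zero, Matrix.zero_mul, zero_add,
            ← Matrix.mul_assoc, mul_nonsing_inv _ hu₂', Matrix.one_mul, h3]
        rw [h1, Matrix.mul_sub, Matrix.sub_mul, h2, ← hHB']
      symm
      refine inv_eq_right_inv ?_
      have h4 : (fromBlocks 1 0 0 (-(1 + β₂ᴴ⁻¹ * (β₂ᴴ⁻¹)ᴴ)) : Frm p q) * fromBlocks 1 0 0 (-W₂) =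
          1 := by
        rw [fromBlocks_multiply, ← fromBlocks_one, fromBlocks_inj]
        refine ⟨by simp, by simp, by simp, ?_⟩
        rw [Matrix.neg_mul, Matrix.mul_neg, neg_neg, mul_nonsing_inv _ hW₂u, Matrix.zero_mul,
          zero_add]
      have h5 : Bᴴ * (B⁻¹)ᴴ = 1 := by
        rw [← conjTranspose_mul, nonsing_inv_mul _ hBu, conjTranspose_one]
      have h6 : B * (B⁻¹ * fromBlocks 1 0 0 (-W₂) * (B⁻¹)ᴴ) =
          fromBlocks 1 0 0 (-W₂) * (B⁻¹)ᴴ := by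
        rw [← Matrix.mul_assoc, ← Matrix.mul_assoc, mul_nonsing_inv _ hBu, Matrix.one_mul]
      rw [hT, Matrix.mul_assoc, h6, Matrix.mul_assoc, ← Matrix.mul_assoc (fromBlocks 1 0 0 _), h4,
        Matrix.one_mul, h5]
    set ρ : Frm p q := fromBlocks ((1 / 2 : ℂ) • 1 - W₁) 0 0 ((1 / 2 : ℂ) • 1 - W₂) with hρ
    have half : ∀ {n : ℕ} (W : Matrix (Fin n) (Fin n) ℂ), (∀ i j, ‖W i j‖ ≤ 1) →
        ∀ i j, ‖((1 / 2 : ℂ) • (1 : Matrix (Fin n) (Fin n) ℂ) - W) i j‖ ≤ 2 := by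
      intro n W hW i j
      rw [Matrix.sub_apply, Matrix.smul_apply]
      refine (norm_sub_le _ _).trans ?_
      have : ‖(1 / 2 : ℂ) • (1 : Matrix (Fin n) (Fin n) ℂ) i j‖ ≤ 1 := by
        rw [Matrix.one_apply]; split_ifs <;> norm_num
      linarith [hW i j]
    refine ⟨ρ, hBu, hHB', ?_, fun S => ?_⟩
    · intro i j
      rcases i with i | i <;> rcases j with j | j
      · exact half _ (norm_inv_one_add_mul_conjTranspose_apply_le β₁) i j
      · simp [hρ]
      · simp [hρ]
      · exact half _ (norm_inv_one_add_mul_conjTranspose_apply_le β₂ᴴ⁻¹) i j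
    · have k1 := hasDerivAt_bell (F := (1 : Frm p q)) (H := H) (fun i => c₁ i - 3 / 2 * ε)
        (fun i => c₂ i - 1 / 2 * ε) h₁ h₂ d₁ d₂ (Or.inl rfl) (Z := Z)
        (by rw [conjTranspose_one, Matrix.one_mul, Matrix.mul_one]; exact hHB) S
      have k2 := hasDerivAt_log_det hP1u S.toBlocks₁₁
      have k3 := hasDerivAt_log_det hHeu S
      simp only [conjTranspose_one, Matrix.one_mul, Matrix.mul_one] at k1
      have e2 : ∀ t : ℝ, (H + (t : ℂ) • S).toBlocks₁₁ + 1 = P + 1 + (t : ℂ) • S.toBlocks₁₁ := by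
        intro t
        rw [← h11]
        ext i j
        simp [toBlocks₁₁]; ring
      have e3 : ∀ t : ℝ, H + (t : ℂ) • S - lowerProj p q = H - lowerProj p q + (t : ℂ) • S :=
        fun t => by abel
      simp only [← e2] at k2
      simp only [← e3] at k3
      refine (k1.add ((k2.add k3).const_mul ε)).congr_deriv ?_
      have t2 : ((P + 1)⁻¹ * S.toBlocks₁₁).trace = (fromBlocks (P + 1)⁻¹ 0 0 0 * S).trace := by
        conv_rhs => rw [← fromBlocks_toBlocks S, fromBlocks_multiply]
        simp [Matrix.trace, Fintype.sum_sum_type]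
      have hG1' : fromBlocks (P + 1)⁻¹ 0 0 0 = B⁻¹ * fromBlocks (1 - W₁) 0 0 0 * (B⁻¹)ᴴ := by
        rw [← hG1]
        have h5 : Bᴴ * (B⁻¹)ᴴ = 1 := by
          rw [← conjTranspose_mul, nonsing_inv_mul _ hBu, conjTranspose_one]
        rw [Matrix.mul_assoc B, ← Matrix.mul_assoc B⁻¹, nonsing_inv_mul _ hBu, Matrix.one_mul,
          Matrix.mul_assoc, h5, Matrix.mul_one]
      have hmid : dJ c₁ c₂ + (ε : ℂ) • ρ =
          ((1 : ℝ) : ℂ) • dJ (fun i => c₁ i - 3 / 2 * ε) (fun i => c₂ i - 1 / 2 * ε) +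
          (ε : ℂ) • (fromBlocks (1 - W₁) 0 0 0 + fromBlocks 1 0 0 (-W₂)) := by
        rw [hρ, Complex.ofReal_one, one_smul]
        ext i j
        rcases i with i | i <;> rcases j with j | j <;>
          simp [dJ, diagonal_apply, Matrix.one_apply]
        · split_ifs <;> ring
        · split_ifs <;> ring
      rw [hmid, t2, hG1', ← hG2]
      simp only [Matrix.mul_add, Matrix.add_mul, Matrix.mul_smul, Matrix.smul_mul, smul_add,
        Matrix.trace_add, Matrix.trace_smul, Complex.add_re, smul_eq_mul, Complex.re_ofReal_mul]
      ring

end Regularizer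

section DetMono

variable {m : Type*} [Fintype m] [DecidableEq m]

lemma one_le_norm_det_one_add {E : Matrix m m ℂ} (hE : E.PosSemidef) : 1 ≤ ‖(1 + E).det‖ := by
  set U : Matrix m m ℂ := (hE.1.eigenvectorUnitary : Matrix m m ℂ) with hU
  have hs : E = U * diagonal (fun i => (hE.1.eigenvalues i : ℂ)) * Uᴴ := hE.1.spectral_theorem
  have hUU : U * Uᴴ = 1 := Unitary.mul_star_self_of_mem hE.1.eigenvectorUnitary.2
  have h1 : 1 + E = U * (1 + diagonal (fun i => (hE.1.eigenvalues i : ℂ))) * Uᴴ := by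
    rw [Matrix.mul_add, Matrix.add_mul, Matrix.mul_one, hUU, ← hs]
  have h2 : (1 + E).det = ∏ i, ((1 + hE.1.eigenvalues i : ℝ) : ℂ) := by
    rw [h1, det_mul, mul_comm, ← det_mul, ← Matrix.mul_assoc, mul_eq_one_comm.1 hUU, Matrix.one_mul,
      ← diagonal_one, diagonal_add, det_diagonal]
    simp
  rw [h2, norm_prod]
  have h0 := fun i => hE.eigenvalues_nonneg i
  refine le_trans (by simp) (Finset.prod_le_prod (f := fun _ : m => (1 : ℝ))
    (fun i _ => zero_le_one) fun i _ => ?_)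
  rw [Complex.norm_real, Real.norm_eq_abs]
  exact le_trans (by linarith [h0 i]) (le_abs_self _)

lemma norm_det_mono {A B : Matrix m m ℂ} (hB : B.PosDef) (hAB : (A - B).PosSemidef) :
    ‖B.det‖ ≤ ‖A.det‖ := by
  obtain ⟨C, hC, rfl⟩ := PosDef.exists_isUnit_factor hB
  have hp := hAB.conjTranspose_mul_mul_same C⁻¹
  have h1 : A = Cᴴ * (1 + (C⁻¹)ᴴ * (A - Cᴴ * C) * C⁻¹) * C := by
    have : Cᴴ * (C⁻¹)ᴴ = 1 := by
      rw [← conjTranspose_mul, nonsing_inv_mul _ hC, conjTranspose_one]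
    rw [Matrix.mul_add, Matrix.add_mul, Matrix.mul_one, Matrix.mul_assoc, Matrix.mul_assoc,
      Matrix.mul_assoc, nonsing_inv_mul _ hC, ← Matrix.mul_assoc, this]
    simp
  have h2 := one_le_norm_det_one_add hp
  rw [h1, det_mul, det_mul, det_mul, norm_mul, norm_mul, norm_mul]
  nlinarith [mul_nonneg (norm_nonneg (Cᴴ.det)) (norm_nonneg C.det)]

end DetMono

lemma exists_greedy {ι E : Type*} [Fintype ι] [DecidableEq ι] [AddCommGroup E] [Module ℂ E]
    (v : ι → E) (σ : ι → ℝ) : ∃ S : Finset ι, LinearIndepOn ℂ v (S : Set ι) ∧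
      ∀ i, v i ∈ Submodule.span ℂ (v '' {j | j ∈ S ∧ σ i ≤ σ j}) := by
  suffices h : ∀ s : Finset ι, ∃ S ⊆ s, LinearIndepOn ℂ v (S : Set ι) ∧
      ∀ i ∈ s, v i ∈ Submodule.span ℂ (v '' {j | j ∈ S ∧ σ i ≤ σ j}) by
    obtain ⟨S, -, h1, h2⟩ := h Finset.univ
    exact ⟨S, h1, fun i => h2 i (Finset.mem_univ i)⟩
  intro s
  induction s using Finset.induction_on_min_value σ with
  | empty => exact ⟨∅, by simp, by simp, by simp⟩
  | insert a s ha hmin ih =>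
    obtain ⟨S, hS, hi, hsp⟩ := ih
    by_cases h : v a ∈ Submodule.span ℂ (v '' S)
    · refine ⟨S, hS.trans (Finset.subset_insert _ _), hi, fun i his => ?_⟩
      rcases Finset.mem_insert.1 his with rfl | his
      · refine Submodule.span_mono (Set.image_mono fun j hj => ?_) h
        exact ⟨hj, hmin j (hS hj)⟩
      · exact hsp i his
    · refine ⟨insert a S, Finset.insert_subset_insert _ hS, ?_, fun i his => ?_⟩
      · rw [Finset.coe_insert]
        exact hi.insert h
      · rcases Finset.mem_insert.1 his with rfl | his
        · exact Submodule.subset_span ⟨i, ⟨Finset.mem_insert_self _ _, le_rfl⟩, rfl⟩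
        · refine Submodule.span_mono (Set.image_mono fun j hj => ?_) (hsp i his)
          exact ⟨Finset.mem_insert_of_mem hj.1, hj.2⟩

lemma exists_greedy_rows {ι κ : Type*} [Fintype ι] [DecidableEq ι] [Fintype κ]
    (M : Matrix ι κ ℂ) (σ : ι → ℝ) : ∃ S : Finset ι, LinearIndepOn ℂ M.row (S : Set ι) ∧
      ∀ c : ℝ, (S.filter fun i => c ≤ σ i).card =
        (M.submatrix (Subtype.val : {i // c ≤ σ i} → ι) id).rank := by
  obtain ⟨S, h1, h2⟩ := exists_greedy M.row σ
  refine ⟨S, h1, fun c => ?_⟩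
  have h3 : LinearIndependent ℂ fun i : S.filter fun i => c ≤ σ i => M.row i :=
    h1.mono (by intro i hi; exact (Finset.mem_filter.1 hi).1)
  rw [rank_eq_finrank_span_row]
  have h4 := finrank_span_eq_card h3
  rw [Fintype.card_coe] at h4
  rw [← h4]
  have : Submodule.span ℂ (Set.range fun i : S.filter fun i => c ≤ σ i => M.row i) =
    Submodule.span ℂ (Set.range
      (M.submatrix (Subtype.val : {i // c ≤ σ i} → ι) id).row) := by
    apply le_antisymm
    · rw [Submodule.span_le]
      rintro _ ⟨i, rfl⟩
      exact Submodule.subset_span ⟨⟨i, (Finset.mem_filter.1 i.2).2⟩, rfl⟩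
    · rw [Submodule.span_le]
      rintro _ ⟨i, rfl⟩
      refine Submodule.span_mono ?_ (h2 i)
      rintro _ ⟨j, hj, rfl⟩
      exact ⟨⟨j, Finset.mem_filter.2 ⟨hj.1, i.2.trans hj.2⟩⟩, rfl⟩
  rw [this]

section LocalSlope

variable {n : ℕ}

lemma card_pre {k : ℕ} (hk : k ≤ n) : Fintype.card {j : Fin n // j.val < k} = k := by
  rw [Fintype.card_subtype]
  have h2 : (Finset.univ.filter fun j : Fin n => j.val < k).card = min k n := by
    have : (Finset.univ.filter fun j : Fin n => j.val < k) =
        (Finset.univ : Finset (Fin (min k n))).map (Fin.castLEEmb (min_le_right k n)) := by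
      ext j
      simp only [Finset.mem_filter, Finset.mem_univ, true_and, Finset.mem_map]
      constructor
      · intro h
        exact ⟨⟨j, lt_min h j.2⟩, Fin.ext rfl⟩
      · rintro ⟨i, rfl⟩
        exact lt_of_lt_of_le i.2 (min_le_left k n)
    rw [this, Finset.card_map, Finset.card_univ, Fintype.card_fin]
  rw [h2, min_eq_left hk]

lemma norm_minor_full (M : Matrix (Fin n) (Fin n) ℂ) : ‖minor M n‖ = ‖M.det‖ := by
  exact congrArg _ (det_submatrix_equiv_self (Equiv.subtypeUnivEquiv fun j : Fin n => j.isLt) M)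

lemma norm_det_pivot_le {κ : Type*} [Fintype κ] [DecidableEq κ] (V : Matrix (Fin n) κ ℂ)
    (S : Finset (Fin n)) (e : κ ≃ S) (hU : (V.submatrix (fun j => (e j).1) id).det ≠ 0)
    (s : Fin n → ℝ) :
    2 * Real.log ‖(V.submatrix (fun j => (e j).1) id).det‖ + ∑ i ∈ S, s i ≤
      Real.log ‖(Vᴴ * diagonal (fun i => (Real.exp (s i) : ℂ)) * V).det‖ := by
  set U := V.submatrix (fun j => (e j).1) id with hUdef
  set D : Matrix κ κ ℂ := diagonal fun j => (Real.exp (s (e j).1) : ℂ) with hD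
  have hDp : D.PosDef := by
    rw [hD]
    exact PosDef.diagonal fun j => by exact_mod_cast Real.exp_pos _
  have hB : (Uᴴ * D * U).PosDef := hDp.conjTranspose_mul_mul_same
    (mulVec_injective_iff_isUnit.2 ((isUnit_iff_isUnit_det _).2 (isUnit_iff_ne_zero.2 hU)))
  have hBe : Uᴴ * D * U =
      Vᴴ * diagonal (fun i => if i ∈ S then (Real.exp (s i) : ℂ) else 0) * V := by
    ext a b
    simp only [Matrix.mul_apply (M := _ * _), hD, mul_diagonal, conjTranspose_apply, hUdef,
      submatrix_apply, id]
    rw [Equiv.sum_comp e (fun i : S => star (V i a) * (Real.exp (s i) : ℂ) * V i b),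
      Finset.sum_coe_sort S (fun i => star (V i a) * (Real.exp (s i) : ℂ) * V i b),
      ← Finset.sum_filter_add_sum_filter_not Finset.univ (· ∈ S)]
    rw [Finset.sum_eq_zero (s := Finset.univ.filter (fun x => ¬ (x ∈ S))), add_zero]
    · refine Finset.sum_congr (by ext; simp) fun i hi => ?_
      rw [if_pos (Finset.mem_filter.1 hi).2]
    · intro i hi
      rw [if_neg (Finset.mem_filter.1 hi).2]; simp
  have hAB : (Vᴴ * diagonal (fun i => (Real.exp (s i) : ℂ)) * V - Uᴴ * D * U).PosSemidef := by
    rw [hBe, ← Matrix.sub_mul, ← Matrix.mul_sub, diagonal_sub]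
    refine PosSemidef.conjTranspose_mul_mul_same (PosSemidef.diagonal fun i => ?_) V
    by_cases hi : i ∈ S
    · simp [hi]
    · simp only [hi, if_false, sub_zero, Pi.zero_apply]
      exact_mod_cast (Real.exp_pos _).le
  have h1 := norm_det_mono hB hAB
  have h2 : Real.log ‖(Uᴴ * D * U).det‖ = 2 * Real.log ‖U.det‖ + ∑ i ∈ S, s i := by
    have h3 : ‖D.det‖ = Real.exp (∑ i ∈ S, s i) := by
      rw [hD, det_diagonal, norm_prod, Real.exp_sum, ← Finset.prod_coe_sort S,
        ← Equiv.prod_comp e]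
      exact Finset.prod_congr rfl fun j _ => by
        rw [Complex.norm_real, Real.norm_eq_abs, abs_of_pos (Real.exp_pos _)]
    rw [det_mul, det_mul, det_conjTranspose, norm_mul, norm_mul, norm_star, h3,
      Real.log_mul (by simp [hU]) (by simp [hU]), Real.log_mul (by simp [hU]) (Real.exp_ne_zero _),
      Real.log_exp]
    ring
  rw [← h2]
  refine Real.log_le_log (norm_pos_iff.2 ?_) h1
  exact ((isUnit_iff_isUnit_det _).1 hB.isUnit).ne_zero

/-- Near an invertible matrix, the logarithm of a leading minor of a positive diagonal form is
bounded below by a partial trace that is optimal for a given direction. -/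
lemma exists_local_minor {V₀ : Matrix (Fin n) (Fin n) ℂ} (hV : V₀.det ≠ 0) (σ : Fin n → ℝ) {k : ℕ}
    (hk : k ≤ n) : ∃ S : Finset (Fin n), S.card = k ∧
      (∀ c : ℝ, (S.filter fun i => c ≤ σ i).card =
        preRank (V₀.submatrix (Subtype.val : {i // c ≤ σ i} → Fin n) id) k) ∧
      ∃ K : ℝ, ∀ᶠ V in 𝓝 V₀, ∀ s : Fin n → ℝ, ∑ i ∈ S, s i - K ≤
        Real.log ‖minor (Vᴴ * diagonal (fun i => (Real.exp (s i) : ℂ)) * V) k‖ := by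
  obtain ⟨S, hS, hc⟩ := exists_greedy_rows (V₀.submatrix id (pre n k)) σ
  have hcard : S.card = k := by
    obtain ⟨c, hcm⟩ : ∃ c : ℝ, ∀ i, c ≤ σ i := by
      obtain ⟨c, hc⟩ := (Set.finite_range σ).bddBelow
      exact ⟨c, fun i => hc ⟨i, rfl⟩⟩
    have h1 := hc c
    rw [Finset.filter_true_of_mem fun i _ => hcm i] at h1
    rw [h1]
    have h2 := rank_submatrix (V₀.submatrix id (pre n k))
      (Equiv.subtypeUnivEquiv hcm) (Equiv.refl _)
    have h3 : (V₀.submatrix id (pre n k)).rank = k := by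
      rw [← rank_transpose]
      have hr : LinearIndependent ℂ V₀ᵀ.row := by
        rw [linearIndependent_rows_iff_isUnit, isUnit_iff_isUnit_det, det_transpose]
        exact isUnit_iff_ne_zero.2 hV
      have h4 := (hr.comp (pre n k) Subtype.val_injective)
      have h5 := LinearIndependent.rank_matrix (M := (V₀.submatrix id (pre n k))ᵀ) h4
      rw [h5, card_pre hk]
    exact h2.trans h3
  refine ⟨S, hcard, fun c => hc c, ?_⟩
  obtain ⟨e⟩ : Nonempty ({j : Fin n // j.val < k} ≃ S) := by
    rw [← Fintype.card_eq, card_pre hk, Fintype.card_coe, hcard]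
  have hU : ((V₀.submatrix id (pre n k)).submatrix (fun j => (e j).1) id).det ≠ 0 := by
    have h1 : LinearIndependent ℂ
        ((V₀.submatrix id (pre n k)).submatrix (fun j => (e j).1) id).row :=
      LinearIndependent.comp hS e e.injective
    rw [linearIndependent_rows_iff_isUnit, isUnit_iff_isUnit_det] at h1
    exact h1.ne_zero
  have hcont : Continuous fun V : Matrix (Fin n) (Fin n) ℂ =>
      ((V.submatrix id (pre n k)).submatrix (fun j => (e j).1) id).det :=
    ((continuous_id.matrix_submatrix _ _).matrix_submatrix _ _).matrix_det
  have hlog : ContinuousAt (fun V : Matrix (Fin n) (Fin n) ℂ =>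
      Real.log ‖((V.submatrix id (pre n k)).submatrix (fun j => (e j).1) id).det‖) V₀ :=
    hcont.continuousAt.norm.log (norm_ne_zero_iff.2 hU)
  refine ⟨-(2 * (Real.log ‖((V₀.submatrix id (pre n k)).submatrix (fun j => (e j).1) id).det‖ - 1)),
    ?_⟩
  filter_upwards [hcont.continuousAt.eventually_ne hU, hlog.eventually
    (lt_mem_nhds (sub_one_lt _))] with V h1 h2 s
  have h3 := norm_det_pivot_le (V.submatrix id (pre n k)) S e h1 s
  have h4 : minor (Vᴴ * diagonal (fun i => (Real.exp (s i) : ℂ)) * V) k =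
      ((V.submatrix id (pre n k))ᴴ * diagonal (fun i => (Real.exp (s i) : ℂ)) *
        V.submatrix id (pre n k)).det := rfl
  rw [h4]
  linarith

lemma exists_local_slope {w : Fin n → ℝ} (hw : Antitone w) {V₀ : Matrix (Fin n) (Fin n) ℂ}
    (hV : V₀.det ≠ 0) (σ : Fin n → ℝ) : ∃ L : (Fin n → ℝ) →ₗ[ℝ] ℝ,
      (∀ c : ℝ, L (fun i => if c ≤ σ i then 1 else 0) =
        sl w (V₀.submatrix (Subtype.val : {i // c ≤ σ i} → Fin n) id)) ∧
      L 1 = ∑ i, w i ∧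
      ∃ K : ℝ, ∀ᶠ V in 𝓝 V₀, ∀ s : Fin n → ℝ, L s - K ≤
        ell w (Vᴴ * diagonal (fun i => (Real.exp (s i) : ℂ)) * V) := by
  have h := fun k : ℕ => fun hk : k ≤ n => exists_local_minor hV σ hk
  choose! S hS hc K hK using h
  obtain ⟨L, hL⟩ : ∃ L : (Fin n → ℝ) →ₗ[ℝ] ℝ, ∀ s, L s = slope w fun k => ∑ i ∈ S k, s i := by
    refine ⟨IsLinearMap.mk' (fun s => slope w fun k => ∑ i ∈ S k, s i)
      ⟨fun s t => ?_, fun t s => ?_⟩, fun s => rfl⟩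
    · rw [← slope_add_right]
      simp [Finset.sum_add_distrib]
    · simp only [slope, Pi.smul_apply, smul_eq_mul, ← Finset.mul_sum]
      rw [Finset.mul_sum]
      exact Finset.sum_congr rfl fun i _ => by rw [← mul_sub]; ring
  refine ⟨L, fun c => ?_, ?_, ?_⟩
  · rw [hL]
    refine slope_congr w fun k hk => ?_
    rw [← hc k hk, Finset.sum_ite, Finset.sum_const_zero, add_zero, Finset.sum_const, nsmul_eq_mul,
      mul_one]
  · have : ∀ k ≤ n, ∑ i ∈ S k, (1 : Fin n → ℝ) i = (k : ℝ) := fun k hk => by simp [hS k hk]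
    rw [hL, slope_congr w this]
    simp [slope]
  · set K₁ : ℝ := (∑ k ∈ Finset.range (n + 1), |K k|) + (|2 * Real.log ‖V₀.det‖| + 1) with hK₁
    have hpos : 0 ≤ ∑ k ∈ Finset.range (n + 1), |K k| := Finset.sum_nonneg fun _ _ => abs_nonneg _
    have hKle : ∀ k ≤ n, K k ≤ K₁ := fun k hk => by
      have := Finset.single_le_sum (fun k _ => abs_nonneg (K k))
        (Finset.mem_range.2 (Nat.lt_succ_of_le hk))
      have h2 := le_abs_self (K k)
      have h3 := abs_nonneg (2 * Real.log ‖V₀.det‖)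
      linarith
    refine ⟨2 * K₁ * ∑ i, |w i|, ?_⟩
    have hdet : Continuous fun V : Matrix (Fin n) (Fin n) ℂ => V.det := continuous_id.matrix_det
    have hlog : ContinuousAt (fun V : Matrix (Fin n) (Fin n) ℂ => |2 * Real.log ‖V.det‖|) V₀ :=
      ((hdet.continuousAt.norm.log (norm_ne_zero_iff.2 hV)).const_mul 2).abs
    have hall : ∀ᶠ V in 𝓝 V₀, ∀ k ∈ Finset.range (n + 1), ∀ s : Fin n → ℝ, ∑ i ∈ S k, s i - K k ≤
        Real.log ‖minor (Vᴴ * diagonal (fun i => (Real.exp (s i) : ℂ)) * V) k‖ :=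
      (Filter.eventually_all_finset _).2 fun k hk =>
        hK k (Nat.lt_succ_iff.1 (Finset.mem_range.1 hk))
    filter_upwards [hall, hdet.continuousAt.eventually_ne hV,
      hlog.eventually (gt_mem_nhds (lt_add_one _))] with V h1 h2 h3 s
    rw [hL]
    refine slope_mono_of_bounded w hw _ _ K₁ (by positivity) ?_ ?_ fun k hk => ?_
    · have : S 0 = ∅ := Finset.card_eq_zero.1 (hS 0 (Nat.zero_le _))
      simp only [this, Finset.sum_empty, minor]
      haveI : IsEmpty {j : Fin n // j.val < 0} := ⟨fun j => absurd j.2 (Nat.not_lt_zero _)⟩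
      rw [det_isEmpty]
      simp only [norm_one, Real.log_one, sub_zero, abs_zero]
      positivity
    · have hu : S n = Finset.univ := Finset.eq_univ_of_card _ (by simp [hS n le_rfl])
      have h5 : ‖(diagonal fun i => (Real.exp (s i) : ℂ)).det‖ = Real.exp (∑ i, s i) := by
        rw [det_diagonal, norm_prod, Real.exp_sum]
        exact Finset.prod_congr rfl fun j _ => by
          rw [Complex.norm_real, Real.norm_eq_abs, abs_of_pos (Real.exp_pos _)]
      rw [hu, norm_minor_full, det_mul, det_mul, det_conjTranspose, norm_mul, norm_mul, norm_star,
        h5, Real.log_mul (by simp [h2]) (by simp [h2]),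
        Real.log_mul (by simp [h2]) (Real.exp_ne_zero _), Real.log_exp]
      rw [show ∑ i, s i - (Real.log ‖V.det‖ + ∑ i, s i + Real.log ‖V.det‖) =
        -(2 * Real.log ‖V.det‖) by ring, abs_neg]
      linarith
    · have := h1 k (Finset.mem_range.2 (Nat.lt_succ_of_le hk)) s
      linarith [hKle k hk]

end LocalSlope

lemma map_nonneg_of_levels {ι : Type*} [Fintype ι] [DecidableEq ι] (L : (ι → ℝ) →ₗ[ℝ] ℝ)
    (h1 : L 1 = 0) (σ : ι → ℝ) (h : ∀ c : ℝ, 0 ≤ L (fun i => if c ≤ σ i then 1 else 0)) :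
    0 ≤ L σ := by
  have hL : ∀ f, L f = ∑ i, f i * L (Pi.single i 1) := fun f => by
    rw [LinearMap.pi_apply_eq_sum_univ L f]
    refine Finset.sum_congr rfl fun i _ => ?_
    rw [smul_eq_mul]
    congr 2
    ext j
    by_cases hij : i = j
    · subst hij; simp
    · simp [hij, Ne.symm hij]
  obtain ⟨M, hM⟩ : ∃ M : ℝ, ∀ i, |σ i| ≤ M := by
    obtain ⟨M, hM⟩ := (Set.finite_range fun i => |σ i|).bddAbove
    exact ⟨M, fun i => hM ⟨i, rfl⟩⟩
  have hint : ∀ i, IntervalIntegrable (fun c : ℝ => if c ≤ σ i then (1 : ℝ) else 0)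
      MeasureTheory.volume (-M) M := fun i => by
    refine AntitoneOn.intervalIntegrable fun x _ y _ hxy => ?_
    by_cases hy : y ≤ σ i
    · simp [hy, hxy.trans hy]
    · simp only [hy, if_false]; split_ifs <;> norm_num
  have hval : ∀ i, ∫ c in (-M)..M, (if c ≤ σ i then (1 : ℝ) else 0) = σ i + M := fun i => by
    have hi := abs_le.1 (hM i)
    have := intervalIntegral.integral_indicator (f := fun _ : ℝ => (1 : ℝ))
      (μ := MeasureTheory.volume) (a₁ := -M) (a₂ := σ i) (a₃ := M) ⟨hi.1, hi.2⟩
    rw [show ({x | x ≤ σ i} : Set ℝ).indicator (fun _ : ℝ => (1 : ℝ)) =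
      fun c => if c ≤ σ i then (1 : ℝ) else 0 from by
        funext c; by_cases hc : c ≤ σ i <;> simp [Set.indicator, hc]] at this
    rw [this]; simp
  rcases isEmpty_or_nonempty ι with hE | ⟨⟨i0⟩⟩
  · rw [hL]; simp
  have hM0 : 0 ≤ M := (abs_nonneg _).trans (hM i0)
  have key : ∫ c in (-M)..M, L (fun i => if c ≤ σ i then 1 else 0) = L σ := by
    have e : (fun c : ℝ => L (fun i => if c ≤ σ i then 1 else 0)) = fun c =>
        ∑ i, (if c ≤ σ i then (1 : ℝ) else 0) * L (Pi.single i 1) := funext fun c => hL _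
    rw [e, intervalIntegral.integral_finsetSum fun i _ => (hint i).mul_const _]
    simp only [intervalIntegral.integral_mul_const, hval, add_mul]
    rw [Finset.sum_add_distrib, ← hL σ, ← Finset.mul_sum]
    have := hL 1
    simp only [Pi.one_apply, one_mul] at this
    rw [← this, h1]; simp
  rw [← key]
  exact intervalIntegral.integral_nonneg (by linarith) fun c _ => h c

section Blocks

variable {n : ℕ}

/-- The positive definite matrix with given eigenvectors and logarithms of eigenvalues. -/
def expForm (U : Matrix (Fin n) (Fin n) ℂ) (s : Fin n → ℝ) : Matrix (Fin n) (Fin n) ℂ :=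
  U * diagonal (fun i => (Real.exp (s i) : ℂ)) * Uᴴ

/-- The contribution of a positive definite block to the potential. -/
def blk (a b c : Fin n → ℝ) (f g P : Matrix (Fin n) (Fin n) ℂ) : ℝ :=
  ell a (fᴴ * P * f) + ell b (gᴴ * P * g) + ell c P

lemma PosDef.exists_expForm {P : Matrix (Fin n) (Fin n) ℂ} (hP : P.PosDef) :
    ∃ U s, Uᴴ * U = 1 ∧ P = expForm U s := by
  refine ⟨(hP.1.eigenvectorUnitary : Matrix (Fin n) (Fin n) ℂ),
    fun i => Real.log (hP.1.eigenvalues i),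
    Unitary.star_mul_self_of_mem hP.1.eigenvectorUnitary.2, ?_⟩
  have hs := hP.1.spectral_theorem
  simp only [expForm, Real.exp_log (hP.eigenvalues_pos _)]
  exact hs

lemma expForm_inv {U : Matrix (Fin n) (Fin n) ℂ} (hU : Uᴴ * U = 1) (s : Fin n → ℝ) :
    (expForm U s)⁻¹ = expForm U (-s) := by
  refine inv_eq_right_inv ?_
  have : (diagonal fun i => (Real.exp (s i) : ℂ)) * diagonal (fun i => (Real.exp ((-s) i) : ℂ)) =
      (1 : Matrix (Fin n) (Fin n) ℂ) := by
    rw [diagonal_mul_diagonal, ← diagonal_one]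
    congr 1
    funext i
    rw [← Complex.ofReal_mul, ← Real.exp_add]; simp
  calc expForm U s * expForm U (-s) = U * (diagonal (fun i => (Real.exp (s i) : ℂ)) * (Uᴴ * U) *
        diagonal (fun i => (Real.exp ((-s) i) : ℂ))) * Uᴴ := by
        simp only [expForm, Matrix.mul_assoc]
    _ = 1 := by rw [hU, Matrix.mul_one, this, Matrix.mul_one, mul_eq_one_comm.1 hU]

lemma half_sum_abs_le_size {U : Matrix (Fin n) (Fin n) ℂ} (hU : Uᴴ * U = 1) (s : Fin n → ℝ) :
    1 / 2 * ∑ i, |s i| ≤ size (expForm U s) := by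
  have hUU := mul_eq_one_comm.1 hU
  have hdU : ∀ d : Fin n → ℂ, (U * diagonal d * Uᴴ).det = ∏ i, d i := fun d => by
    rw [det_mul, mul_comm, ← det_mul, ← Matrix.mul_assoc, hU, Matrix.one_mul, det_diagonal]
  have h1 : (expForm U s).det = ∏ i, (Real.exp (s i) : ℂ) := hdU _
  have h2 : (expForm U s + 1).det = ∏ i, ((Real.exp (s i) + 1 : ℝ) : ℂ) := by
    rw [← hdU, expForm]
    congr 1
    have : (diagonal fun i => ((Real.exp (s i) + 1 : ℝ) : ℂ)) =
        (diagonal fun i => (Real.exp (s i) : ℂ)) + (1 : Matrix (Fin n) (Fin n) ℂ) := by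
      rw [← diagonal_one, diagonal_add]; simp
    rw [this, Matrix.mul_add, Matrix.add_mul, Matrix.mul_one, hUU]
  have hpos : ∀ i, 0 < Real.exp (s i) := fun i => Real.exp_pos _
  rw [size, h1, h2, norm_prod, norm_prod, Real.log_prod (fun i _ => by
      rw [Complex.norm_real, norm_ne_zero_iff]; linarith [hpos i]), Real.log_prod (fun i _ => by
      rw [Complex.norm_real, norm_ne_zero_iff]; linarith [hpos i]), Finset.mul_sum, Finset.mul_sum,
    ← Finset.sum_sub_distrib]
  refine Finset.sum_le_sum fun i _ => ?_
  rw [Complex.norm_real, Complex.norm_real, Real.norm_eq_abs, Real.norm_eq_abs,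
    abs_of_pos (hpos i), abs_of_pos (a := Real.exp (s i) + 1) (by linarith [hpos i]), Real.log_exp]
  have h3 : s i ≤ Real.log (Real.exp (s i) + 1) := by
    rw [Real.le_log_iff_exp_le (by linarith [hpos i])]; linarith
  have h4 : 0 ≤ Real.log (Real.exp (s i) + 1) := Real.log_nonneg (by linarith [hpos i])
  rcases abs_cases (s i) with ⟨h, -⟩ | ⟨h, -⟩ <;> rw [h] <;> linarith

lemma exists_local_blk {a b c : Fin n → ℝ} (ha : Antitone a) (hb : Antitone b) (hc : Antitone c)
    {f g : Matrix (Fin n) (Fin n) ℂ} (hf : f.det ≠ 0) (hg : g.det ≠ 0)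
    {U₀ : Matrix (Fin n) (Fin n) ℂ} (hU : U₀ᴴ * U₀ = 1) (σ : Fin n → ℝ) :
    ∃ L : (Fin n → ℝ) →ₗ[ℝ] ℝ,
      (∀ t : ℝ, L (fun i => if t ≤ σ i then 1 else 0) =
        sl a (U₀ᴴ.submatrix (Subtype.val : {i // t ≤ σ i} → Fin n) id * f) +
        sl b (U₀ᴴ.submatrix (Subtype.val : {i // t ≤ σ i} → Fin n) id * g) +
        sl c (U₀ᴴ.submatrix (Subtype.val : {i // t ≤ σ i} → Fin n) id)) ∧
      L 1 = ∑ i, (a i + b i + c i) ∧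
      ∃ K : ℝ, ∀ᶠ U in 𝓝 U₀, ∀ s : Fin n → ℝ, L s - K ≤ blk a b c f g (expForm U s) := by
  have hd : U₀ᴴ.det ≠ 0 := fun h => by
    have := congrArg det hU
    rw [det_mul, h] at this
    simp at this
  have key : ∀ {w : Fin n → ℝ} (_ : Antitone w) {f : Matrix (Fin n) (Fin n) ℂ} (_ : f.det ≠ 0),
      ∃ L : (Fin n → ℝ) →ₗ[ℝ] ℝ, (∀ t : ℝ, L (fun i => if t ≤ σ i then 1 else 0) =
        sl w (U₀ᴴ.submatrix (Subtype.val : {i // t ≤ σ i} → Fin n) id * f)) ∧ L 1 = ∑ i, w i ∧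
      ∃ K : ℝ, ∀ᶠ U in 𝓝 U₀, ∀ s : Fin n → ℝ, L s - K ≤ ell w (fᴴ * expForm U s * f) := by
    intro w hw f hf
    obtain ⟨L, h1, h2, K, hK⟩ := exists_local_slope hw (V₀ := U₀ᴴ * f)
      (by rw [det_mul]; exact mul_ne_zero hd hf) σ
    refine ⟨L, h1, h2, K, ?_⟩
    have hcont : Continuous fun U : Matrix (Fin n) (Fin n) ℂ => Uᴴ * f :=
      (continuous_id.matrix_conjTranspose).matrix_mul continuous_const
    filter_upwards [hcont.continuousAt.eventually hK] with U hU s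
    refine (hU s).trans_eq ?_
    congr 1
    simp only [expForm, conjTranspose_mul, conjTranspose_conjTranspose, Matrix.mul_assoc]
  obtain ⟨L₁, h₁, i₁, K₁, hK₁⟩ := key ha hf
  obtain ⟨L₂, h₂, i₂, K₂, hK₂⟩ := key hb hg
  obtain ⟨L₃, h₃, i₃, K₃, hK₃⟩ := key hc (f := 1) (by simp)
  refine ⟨L₁ + L₂ + L₃, fun t => ?_, ?_, K₁ + K₂ + K₃, ?_⟩
  · simp only [LinearMap.add_apply, h₁, h₂, h₃, Matrix.mul_one]
  · simp only [LinearMap.add_apply, i₁, i₂, i₃, Finset.sum_add_distrib]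
  · filter_upwards [hK₁, hK₂, hK₃] with U u₁ u₂ u₃ s
    have := u₁ s
    have := u₂ s
    have := u₃ s
    simp only [conjTranspose_one, Matrix.one_mul, Matrix.mul_one] at this
    simp only [LinearMap.add_apply, blk]
    linarith

lemma isCompact_unitary : IsCompact {U : Matrix (Fin n) (Fin n) ℂ | Uᴴ * U = 1} := by
  have hc : IsCompact (Set.pi Set.univ fun _ : Fin n => Set.pi Set.univ fun _ : Fin n =>
      Metric.closedBall (0 : ℂ) 1) :=
    isCompact_univ_pi fun _ => isCompact_univ_pi fun _ => isCompact_closedBall _ _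
  refine IsCompact.of_isClosed_subset hc ?_ ?_
  · exact isClosed_eq ((continuous_id.matrix_conjTranspose).matrix_mul continuous_id)
      continuous_const
  · intro U hU i _ j _
    rw [mem_closedBall_zero_iff]
    exact entry_norm_bound_of_unitary
      (mem_unitaryGroup_iff'.2 hU) i j

end Blocks

section BaseBound

variable {p q : ℕ}

lemma trace_expForm (U₁ : Matrix (Fin p) (Fin p) ℂ) (U₂ : Matrix (Fin q) (Fin q) ℂ)
    (X : Matrix (Fin p) (Fin q) ℂ) (s₁ : Fin p → ℝ) (s₂ : Fin q → ℝ) :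
    (expForm U₂ (-s₂) * (Xᴴ * expForm U₁ s₁ * X)).trace.re =
      ∑ j, ∑ i, Real.exp (s₁ i - s₂ j) * ‖(U₁ᴴ * X * U₂) i j‖ ^ 2 := by
  set W := U₁ᴴ * X * U₂ with hW
  have h1 : (expForm U₂ (-s₂) * (Xᴴ * expForm U₁ s₁ * X)).trace =
      (diagonal (fun i => (Real.exp ((-s₂) i) : ℂ)) *
        (Wᴴ * (diagonal (fun i => (Real.exp (s₁ i) : ℂ)) * W))).trace := by
    have : expForm U₂ (-s₂) * (Xᴴ * expForm U₁ s₁ * X) =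
      U₂ * (diagonal (fun i => (Real.exp ((-s₂) i) : ℂ)) * (U₂ᴴ * Xᴴ * U₁ *
        diagonal (fun i => (Real.exp (s₁ i) : ℂ)) * (U₁ᴴ * X))) := by
      simp only [expForm, Matrix.mul_assoc]
    rw [this, trace_mul_comm, hW]
    simp only [conjTranspose_mul, conjTranspose_conjTranspose, Matrix.mul_assoc]
  rw [h1, trace, Complex.re_sum]
  refine Finset.sum_congr rfl fun j _ => ?_
  rw [diag_apply, diagonal_mul, Matrix.mul_apply, Finset.mul_sum, Complex.re_sum]
  refine Finset.sum_congr rfl fun i _ => ?_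
  rw [diagonal_mul, conjTranspose_apply]
  have h2 : star (W i j) * W i j = ((‖W i j‖ ^ 2 : ℝ) : ℂ) := by
    push_cast; exact Complex.conj_mul' _
  rw [show (Real.exp ((-s₂) j) : ℂ) * (star (W i j) * ((Real.exp (s₁ i) : ℂ) * W i j)) =
    ((Real.exp ((-s₂) j) : ℝ) : ℂ) * ((Real.exp (s₁ i) : ℝ) : ℂ) * (star (W i j) * W i j) by ring,
    h2,
    ← Complex.ofReal_mul, ← Complex.ofReal_mul, Complex.ofReal_re, ← Real.exp_add, Pi.neg_apply,
    show -s₂ j + s₁ i = s₁ i - s₂ j by ring]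

lemma exp_mul_sq_le_trace (U₁ : Matrix (Fin p) (Fin p) ℂ) (U₂ : Matrix (Fin q) (Fin q) ℂ)
    (X : Matrix (Fin p) (Fin q) ℂ) (s₁ : Fin p → ℝ) (s₂ : Fin q → ℝ) (i : Fin p) (j : Fin q) :
    Real.exp (s₁ i - s₂ j) * ‖(U₁ᴴ * X * U₂) i j‖ ^ 2 ≤
      (expForm U₂ (-s₂) * (Xᴴ * expForm U₁ s₁ * X)).trace.re := by
  rw [trace_expForm]
  refine le_trans ?_ (Finset.single_le_sum (f := fun j => ∑ i,
    Real.exp (s₁ i - s₂ j) * ‖(U₁ᴴ * X * U₂) i j‖ ^ 2)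
    (fun _ _ => by positivity) (Finset.mem_univ j))
  exact Finset.single_le_sum (f := fun i =>
    Real.exp (s₁ i - s₂ j) * ‖(U₁ᴴ * X * U₂) i j‖ ^ 2)
    (fun _ _ => by positivity) (Finset.mem_univ i)

lemma exists_linear_le_exp {C a d : ℝ} (ha : 0 < a) (hd : 0 < d) :
    ∃ K : ℝ, ∀ T : ℝ, 0 ≤ T → C * T - K ≤ a * Real.exp (d * T) := by
  refine ⟨C ^ 2 / (2 * a * d ^ 2), fun T hT => ?_⟩
  have h1 := Real.quadratic_le_exp_of_nonneg (x := d * T) (by positivity)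
  have h2 : a * ((d * T) ^ 2 / 2) ≤ a * Real.exp (d * T) :=
    mul_le_mul_of_nonneg_left (by nlinarith [mul_nonneg hd.le hT]) ha.le
  refine le_trans ?_ h2
  rw [sub_le_iff_le_add, ← sub_le_iff_le_add', le_div_iff₀ (by positivity)]
  nlinarith [sq_nonneg (a * d ^ 2 * T - C)]

/-- Numerical semistability bounds the slope of the potential along every ray. -/
lemma Config.Numeric.exists_local_bound {D : Config p q} {a₁ b₁ c₁ : Fin p → ℝ}
    {a₂ b₂ c₂ : Fin q → ℝ} (hN : D.Numeric a₁ b₁ c₁ a₂ b₂ c₂) (hD : D.Invertible)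
    (ha₁ : Antitone a₁) (hb₁ : Antitone b₁) (hc₁ : Antitone c₁)
    (ha₂ : Antitone a₂) (hb₂ : Antitone b₂) (hc₂ : Antitone c₂)
    (hsum : ∑ i, (a₁ i + b₁ i + c₁ i) + ∑ j, (a₂ j + b₂ j + c₂ j) = 0)
    {η c : ℝ} (hη : 0 < η) (hc : 0 < c)
    {U₁ : Matrix (Fin p) (Fin p) ℂ} {U₂ : Matrix (Fin q) (Fin q) ℂ} (hU₁ : U₁ᴴ * U₁ = 1)
    (hU₂ : U₂ᴴ * U₂ = 1) (σ₁ : Fin p → ℝ) (σ₂ : Fin q → ℝ) :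
    ∃ K : ℝ, ∀ᶠ θ : (Matrix (Fin p) (Fin p) ℂ × Matrix (Fin q) (Fin q) ℂ) ×
        ((Fin p → ℝ) × (Fin q → ℝ)) in 𝓝 ((U₁, U₂), (σ₁, σ₂)), ∀ T : ℝ, 0 ≤ T →
      -η * T - K ≤ blk a₁ b₁ c₁ D.fA D.fB (expForm θ.1.1 (T • θ.2.1)) +
        blk a₂ b₂ c₂ D.gA D.gB (expForm θ.1.2 (T • θ.2.2)) +
        c * (expForm θ.1.2 (-(T • θ.2.2)) *
          (D.Xᴴ * expForm θ.1.1 (T • θ.2.1) * D.X)).trace.re := by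
  obtain ⟨L₁, l₁, o₁, K₁, k₁⟩ := exists_local_blk ha₁ hb₁ hc₁ hD.fA hD.fB hU₁ σ₁
  obtain ⟨L₂, l₂, o₂, K₂, k₂⟩ := exists_local_blk ha₂ hb₂ hc₂ hD.gA hD.gB hU₂ σ₂
  set Θ := (Matrix (Fin p) (Fin p) ℂ × Matrix (Fin q) (Fin q) ℂ) × ((Fin p → ℝ) × (Fin q → ℝ))
  set θ₀ : Θ := ((U₁, U₂), (σ₁, σ₂)) with hθ₀
  have e₁ : ∀ᶠ θ : Θ in 𝓝 θ₀, ∀ s, L₁ s - K₁ ≤ blk a₁ b₁ c₁ D.fA D.fB (expForm θ.1.1 s) :=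
    (continuous_fst.fst.continuousAt (x := θ₀)).eventually k₁
  have e₂ : ∀ᶠ θ : Θ in 𝓝 θ₀, ∀ s, L₂ s - K₂ ≤ blk a₂ b₂ c₂ D.gA D.gB (expForm θ.1.2 s) :=
    (continuous_fst.snd.continuousAt (x := θ₀)).eventually k₂
  have hL : Continuous fun θ : Θ => L₁ θ.2.1 + L₂ θ.2.2 :=
    ((LinearMap.continuous_of_finiteDimensional L₁).comp continuous_snd.fst).add
      ((LinearMap.continuous_of_finiteDimensional L₂).comp continuous_snd.snd)
  have hWc : Continuous fun θ : Θ => θ.1.1ᴴ * D.X * θ.1.2 :=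
    ((continuous_fst.fst.matrix_conjTranspose).matrix_mul continuous_const).matrix_mul
      continuous_fst.snd
  by_cases hcomp : ∀ i j, σ₂ j < σ₁ i → (U₁ᴴ * D.X * U₂) i j = 0
  · have hpos : 0 ≤ L₁ σ₁ + L₂ σ₂ := by
      have := map_nonneg_of_levels
        (L₁ ∘ₗ LinearMap.funLeft ℝ ℝ Sum.inl + L₂ ∘ₗ LinearMap.funLeft ℝ ℝ Sum.inr)
        (by
          have u₁ : LinearMap.funLeft ℝ ℝ (Sum.inl : Fin p → Fin p ⊕ Fin q) 1 = 1 := rfl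
          have u₂ : LinearMap.funLeft ℝ ℝ (Sum.inr : Fin q → Fin p ⊕ Fin q) 1 = 1 := rfl
          simp only [LinearMap.add_apply, LinearMap.comp_apply, u₁, u₂, o₁, o₂, hsum])
        (Sum.elim σ₁ σ₂) (fun t => ?_)
      · exact this
      · change 0 ≤ L₁ (fun i => if t ≤ σ₁ i then 1 else 0) + L₂ (fun i => if t ≤ σ₂ i then 1 else 0)
        rw [l₁, l₂]
        have li : ∀ {n : ℕ} {U : Matrix (Fin n) (Fin n) ℂ} (_ : Uᴴ * U = 1) (σ : Fin n → ℝ),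
            LinearIndependent ℂ
              (Uᴴ.submatrix (Subtype.val : {i // t ≤ σ i} → Fin n) id).row := by
          intro n U hU σ
          have hu : LinearIndependent ℂ Uᴴ.row := by
            rw [linearIndependent_rows_iff_isUnit]
            exact IsUnit.of_mul_eq_one _ hU
          exact hu.comp _ Subtype.val_injective
        refine hN _ _ _ _ ((U₁ᴴ * D.X * U₂).submatrix (Subtype.val : {i // t ≤ σ₁ i} → Fin p)
          (Subtype.val : {i // t ≤ σ₂ i} → Fin q)) (li hU₁ σ₁) (li hU₂ σ₂) ?_
        have h1 : U₁ᴴ * D.X = U₁ᴴ * D.X * U₂ * U₂ᴴ := by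
          rw [Matrix.mul_assoc _ U₂, mul_eq_one_comm.1 hU₂, Matrix.mul_one]
        ext i j
        change (U₁ᴴ * D.X) i.1 j = _
        refine (congrFun (congrFun h1 i.1) j).trans ?_
        rw [Matrix.mul_apply, Matrix.mul_apply]
        simp only [submatrix_apply, id]
        symm
        refine (Finset.sum_subtype (Finset.univ.filter fun l => t ≤ σ₂ l)
          (p := fun l => t ≤ σ₂ l) (by simp) (fun l => (U₁ᴴ * D.X * U₂) i.1 l * U₂ᴴ l j)).symm.trans
          ?_
        refine Finset.sum_subset (Finset.subset_univ _) fun l _ hl => ?_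
        rw [hcomp i.1 l, zero_mul]
        have : ¬ t ≤ σ₂ l := fun h => hl (Finset.mem_filter.2 ⟨Finset.mem_univ _, h⟩)
        exact lt_of_lt_of_le (not_le.1 this) i.2
    refine ⟨K₁ + K₂, ?_⟩
    filter_upwards [e₁, e₂, hL.continuousAt.eventually (lt_mem_nhds
      (show -η < L₁ θ₀.2.1 + L₂ θ₀.2.2 from lt_of_lt_of_le (neg_lt_zero.2 hη) hpos))]
    with θ u₁ u₂ u₃ T hT
    have v₁ := u₁ (T • θ.2.1)
    have v₂ := u₂ (T • θ.2.2)
    rw [map_smul, smul_eq_mul] at v₁ v₂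
    have v₃ : 0 ≤ c * (expForm θ.1.2 (-(T • θ.2.2)) *
          (D.Xᴴ * expForm θ.1.1 (T • θ.2.1) * D.X)).trace.re := by
      rw [trace_expForm]; positivity
    have v₄ := mul_le_mul_of_nonneg_right u₃.le hT
    linarith
  · push Not at hcomp
    obtain ⟨i, j, hij, hW⟩ := hcomp
    set d := (σ₁ i - σ₂ j) / 2 with hd
    have hd0 : 0 < d := by rw [hd]; linarith
    set ω := ‖(U₁ᴴ * D.X * U₂) i j‖ ^ 2 / 2 with hω
    have hω0 : 0 < ω := by have := norm_pos_iff.2 hW; positivity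
    have c₁ : Continuous fun θ : Θ => ‖(θ.1.1ᴴ * D.X * θ.1.2) i j‖ ^ 2 :=
      ((hWc.matrix_elem i j).norm).pow 2
    have c₂ : Continuous fun θ : Θ => θ.2.1 i - θ.2.2 j := by fun_prop
    obtain ⟨K, hK⟩ := exists_linear_le_exp (C := -(L₁ σ₁ + L₂ σ₂ - 1)) (mul_pos hc hω0) hd0
    refine ⟨K₁ + K₂ + K, ?_⟩
    filter_upwards [e₁, e₂, hL.continuousAt.eventually (lt_mem_nhds
      (show L₁ σ₁ + L₂ σ₂ - 1 < L₁ θ₀.2.1 + L₂ θ₀.2.2 from sub_one_lt _)),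
      c₁.continuousAt.eventually (lt_mem_nhds
      (show ω < ‖(θ₀.1.1ᴴ * D.X * θ₀.1.2) i j‖ ^ 2 from by
        change ω < ‖(U₁ᴴ * D.X * U₂) i j‖ ^ 2; linarith)),
      c₂.continuousAt.eventually (lt_mem_nhds
      (show d < θ₀.2.1 i - θ₀.2.2 j from by change d < σ₁ i - σ₂ j; linarith))]
      with θ u₁ u₂ u₃ u₄ u₅ T hT
    have v₁ := u₁ (T • θ.2.1)
    have v₂ := u₂ (T • θ.2.2)
    rw [map_smul, smul_eq_mul] at v₁ v₂
    have v₃ : c * ω * Real.exp (d * T) ≤ c * (expForm θ.1.2 (-(T • θ.2.2)) *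
          (D.Xᴴ * expForm θ.1.1 (T • θ.2.1) * D.X)).trace.re := by
      rw [mul_assoc]
      refine mul_le_mul_of_nonneg_left ?_ hc.le
      refine le_trans ?_ (exp_mul_sq_le_trace θ.1.1 θ.1.2 D.X _ _ i j)
      rw [mul_comm]
      refine mul_le_mul (Real.exp_le_exp.2 ?_) u₄.le hω0.le (Real.exp_pos _).le
      have := mul_le_mul_of_nonneg_right u₅.le hT
      simp only [Pi.smul_apply, smul_eq_mul]
      linarith
    have v₄ := mul_le_mul_of_nonneg_right u₃.le hT
    have v₅ := hK T hT
    have v₆ : 0 ≤ η * T := by positivity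
    linarith

/-- A semistable configuration has a potential that is bounded below up to a small multiple of the
size. -/
theorem Config.Numeric.exists_bound {D : Config p q} {a₁ b₁ c₁ : Fin p → ℝ}
    {a₂ b₂ c₂ : Fin q → ℝ} (hN : D.Numeric a₁ b₁ c₁ a₂ b₂ c₂) (hD : D.Invertible)
    (ha₁ : Antitone a₁) (hb₁ : Antitone b₁) (hc₁ : Antitone c₁)
    (ha₂ : Antitone a₂) (hb₂ : Antitone b₂) (hc₂ : Antitone c₂)
    (hsum : ∑ i, (a₁ i + b₁ i + c₁ i) + ∑ j, (a₂ j + b₂ j + c₂ j) = 0)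
    {η c : ℝ} (hη : 0 < η) (hc : 0 < c) :
    ∃ K : ℝ, ∀ P Q, P.PosDef → Q.PosDef → -η * (size P + size Q) - K ≤
      blk a₁ b₁ c₁ D.fA D.fB P + blk a₂ b₂ c₂ D.gA D.gB Q +
        c * (Q⁻¹ * (D.Xᴴ * P * D.X)).trace.re := by
  have hcpt : IsCompact
      (({U : Matrix (Fin p) (Fin p) ℂ | Uᴴ * U = 1} ×ˢ {U : Matrix (Fin q) (Fin q) ℂ | Uᴴ * U = 1})
        ×ˢ (Metric.closedBall (0 : Fin p → ℝ) 1 ×ˢ Metric.closedBall (0 : Fin q → ℝ) 1)) :=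
    (isCompact_unitary.prod isCompact_unitary).prod
      ((isCompact_closedBall _ _).prod (isCompact_closedBall _ _))
  obtain ⟨K, hK⟩ := hcpt.induction_on (p := fun t => ∃ K : ℝ, ∀ θ ∈ t, ∀ T : ℝ, 0 ≤ T →
      -(η / 2) * T - K ≤ blk a₁ b₁ c₁ D.fA D.fB (expForm θ.1.1 (T • θ.2.1)) +
        blk a₂ b₂ c₂ D.gA D.gB (expForm θ.1.2 (T • θ.2.2)) +
        c * (expForm θ.1.2 (-(T • θ.2.2)) *
          (D.Xᴴ * expForm θ.1.1 (T • θ.2.1) * D.X)).trace.re)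
    ⟨0, by simp⟩ (fun s t hst ⟨K, hK⟩ => ⟨K, fun θ hθ => hK θ (hst hθ)⟩)
    (fun s t ⟨K, hK⟩ ⟨K', hK'⟩ => ⟨max K K', fun θ hθ T hT => by
      rcases hθ with h | h
      · exact le_trans (by linarith [le_max_left K K']) (hK θ h T hT)
      · exact le_trans (by linarith [le_max_right K K']) (hK' θ h T hT)⟩)
    (fun θ hθ => by
      obtain ⟨K, hK⟩ := hN.exists_local_bound hD ha₁ hb₁ hc₁ ha₂ hb₂ hc₂ hsum (half_pos hη) hc
        hθ.1.1 hθ.1.2 θ.2.1 θ.2.2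
      exact ⟨_, mem_nhdsWithin_of_mem_nhds hK, K, fun θ h => h⟩)
  refine ⟨K, fun P Q hP hQ => ?_⟩
  obtain ⟨U₁, s₁, hU₁, rfl⟩ := PosDef.exists_expForm hP
  obtain ⟨U₂, s₂, hU₂, rfl⟩ := PosDef.exists_expForm hQ
  set T := ∑ i, |s₁ i| + ∑ j, |s₂ j| with hT
  have t₁ : 0 ≤ ∑ i, |s₁ i| := Finset.sum_nonneg fun _ _ => abs_nonneg _
  have t₂ : 0 ≤ ∑ i, |s₂ i| := Finset.sum_nonneg fun _ _ => abs_nonneg _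
  have hT0 : 0 ≤ T := by linarith
  have hs₁ : ∀ i, |s₁ i| ≤ T := fun i => by
    have := Finset.single_le_sum (fun i _ => abs_nonneg (s₁ i)) (Finset.mem_univ i)
    linarith
  have hs₂ : ∀ i, |s₂ i| ≤ T := fun i => by
    have := Finset.single_le_sum (fun i _ => abs_nonneg (s₂ i)) (Finset.mem_univ i)
    linarith
  have scale : ∀ {n : ℕ} (s : Fin n → ℝ) (_ : ∀ i, |s i| ≤ T),
      T⁻¹ • s ∈ Metric.closedBall (0 : Fin n → ℝ) 1 ∧ T • T⁻¹ • s = s := by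
    intro n s hs
    constructor
    · rw [mem_closedBall_zero_iff, pi_norm_le_iff_of_nonneg zero_le_one]
      intro i
      rw [Pi.smul_apply, smul_eq_mul, norm_mul, Real.norm_eq_abs, Real.norm_eq_abs, abs_inv,
        abs_of_nonneg hT0]
      exact inv_mul_le_one_of_le₀ (hs i) hT0
    · rcases eq_or_lt_of_le hT0 with h | h
      · rw [← h]
        funext i
        have := hs i
        rw [← h] at this
        simp [abs_nonpos_iff.1 this]
      · rw [smul_smul, mul_inv_cancel₀ h.ne', one_smul]
  have h := hK ((U₁, U₂), (T⁻¹ • s₁, T⁻¹ • s₂)) ⟨⟨hU₁, hU₂⟩,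
    (scale s₁ hs₁).1, (scale s₂ hs₂).1⟩ T hT0
  simp only [(scale s₁ hs₁).2, (scale s₂ hs₂).2] at h
  rw [expForm_inv hU₂]
  refine le_trans ?_ h
  have z₁ := half_sum_abs_le_size hU₁ s₁
  have z₂ := half_sum_abs_le_size hU₂ s₂
  nlinarith

end BaseBound

section Topological

variable {m : Type*} [Fintype m] [DecidableEq m]

lemma PosDef.eventually_add_smul {A S : Matrix m m ℂ} (hA : A.PosDef) (hS : S.IsHermitian) :
    ∀ᶠ t : ℝ in 𝓝 0, (A + (t : ℂ) • S).PosDef := by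
  obtain ⟨B, hB, rfl⟩ := PosDef.exists_isUnit_factor hA
  have hT : ((B⁻¹)ᴴ * S * B⁻¹).IsHermitian := isHermitian_conjTranspose_mul_mul _ hS
  set U : Matrix m m ℂ := (hT.eigenvectorUnitary : Matrix m m ℂ) with hU
  have hs : (B⁻¹)ᴴ * S * B⁻¹ = U * diagonal (fun i => (hT.eigenvalues i : ℂ)) * Uᴴ :=
    hT.spectral_theorem
  have hUU : U * Uᴴ = 1 := Unitary.mul_star_self_of_mem hT.eigenvectorUnitary.2
  have hpos : ∀ᶠ t : ℝ in 𝓝 0, ∀ i, 0 < 1 + t * hT.eigenvalues i := by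
    rw [Filter.eventually_all]
    intro i
    have : Continuous fun t : ℝ => 1 + t * hT.eigenvalues i := by fun_prop
    exact this.continuousAt.eventually (lt_mem_nhds (by simp))
  filter_upwards [hpos] with t ht
  have hd : (diagonal fun i => ((1 + t * hT.eigenvalues i : ℝ) : ℂ)).PosDef :=
    PosDef.diagonal fun i => by exact_mod_cast ht i
  have hBt : Bᴴ * (B⁻¹)ᴴ = 1 := by
    rw [← conjTranspose_mul, nonsing_inv_mul _ hB, conjTranspose_one]
  have e : (Uᴴ * B)ᴴ * diagonal (fun i => ((1 + t * hT.eigenvalues i : ℝ) : ℂ)) * (Uᴴ * B) =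
      Bᴴ * B + (t : ℂ) • S := by
    have e1 : diagonal (fun i => ((1 + t * hT.eigenvalues i : ℝ) : ℂ)) =
        (1 : Matrix m m ℂ) + (t : ℂ) • diagonal (fun i => (hT.eigenvalues i : ℂ)) := by
      rw [← diagonal_one, ← diagonal_smul, diagonal_add]
      congr 1; funext i; simp
    have e2 : S = Bᴴ * (U * diagonal (fun i => (hT.eigenvalues i : ℂ)) * Uᴴ) * B := by
      rw [← hs]
      calc S = (Bᴴ * (B⁻¹)ᴴ) * S * (B⁻¹ * B) := by rw [hBt, nonsing_inv_mul _ hB]; simp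
        _ = _ := by simp only [Matrix.mul_assoc]
    calc _ = Bᴴ * (U * Uᴴ) * B +
          (t : ℂ) • (Bᴴ * (U * diagonal (fun i => (hT.eigenvalues i : ℂ)) * Uᴴ) * B) := by
          rw [e1, conjTranspose_mul, conjTranspose_conjTranspose, Matrix.mul_add, Matrix.add_mul,
            Matrix.mul_one, Matrix.mul_smul, Matrix.smul_mul]
          simp only [Matrix.mul_assoc]
      _ = _ := by rw [← e2, hUU, Matrix.mul_one]
  rw [← e]
  refine hd.conjTranspose_mul_mul_same (mulVec_injective_iff_isUnit.2 ?_)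
  rw [isUnit_iff_isUnit_det, det_mul]
  exact (isUnit_det_of_left_inverse hUU).mul hB

lemma isClosed_posSemidef : IsClosed {A : Matrix m m ℂ | A.PosSemidef} := by
  have : {A : Matrix m m ℂ | A.PosSemidef} = {A | Aᴴ = A} ∩
      ⋂ x : m → ℂ, {A | 0 ≤ star x ⬝ᵥ A *ᵥ x} := by
    ext A
    simp only [Set.mem_ofPred_eq, Set.mem_inter_iff, Set.mem_iInter]
    exact posSemidef_iff_dotProduct_mulVec
  rw [this]
  refine IsClosed.inter (isClosed_eq continuous_id.matrix_conjTranspose continuous_id)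
    (isClosed_iInter fun x => ?_)
  have hc : Continuous fun A : Matrix m m ℂ => star x ⬝ᵥ A *ᵥ x :=
    continuous_const.dotProduct (continuous_id.matrix_mulVec continuous_const)
  exact isClosed_le continuous_const hc

lemma norm_mul_apply_le {k l : Type*} {A : Matrix k m ℂ} {B : Matrix m l ℂ} {a b : ℝ} (ha : 0 ≤ a)
    (hA : ∀ i j, ‖A i j‖ ≤ a) (hB : ∀ i j, ‖B i j‖ ≤ b) (i : k) (j : l) :
    ‖(A * B) i j‖ ≤ Fintype.card m * (a * b) := by
  rw [Matrix.mul_apply]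
  refine (norm_sum_le _ _).trans ?_
  calc ∑ l, ‖A i l * B l j‖ ≤ ∑ _l : m, a * b := Finset.sum_le_sum fun l _ => by
        rw [norm_mul]
        exact mul_le_mul (hA i l) (hB l j) (norm_nonneg _) ha
    _ = _ := by simp

lemma isCompact_entries_le (R : ℝ) {k l : Type*} :
    IsCompact {A : Matrix k l ℂ | ∀ i j, ‖A i j‖ ≤ R} := by
  have hc : IsCompact (Set.pi Set.univ fun _ : k => Set.pi Set.univ fun _ : l =>
      Metric.closedBall (0 : ℂ) R) :=
    isCompact_univ_pi fun _ => isCompact_univ_pi fun _ => isCompact_closedBall _ _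
  have e : {A : Matrix k l ℂ | ∀ i j, ‖A i j‖ ≤ R} = (Set.pi Set.univ fun _ : k =>
      Set.pi Set.univ fun _ : l => Metric.closedBall (0 : ℂ) R : Set (k → l → ℂ)) := by
    apply Set.ext
    intro A
    constructor
    · intro h i _ j _
      exact mem_closedBall_zero_iff.2 (h i j)
    · intro h i j
      exact mem_closedBall_zero_iff.1 (h i trivial j trivial)
  rw [e]
  exact hc

end Topological

section Coercive

variable {p q : ℕ}

lemma norm_det_expForm {n : ℕ} {U : Matrix (Fin n) (Fin n) ℂ} (hU : Uᴴ * U = 1) (s : Fin n → ℝ) :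
    ‖(expForm U s).det‖ = Real.exp (∑ i, s i) := by
  rw [expForm, det_mul, mul_comm, ← det_mul, ← Matrix.mul_assoc, hU, Matrix.one_mul, det_diagonal,
    norm_prod, Real.exp_sum]
  exact Finset.prod_congr rfl fun i _ => by
    rw [Complex.norm_real, Real.norm_eq_abs, abs_of_pos (Real.exp_pos _)]

lemma size_nonneg {n : ℕ} {P : Matrix (Fin n) (Fin n) ℂ} (hP : P.PosDef) : 0 ≤ size P := by
  obtain ⟨U, s, hU, rfl⟩ := PosDef.exists_expForm hP
  have := half_sum_abs_le_size hU s
  have := Finset.sum_nonneg fun i (_ : i ∈ Finset.univ) => abs_nonneg (s i)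
  linarith

/-- Forms with bounded size and bounded displacement stay in a bounded set. -/
lemma exists_coercive (p q : ℕ) (C : ℝ) : ∃ R : ℝ, ∀ (P : Matrix (Fin p) (Fin p) ℂ)
    (Y : Matrix (Fin p) (Fin q) ℂ) (Q : Matrix (Fin q) (Fin q) ℂ), P.PosDef → Q.PosDef →
    size P ≤ C → size Q ≤ C → (Q⁻¹ * (Yᴴ * P * Y)).trace.re ≤ C →
    (∀ i j, ‖hmat P Y Q i j‖ ≤ R) ∧ Real.exp (-(2 * C)) ≤ ‖P.det‖ ∧
      Real.exp (-(2 * C)) ≤ ‖Q.det‖ := by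
  set r : ℝ := Real.exp (2 * C) with hr
  have hr0 : 0 < r := Real.exp_pos _
  set r₁ : ℝ := p * (p * (1 * r) * 1) with hr₁
  set r₂ : ℝ := q * (q * (1 * r) * 1) with hr₂
  set w : ℝ := |C| * Real.exp (4 * C) + 1 with hw
  set y : ℝ := q * (p * (1 * w) * 1) with hy
  have hw0 : 0 ≤ w := by positivity
  have hy0 : 0 ≤ y := by positivity
  have h₁0 : 0 ≤ r₁ := by positivity
  have h₂0 : 0 ≤ r₂ := by positivity
  refine ⟨r₁ + p * (r₁ * y) + p * (y * r₁) + (p * ((p * (y * r₁)) * y) + r₂), ?_⟩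
  intro P Y Q hP hQ sP sQ hY
  have hC : 0 ≤ C := (size_nonneg hP).trans sP
  obtain ⟨U₁, s₁, hU₁, rfl⟩ := PosDef.exists_expForm hP
  obtain ⟨U₂, s₂, hU₂, rfl⟩ := PosDef.exists_expForm hQ
  have bU : ∀ {n : ℕ} {U : Matrix (Fin n) (Fin n) ℂ}, Uᴴ * U = 1 → ∀ i j, ‖U i j‖ ≤ 1 :=
    fun h => entry_norm_bound_of_unitary (mem_unitaryGroup_iff'.2 h)
  have bs : ∀ {n : ℕ} {U : Matrix (Fin n) (Fin n) ℂ} {s : Fin n → ℝ}, Uᴴ * U = 1 →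
      size (expForm U s) ≤ C → ∑ i, |s i| ≤ 2 * C := by
    intro n U s h h'
    linarith [half_sum_abs_le_size h s]
  have bs' : ∀ {n : ℕ} {s : Fin n → ℝ}, ∑ i, |s i| ≤ 2 * C → ∀ i, |s i| ≤ 2 * C := fun h i =>
    (Finset.single_le_sum (fun i _ => abs_nonneg _) (Finset.mem_univ i)).trans h
  have bE : ∀ {n : ℕ} {U : Matrix (Fin n) (Fin n) ℂ} {s : Fin n → ℝ}, Uᴴ * U = 1 →
      (∀ i, |s i| ≤ 2 * C) → ∀ i j, ‖expForm U s i j‖ ≤ n * (n * (1 * r) * 1) := by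
    intro n U s hU hs
    have h1 : ∀ i j, ‖(diagonal fun i => (Real.exp (s i) : ℂ)) i j‖ ≤ r := by
      intro i j
      rw [diagonal_apply]
      split_ifs
      · rw [Complex.norm_real, Real.norm_eq_abs, abs_of_pos (Real.exp_pos _)]
        exact Real.exp_le_exp.2 ((le_abs_self _).trans (hs i))
      · rw [norm_zero]; exact hr0.le
    have h2 := norm_mul_apply_le zero_le_one (bU hU) h1
    rw [Fintype.card_fin] at h2
    have h3 := norm_mul_apply_le (B := Uᴴ) (b := 1) (by positivity) h2
      (fun i j => by rw [conjTranspose_apply, norm_star]; exact bU hU j i)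
    rwa [Fintype.card_fin] at h3
  have bD : ∀ {n : ℕ} {U : Matrix (Fin n) (Fin n) ℂ} {s : Fin n → ℝ}, Uᴴ * U = 1 →
      ∑ i, |s i| ≤ 2 * C → Real.exp (-(2 * C)) ≤ ‖(expForm U s).det‖ := by
    intro n U s hU hs
    rw [norm_det_expForm hU, Real.exp_le_exp, neg_le]
    refine le_trans ?_ hs
    rw [← Finset.sum_neg_distrib]
    exact Finset.sum_le_sum fun i _ => neg_le_abs _
  have t₁ := bs hU₁ sP
  have t₂ := bs hU₂ sQ
  have b₁ := bE hU₁ (bs' t₁)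
  have b₂ := bE hU₂ (bs' t₂)
  have bW : ∀ i j, ‖(U₁ᴴ * Y * U₂) i j‖ ≤ w := by
    intro i j
    have h1 := exp_mul_sq_le_trace U₁ U₂ Y s₁ s₂ i j
    rw [← expForm_inv hU₂] at h1
    have h2 : Real.exp (-(4 * C)) ≤ Real.exp (s₁ i - s₂ j) := by
      rw [Real.exp_le_exp]
      have := abs_le.1 (bs' t₁ i)
      have := abs_le.1 (bs' t₂ j)
      linarith
    set x := ‖(U₁ᴴ * Y * U₂) i j‖
    have h3 : Real.exp (-(4 * C)) * x ^ 2 ≤ C :=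
      (mul_le_mul_of_nonneg_right h2 (sq_nonneg _)).trans (h1.trans hY)
    have h4 : x ^ 2 ≤ |C| * Real.exp (4 * C) := by
      rw [abs_of_nonneg hC]
      rw [Real.exp_neg, inv_mul_le_iff₀ (Real.exp_pos _)] at h3
      linarith
    nlinarith [sq_nonneg (x - 1)]
  have bY : ∀ i j, ‖Y i j‖ ≤ y := by
    have e : Y = U₁ * (U₁ᴴ * Y * U₂) * U₂ᴴ := by
      calc Y = (U₁ * U₁ᴴ) * Y * (U₂ * U₂ᴴ) := by
            rw [mul_eq_one_comm.1 hU₁, mul_eq_one_comm.1 hU₂]; simp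
        _ = _ := by simp only [Matrix.mul_assoc]
    rw [e]
    have h2 := norm_mul_apply_le zero_le_one (bU hU₁) bW
    rw [Fintype.card_fin] at h2
    have h3 := norm_mul_apply_le (B := U₂ᴴ) (b := 1) (by positivity) h2
      (fun i j => by rw [conjTranspose_apply, norm_star]; exact bU hU₂ j i)
    rwa [Fintype.card_fin] at h3
  refine ⟨?_, bD hU₁ t₁, bD hU₂ t₂⟩
  have b₃ := norm_mul_apply_le h₁0 b₁ bY
  have b₄ := norm_mul_apply_le (A := Yᴴ) hy0
    (fun i j => by rw [conjTranspose_apply, norm_star]; exact bY j i) b₁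
  rw [Fintype.card_fin] at b₃ b₄
  have b₅ := norm_mul_apply_le (by positivity) b₄ bY
  rw [Fintype.card_fin] at b₅
  have z₁ : 0 ≤ (p : ℝ) * (r₁ * y) := by positivity
  have z₂ : 0 ≤ (p : ℝ) * (y * r₁) := by positivity
  have z₃ : 0 ≤ (p : ℝ) * ((p * (y * r₁)) * y) := by positivity
  rintro (i | i) (j | j)
  · simp only [hmat, fromBlocks_apply₁₁]
    linarith [b₁ i j]
  · simp only [hmat, fromBlocks_apply₁₂, Matrix.neg_apply, norm_neg]
    linarith [b₃ i j]
  · simp only [hmat, fromBlocks_apply₂₁, Matrix.neg_apply, norm_neg]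
    linarith [b₄ i j]
  · simp only [hmat, fromBlocks_apply₂₂, Matrix.sub_apply]
    have := norm_sub_le ((Yᴴ * expForm U₁ s₁ * Y) i j) (expForm U₂ s₂ i j)
    linarith [b₅ i j, b₂ i j]

end Coercive

section Minimizer

variable {p q : ℕ}

/-- The potential whose critical points are regularized solutions of the spectral problem. -/
def pot (D : Config p q) (a₁ b₁ c₁ : Fin p → ℝ) (a₂ b₂ c₂ : Fin q → ℝ) (ε : ℝ) (H : Frm p q) : ℝ :=
  bell a₂ a₁ ((frame D.fA D.gA D.X)ᴴ * H * frame D.fA D.gA D.X) +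
    bell b₂ b₁ ((frame D.fB D.gB 0)ᴴ * H * frame D.fB D.gB 0) + stdPot c₁ c₂ ε H

lemma ld_conj_sub {n : ℕ} {g Q N : Matrix (Fin n) (Fin n) ℂ} (hg : g.det ≠ 0) (hQ : Q.PosDef)
    (hN : N.PosDef) :
    ld (gᴴ * Q * g) - ld (gᴴ * N * g) = Real.log ‖Q.det‖ - Real.log ‖N.det‖ := by
  have h1 : ‖g.det‖ ≠ 0 := norm_ne_zero_iff.2 hg
  have h2 : ‖Q.det‖ ≠ 0 := norm_ne_zero_iff.2 hQ.det_pos.ne'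
  have h3 : ‖N.det‖ ≠ 0 := norm_ne_zero_iff.2 hN.det_pos.ne'
  have h4 : ∀ M : Matrix (Fin n) (Fin n) ℂ, ‖M.det‖ ≠ 0 →
      ld (gᴴ * M * g) = Real.log ‖g.det‖ + Real.log ‖M.det‖ + Real.log ‖g.det‖ := by
    intro M hM
    rw [ld_eq_log_det, det_mul, det_mul, det_conjTranspose, norm_mul, norm_mul, norm_star,
      Real.log_mul (mul_ne_zero h1 hM) h1, Real.log_mul h1 hM]
  rw [h4 Q h2, h4 N h3]
  ring

lemma trace_mul_nonneg {m : Type*} [Fintype m] [DecidableEq m] {A B : Matrix m m ℂ}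
    (hA : A.PosDef) (hB : B.PosSemidef) : 0 ≤ (A * B).trace.re := by
  obtain ⟨C, -, rfl⟩ := PosDef.exists_isUnit_factor hA
  rw [Matrix.mul_assoc, trace_mul_comm]
  have := (hB.mul_mul_conjTranspose_same C).trace_nonneg
  exact (Complex.le_def.1 this).1

lemma trace_displacement_le {P : Matrix (Fin p) (Fin p) ℂ} {Q : Matrix (Fin q) (Fin q) ℂ}
    (hP : P.PosDef) (hQ : Q.PosDef) (X Y : Matrix (Fin p) (Fin q) ℂ) :
    (Q⁻¹ * (Xᴴ * P * X)).trace.re ≤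
      2 * (Q⁻¹ * ((X - Y)ᴴ * P * (X - Y))).trace.re + 2 * (Q⁻¹ * (Yᴴ * P * Y)).trace.re := by
  set Z := X - Y with hZ
  have hX : X = Z + Y := by rw [hZ]; abel
  have h := trace_mul_nonneg hQ.inv (hP.posSemidef.conjTranspose_mul_mul_same (Z - Y))
  have e : (Q⁻¹ * (Xᴴ * P * X)) + Q⁻¹ * ((Z - Y)ᴴ * P * (Z - Y)) =
      Q⁻¹ * (Zᴴ * P * Z) + Q⁻¹ * (Zᴴ * P * Z) + (Q⁻¹ * (Yᴴ * P * Y) + Q⁻¹ * (Yᴴ * P * Y)) := by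
    rw [hX]
    simp only [conjTranspose_add, conjTranspose_sub, Matrix.mul_sub, Matrix.sub_mul, Matrix.mul_add,
      Matrix.add_mul]
    abel
  have e' := congrArg (fun M => (trace M).re) e
  simp only [trace_add, Complex.add_re] at e'
  linarith

/-- The data of a numerically semistable configuration used to solve the regularized problem. -/
structure Config.Stable (D : Config p q) (a₁ b₁ c₁ : Fin p → ℝ) (a₂ b₂ c₂ : Fin q → ℝ)
    (c ε : ℝ) : Prop where
  inv : D.Invertible
  num : D.Numeric a₁ b₁ c₁ a₂ b₂ c₂
  ha₁ : Antitone a₁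
  hb₁ : Antitone b₁
  hc₁ : Antitone c₁
  ha₂ : Antitone a₂
  hb₂ : Antitone b₂
  hc₂ : Antitone c₂
  pa : ∀ i, 0 ≤ a₁ i
  pb : ∀ i, 0 ≤ b₁ i
  na : ∀ i, a₂ i ≤ -c
  nb : ∀ i, b₂ i ≤ -c
  sum : ∑ i, (a₁ i + b₁ i + c₁ i) + ∑ j, (a₂ j + b₂ j + c₂ j) = 0
  hc : 0 < c
  hε : 0 < ε

/-- The domain of the potential. -/
def Config.Dom (D : Config p q) (H : Frm p q) : Prop :=
  H.IsHermitian ∧ H.toBlocks₁₁.PosDef ∧ (cmp H D.X).PosDef ∧ (cmp H 0).PosDef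

variable {D : Config p q} {a₁ b₁ c₁ : Fin p → ℝ} {a₂ b₂ c₂ : Fin q → ℝ} {c ε : ℝ}

lemma Config.Stable.exists_lower (h : D.Stable a₁ b₁ c₁ a₂ b₂ c₂ c ε) :
    ∃ K : ℝ, ∀ P Y Q, P.PosDef → (cmp (hmat P Y Q) D.X).PosDef → (cmp (hmat P Y Q) 0).PosDef →
      Q.PosDef ∧ 0 ≤ Real.log ‖Q.det‖ - Real.log ‖(cmp (hmat P Y Q) D.X).det‖ ∧
      (Q⁻¹ * (Yᴴ * P * Y)).trace.re ≤ Real.log ‖Q.det‖ - Real.log ‖(cmp (hmat P Y Q) 0).det‖ ∧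
      ε / 2 * (size P + size Q) + c / 2 *
        ((Real.log ‖Q.det‖ - Real.log ‖(cmp (hmat P Y Q) D.X).det‖) +
          (Real.log ‖Q.det‖ - Real.log ‖(cmp (hmat P Y Q) 0).det‖)) - K ≤
        pot D a₁ b₁ c₁ a₂ b₂ c₂ ε (hmat P Y Q) := by
  obtain ⟨K, hK⟩ := h.num.exists_bound h.inv h.ha₁ h.hb₁ h.hc₁ h.ha₂ h.hb₂ h.hc₂ h.sum
    (half_pos h.hε) (show 0 < c / 4 by linarith [h.hc])
  refine ⟨K, fun P Y Q hP hA hB => ?_⟩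
  obtain ⟨hQ, tA, lA, -⟩ := bell_frame h.pa h.na h.inv.fA.isUnit h.inv.gA.isUnit D.X rfl hP hA
  obtain ⟨-, tB, lB, -⟩ := bell_frame h.pb h.nb h.inv.fB.isUnit h.inv.gB.isUnit 0 rfl hP hB
  have lC := (stdPot_props c₁ c₂ ε rfl hP hQ (Y := Y)).1
  rw [ld_conj_sub h.inv.gA hQ hA] at tA lA
  rw [ld_conj_sub h.inv.gB hQ hB] at tB lB
  have e : (0 - Y)ᴴ * P * (0 - Y) = Yᴴ * P * Y := by
    rw [zero_sub, conjTranspose_neg, Matrix.neg_mul, Matrix.mul_neg, Matrix.neg_mul, neg_neg]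
  rw [e] at tB
  have tX := trace_displacement_le hP hQ D.X Y
  have t0 := trace_mul_nonneg hQ.inv (hP.posSemidef.conjTranspose_mul_mul_same (D.X - Y))
  have t1 := trace_mul_nonneg hQ.inv (hP.posSemidef.conjTranspose_mul_mul_same Y)
  refine ⟨hQ, t0.trans tA, tB, ?_⟩
  have k := hK P Q hP hQ
  rw [blk, blk] at k
  rw [pot, lC]
  have hc := h.hc
  nlinarith [mul_le_mul_of_nonneg_left tX hc.le, mul_le_mul_of_nonneg_left tA hc.le,
    mul_le_mul_of_nonneg_left tB hc.le]

lemma Config.Stable.continuousAt (h : D.Stable a₁ b₁ c₁ a₂ b₂ c₂ c ε) {H : Frm p q}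
    (hH : D.Dom H) : ContinuousAt (pot D a₁ b₁ c₁ a₂ b₂ c₂ ε) H := by
  obtain ⟨h0, hP, hA, hB⟩ := hH
  obtain ⟨Y, Q, e⟩ := exists_eq_hmat h0 hP
  obtain ⟨hQ, -, -, cA, -⟩ :=
    bell_frame h.pa h.na h.inv.fA.isUnit h.inv.gA.isUnit D.X e hP hA
  obtain ⟨-, -, -, cB, -⟩ := bell_frame h.pb h.nb h.inv.fB.isUnit h.inv.gB.isUnit 0 e hP hB
  exact (cA.add cB).add (stdPot_props c₁ c₂ ε e hP hQ).2.1

lemma continuous_cmp (X : Matrix (Fin p) (Fin q) ℂ) : Continuous fun H : Frm p q => cmp H X := by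
  have h₁₁ : Continuous fun H : Frm p q => H.toBlocks₁₁ := continuous_id.matrix_submatrix _ _
  have h₁₂ : Continuous fun H : Frm p q => H.toBlocks₁₂ := continuous_id.matrix_submatrix _ _
  have h₂₁ : Continuous fun H : Frm p q => H.toBlocks₂₁ := continuous_id.matrix_submatrix _ _
  have h₂₂ : Continuous fun H : Frm p q => H.toBlocks₂₂ := continuous_id.matrix_submatrix _ _
  exact ((((continuous_const.matrix_mul h₁₁).matrix_mul continuous_const).add
    (continuous_const.matrix_mul h₁₂)).add (h₂₁.matrix_mul continuous_const)).add h₂₂ |>.neg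

lemma posDef_of_le_norm_det {m : Type*} [Fintype m] [DecidableEq m] {A : Matrix m m ℂ} {δ : ℝ}
    (hδ : 0 < δ) (hA : A.PosSemidef) (h : δ ≤ ‖A.det‖) : A.PosDef :=
  hA.posDef_iff_det_ne_zero.2 (norm_pos_iff.1 (hδ.trans_le h))

lemma dom_base (D : Config p q) : D.Dom (hmat 1 0 (1 + D.Xᴴ * D.X)) := by
  have h : ((1 : Matrix (Fin q) (Fin q) ℂ) + D.Xᴴ * D.X).PosDef :=
    PosDef.one.add_posSemidef (posSemidef_conjTranspose_mul_self _)
  refine ⟨?_, ?_, ?_, ?_⟩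
  · rw [hmat, IsHermitian, fromBlocks_conjTranspose]
    simp
  · rw [hmat, toBlocks_fromBlocks₁₁]; exact PosDef.one
  · rw [cmp_hmat]
    simpa using PosDef.one
  · rw [cmp_hmat]
    simpa using h

/-- The domain bounded away from its boundary. -/
def Config.core (D : Config p q) (R δ : ℝ) : Set (Frm p q) :=
  {H | ∀ i j, ‖H i j‖ ≤ R} ∩ ({H | Hᴴ = H} ∩ {H | H.toBlocks₁₁ ∈ {A | A.PosSemidef}} ∩
    {H | cmp H D.X ∈ {A | A.PosSemidef}} ∩ {H | cmp H 0 ∈ {A | A.PosSemidef}} ∩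
    {H | δ ≤ ‖H.toBlocks₁₁.det‖} ∩ {H | δ ≤ ‖(cmp H D.X).det‖} ∩ {H | δ ≤ ‖(cmp H 0).det‖})

lemma Config.isCompact_core (D : Config p q) (R δ : ℝ) : IsCompact (D.core R δ) := by
  refine (isCompact_entries_le R).inter_right ?_
  have h₁₁ : Continuous fun H : Frm p q => H.toBlocks₁₁ := continuous_id.matrix_submatrix _ _
  refine IsClosed.inter (IsClosed.inter (IsClosed.inter (IsClosed.inter (IsClosed.inter
    (IsClosed.inter ?_ ?_) ?_) ?_) ?_) ?_) ?_
  · exact isClosed_eq continuous_id.matrix_conjTranspose continuous_id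
  · exact isClosed_posSemidef.preimage h₁₁
  · exact isClosed_posSemidef.preimage (continuous_cmp _)
  · exact isClosed_posSemidef.preimage (continuous_cmp _)
  · exact isClosed_le continuous_const h₁₁.matrix_det.norm
  · exact isClosed_le continuous_const (continuous_cmp _).matrix_det.norm
  · exact isClosed_le continuous_const (continuous_cmp _).matrix_det.norm

lemma Config.dom_of_mem_core {R δ : ℝ} (hδ : 0 < δ) {H : Frm p q} (hH : H ∈ D.core R δ) :
    D.Dom H := by
  obtain ⟨-, ⟨⟨⟨⟨⟨s1, s2⟩, s3⟩, s4⟩, s5⟩, s6⟩, s7⟩ := hH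
  exact ⟨s1, posDef_of_le_norm_det hδ s2 s5, posDef_of_le_norm_det hδ s3 s6,
    posDef_of_le_norm_det hδ s4 s7⟩

lemma Config.Stable.exists_sublevel_subset (h : D.Stable a₁ b₁ c₁ a₂ b₂ c₂ c ε) (L : ℝ) :
    ∃ R δ : ℝ, 0 < δ ∧
      ∀ H, D.Dom H → pot D a₁ b₁ c₁ a₂ b₂ c₂ ε H ≤ L → H ∈ D.core R δ := by
  obtain ⟨K, hK⟩ := h.exists_lower
  have hε := h.hε
  have hc := h.hc
  set M := |L + K| with hM
  set C := 2 * M / ε + 2 * M / c with hC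
  have hM0 : 0 ≤ M := abs_nonneg _
  have hC1 : 2 * M / ε ≤ C := le_add_of_nonneg_right (by positivity)
  have hC2 : 2 * M / c ≤ C := le_add_of_nonneg_left (by positivity)
  obtain ⟨R, hR⟩ := exists_coercive p q C
  have hC0 : 0 ≤ C := by positivity
  refine ⟨R, Real.exp (-(3 * C)), Real.exp_pos _, ?_⟩
  rintro H ⟨d1, d2, d3, d4⟩ hle
  obtain ⟨Y, Q, e⟩ := exists_eq_hmat d1 d2
  generalize hP : H.toBlocks₁₁ = P at *
  have d3' := d3
  have d4' := d4
  rw [e] at d3' d4'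
  obtain ⟨hQ, l1, l2, l3⟩ := hK P Y Q d2 d3' d4'
  rw [← e] at l1 l2 l3
  have t1 := trace_mul_nonneg hQ.inv (d2.posSemidef.conjTranspose_mul_mul_same Y)
  have s1 := size_nonneg d2
  have s2 := size_nonneg hQ
  have hLM := le_abs_self (L + K)
  rw [← hM] at hLM
  obtain ⟨u, hu⟩ : ∃ u, u = Real.log ‖Q.det‖ - Real.log ‖(cmp H D.X).det‖ := ⟨_, rfl⟩
  obtain ⟨v, hv⟩ : ∃ v, v = Real.log ‖Q.det‖ - Real.log ‖(cmp H 0).det‖ := ⟨_, rfl⟩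
  rw [← hu] at l1 l3
  rw [← hv] at l2 l3
  have hv0 : 0 ≤ v := t1.trans l2
  have m1 : 0 ≤ c / 2 * (u + v) := by positivity
  have m2 : 0 ≤ ε / 2 * (size P + size Q) := by positivity
  have k1 : size P + size Q ≤ C := by
    refine le_trans ?_ hC1
    rw [le_div_iff₀ hε]; linarith
  have k2 : u + v ≤ C := by
    refine le_trans ?_ hC2
    rw [le_div_iff₀ hc]; linarith
  obtain ⟨r1, r2, r3⟩ := hR P Y Q d2 hQ (by linarith) (by linarith) (by linarith)
  rw [← e] at r1
  have hδle : Real.exp (-(3 * C)) ≤ Real.exp (-(2 * C)) := Real.exp_le_exp.2 (by linarith)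
  have hlog : -(2 * C) ≤ Real.log ‖Q.det‖ :=
    (Real.le_log_iff_exp_le (norm_pos_iff.2 hQ.det_pos.ne')).2 r3
  have r2' : Real.exp (-(3 * C)) ≤ ‖H.toBlocks₁₁.det‖ := by rw [hP]; exact hδle.trans r2
  refine ⟨r1, ⟨⟨⟨⟨⟨d1, ?_⟩, d3.posSemidef⟩, d4.posSemidef⟩, r2'⟩, ?_⟩, ?_⟩
  · rw [← hP] at d2
    exact d2.posSemidef
  · exact (Real.le_log_iff_exp_le (norm_pos_iff.2 d3.det_pos.ne')).1 (by linarith)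
  · exact (Real.le_log_iff_exp_le (norm_pos_iff.2 d4.det_pos.ne')).1 (by linarith)

/-- The potential attains its minimum. -/
lemma Config.Stable.exists_min (h : D.Stable a₁ b₁ c₁ a₂ b₂ c₂ c ε) :
    ∃ H, D.Dom H ∧ ∀ H', D.Dom H' →
      pot D a₁ b₁ c₁ a₂ b₂ c₂ ε H ≤ pot D a₁ b₁ c₁ a₂ b₂ c₂ ε H' := by
  have hdom₀ := dom_base D
  generalize hmat 1 0 (1 + D.Xᴴ * D.X) = H₀ at hdom₀
  obtain ⟨R, δ, hδ, hsub⟩ := h.exists_sublevel_subset (pot D a₁ b₁ c₁ a₂ b₂ c₂ ε H₀)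
  obtain ⟨H, hH, hmin⟩ := (D.isCompact_core R δ).exists_isMinOn ⟨H₀, hsub H₀ hdom₀ le_rfl⟩
    (f := pot D a₁ b₁ c₁ a₂ b₂ c₂ ε)
    (fun H hH => (h.continuousAt (D.dom_of_mem_core hδ hH)).continuousWithinAt)
  refine ⟨H, D.dom_of_mem_core hδ hH, fun H' hH' => ?_⟩
  by_cases hle : pot D a₁ b₁ c₁ a₂ b₂ c₂ ε H' ≤ pot D a₁ b₁ c₁ a₂ b₂ c₂ ε H₀
  · exact hmin (hsub H' hH' hle)
  · exact (hmin (hsub H₀ hdom₀ le_rfl)).trans (not_le.1 hle).le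

lemma cmp_add_smul (H S : Frm p q) (X : Matrix (Fin p) (Fin q) ℂ) (t : ℂ) :
    cmp (H + t • S) X = cmp H X + t • cmp S X := by
  have e₁₁ : (H + t • S).toBlocks₁₁ = H.toBlocks₁₁ + t • S.toBlocks₁₁ := rfl
  have e₁₂ : (H + t • S).toBlocks₁₂ = H.toBlocks₁₂ + t • S.toBlocks₁₂ := rfl
  have e₂₁ : (H + t • S).toBlocks₂₁ = H.toBlocks₂₁ + t • S.toBlocks₂₁ := rfl
  have e₂₂ : (H + t • S).toBlocks₂₂ = H.toBlocks₂₂ + t • S.toBlocks₂₂ := rfl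
  rw [cmp, e₁₁, e₁₂, e₂₁, e₂₂, cmp, cmp]
  simp only [Matrix.mul_add, Matrix.add_mul, Matrix.mul_smul, Matrix.smul_mul, smul_neg, smul_add]
  abel

lemma cmp_isHermitian {S : Frm p q} (hS : S.IsHermitian) (X : Matrix (Fin p) (Fin q) ℂ) :
    (cmp S X).IsHermitian := by
  have h := isHermitian_conjTranspose_mul_mul (frame 1 1 X) hS
  rw [frame_conj] at h
  have h' := (isHermitian_fromBlocks_iff.1 h).1
  simpa using h'.neg

lemma Config.Dom.eventually {H S : Frm p q} (hH : D.Dom H) (hS : S.IsHermitian) :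
    ∀ᶠ t : ℝ in 𝓝 0, D.Dom (H + (t : ℂ) • S) := by
  obtain ⟨d1, d2, d3, d4⟩ := hH
  have hS₁₁ : S.toBlocks₁₁.IsHermitian := by
    have := hS
    rw [← fromBlocks_toBlocks S] at this
    exact (isHermitian_fromBlocks_iff.1 this).1
  filter_upwards [PosDef.eventually_add_smul d2 hS₁₁,
    PosDef.eventually_add_smul d3 (cmp_isHermitian hS D.X),
    PosDef.eventually_add_smul d4 (cmp_isHermitian hS 0)] with t h1 h2 h3
  refine ⟨?_, h1, ?_, ?_⟩
  · have h4 : ((t : ℂ) • S)ᴴ = (t : ℂ) • S := by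
      rw [conjTranspose_smul, hS.eq, RCLike.star_def, Complex.conj_ofReal]
    exact IsHermitian.add d1 h4
  · rw [cmp_add_smul H S D.X (t : ℂ)]
    exact h2
  · rw [cmp_add_smul H S 0 (t : ℂ)]
    exact h3

lemma add_conjTranspose_eq_zero_of_trace {m : Type*} [Fintype m] {G : Matrix m m ℂ}
    (hG : ∀ S : Matrix m m ℂ, S.IsHermitian → (G * S).trace.re = 0) : G + Gᴴ = 0 := by
  set S := G + Gᴴ with hS
  have hSh : S.IsHermitian := isHermitian_add_transpose_self G
  have h1 := hG S hSh
  have h2 : (Gᴴ * S).trace.re = 0 := by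
    rw [← h1, ← hSh.eq, ← conjTranspose_mul, trace_conjTranspose, hSh.eq, trace_mul_comm]
    simp
  have h3 : (S * Sᴴ).trace.re = 0 := by
    rw [hSh.eq]
    conv_lhs => rw [hS]
    rw [← hS, Matrix.add_mul, trace_add, Complex.add_re, h1, h2, add_zero]
  rw [← trace_mul_conjTranspose_self_eq_zero_iff]
  refine Complex.ext h3 ?_
  exact ((Complex.le_def.1 (posSemidef_self_mul_conjTranspose S).trace_nonneg).2).symm

lemma dJ_isHermitian (w₁ : Fin p → ℝ) (w₂ : Fin q → ℝ) : (dJ w₁ w₂)ᴴ = dJ w₁ w₂ := by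
  rw [dJ, fromBlocks_conjTranspose, diagonal_conjTranspose, diagonal_conjTranspose]
  congr 1
  · congr 1; funext i; simp
  · simp
  · simp
  · congr 1; funext i; simp

/-- Numerically semistable configurations yield solutions of the regularized problem. -/
theorem Config.Stable.exists_regularized (h : D.Stable a₁ b₁ c₁ a₂ b₂ c₂ c ε) :
    ∃ kA kB ρ : Frm p q, kAᴴ * sgn (Fin p) (Fin q) * kA = sgn (Fin p) (Fin q) ∧
      kBᴴ * sgn (Fin p) (Fin q) * kB = sgn (Fin p) (Fin q) ∧ (∀ i j, ‖ρ i j‖ ≤ 2) ∧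
      kA * dJ a₁ a₂ * kAᴴ + kB * dJ b₁ b₂ * kBᴴ + dJ c₁ c₂ + (ε : ℂ) • ρ = 0 := by
  obtain ⟨H, hH, hmin⟩ := h.exists_min
  obtain ⟨h0, hP, hA, hB⟩ := id hH
  obtain ⟨Y, Q, e⟩ := exists_eq_hmat h0 hP
  obtain ⟨hQ, -, -, -, kA, hkA, dA⟩ :=
    bell_frame h.pa h.na h.inv.fA.isUnit h.inv.gA.isUnit D.X e hP hA
  obtain ⟨-, -, -, -, kB, hkB, dB⟩ :=
    bell_frame h.pb h.nb h.inv.fB.isUnit h.inv.gB.isUnit 0 e hP hB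
  obtain ⟨-, -, B, ρ, hBu, hHB, hρ, dC⟩ := stdPot_props c₁ c₂ ε e hP hQ
  set G := kA * dJ a₁ a₂ * kAᴴ + kB * dJ b₁ b₂ * kBᴴ + B⁻¹ * (dJ c₁ c₂ + (ε : ℂ) • ρ) * (B⁻¹)ᴴ
    with hG
  have hstat : ∀ S : Frm p q, S.IsHermitian → (G * S).trace.re = 0 := by
    intro S hS
    have hd := ((dA S).add (dB S)).add (dC S)
    have hloc : IsLocalMin (fun t : ℝ => pot D a₁ b₁ c₁ a₂ b₂ c₂ ε (H + (t : ℂ) • S)) 0 := by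
      filter_upwards [hH.eventually hS] with t ht
      simpa using hmin _ ht
    have := hloc.hasDerivAt_eq_zero hd
    rw [hG, Matrix.add_mul, Matrix.add_mul, trace_add, trace_add, Complex.add_re, Complex.add_re]
    exact this
  have hG0 := add_conjTranspose_eq_zero_of_trace hstat
  have hBB : B * B⁻¹ = 1 := mul_nonsing_inv _ hBu
  have hBB' : (B⁻¹)ᴴ * Bᴴ = 1 := by rw [← conjTranspose_mul, hBB, conjTranspose_one]
  have hiso : ∀ k : Frm p q, kᴴ * H * k = sgn (Fin p) (Fin q) →
      (B * k)ᴴ * sgn (Fin p) (Fin q) * (B * k) = sgn (Fin p) (Fin q) := by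
    intro k hk
    calc _ = kᴴ * (Bᴴ * sgn (Fin p) (Fin q) * B) * k := by
          simp only [conjTranspose_mul, Matrix.mul_assoc]
      _ = _ := by rw [← hHB, hk]
  refine ⟨B * kA, B * kB, (2⁻¹ : ℂ) • (ρ + ρᴴ), hiso _ hkA, hiso _ hkB, ?_, ?_⟩
  · intro i j
    have h1 := hρ i j
    have h2 := hρ j i
    have h3 := norm_add_le (ρ i j) (star (ρ j i))
    rw [norm_star] at h3
    rw [Matrix.smul_apply, Matrix.add_apply, conjTranspose_apply, smul_eq_mul, norm_mul]
    norm_num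
    simp only [RCLike.star_def] at h3
    linarith
  · have hT : B * (G + Gᴴ) * Bᴴ = 0 := by rw [hG0]; simp
    have hGc : Gᴴ = kA * dJ a₁ a₂ * kAᴴ + kB * dJ b₁ b₂ * kBᴴ +
        B⁻¹ * (dJ c₁ c₂ + (ε : ℂ) • ρᴴ) * (B⁻¹)ᴴ := by
      rw [hG]
      simp only [conjTranspose_add, conjTranspose_mul, conjTranspose_conjTranspose, dJ_isHermitian,
        conjTranspose_smul, Matrix.mul_assoc]
      simp
    have hc2 : ∀ W : Frm p q, B * (B⁻¹ * W * (B⁻¹)ᴴ) * Bᴴ = W := by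
      intro W
      calc _ = (B * B⁻¹) * W * ((B⁻¹)ᴴ * Bᴴ) := by simp only [Matrix.mul_assoc]
        _ = W := by rw [hBB, hBB', Matrix.one_mul, Matrix.mul_one]
    have hc1 : ∀ (k W : Frm p q), B * (k * W * kᴴ) * Bᴴ = (B * k) * W * (B * k)ᴴ := by
      intro k W
      rw [conjTranspose_mul]
      simp only [Matrix.mul_assoc]
    have hr : ∀ r : Frm p q, B * (kA * dJ a₁ a₂ * kAᴴ + kB * dJ b₁ b₂ * kBᴴ +
        B⁻¹ * (dJ c₁ c₂ + (ε : ℂ) • r) * (B⁻¹)ᴴ) * Bᴴ = (B * kA) * dJ a₁ a₂ * (B * kA)ᴴ +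
          (B * kB) * dJ b₁ b₂ * (B * kB)ᴴ + (dJ c₁ c₂ + (ε : ℂ) • r) := by
      intro r
      rw [Matrix.mul_add, Matrix.mul_add, Matrix.add_mul, Matrix.add_mul, hc1, hc1, hc2]
    rw [Matrix.mul_add, Matrix.add_mul, hGc, hG, hr, hr] at hT
    have hT' := congrArg (fun M => (2⁻¹ : ℂ) • M) hT
    simp only [smul_zero] at hT'
    rw [← hT']
    module

end Minimizer

section Limit

variable {p q : ℕ}

lemma dJ_eq_diagonal (w₁ : Fin p → ℝ) (w₂ : Fin q → ℝ) :
    dJ w₁ w₂ = diagonal fun x => ((Sum.elim w₁ (fun i => -w₂ i) x : ℝ) : ℂ) := by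
  rw [dJ, fromBlocks_diagonal]
  congr 1
  funext x
  rcases x with x | x <;> simp

lemma mul_sq_le_trace_conj {m : Type*} [Fintype m] [DecidableEq m] {d : m → ℝ} {c : ℝ}
    (hc : 0 < c) (hd : ∀ i, c ≤ d i) (k : Matrix m m ℂ) :
    0 ≤ (k * diagonal (fun i => (d i : ℂ)) * kᴴ).trace.re ∧
      ∀ i j, c * ‖k i j‖ ^ 2 ≤ (k * diagonal (fun i => (d i : ℂ)) * kᴴ).trace.re := by
  have e : (k * diagonal (fun i => (d i : ℂ)) * kᴴ).trace.re = ∑ i, ∑ j, d j * ‖k i j‖ ^ 2 := by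
    rw [trace, Complex.re_sum]
    refine Finset.sum_congr rfl fun i _ => ?_
    rw [diag_apply, Matrix.mul_apply, Complex.re_sum]
    refine Finset.sum_congr rfl fun j _ => ?_
    rw [mul_diagonal, conjTranspose_apply, mul_right_comm, RCLike.star_def, Complex.mul_conj,
      Complex.normSq_eq_norm_sq, ← Complex.ofReal_mul, Complex.ofReal_re, mul_comm]
  have h0 : ∀ i j, 0 ≤ d j * ‖k i j‖ ^ 2 := fun i j =>
    mul_nonneg (hc.le.trans (hd j)) (sq_nonneg _)
  rw [e]
  refine ⟨Finset.sum_nonneg fun i _ => Finset.sum_nonneg fun j _ => h0 i j, fun i j => ?_⟩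
  calc c * ‖k i j‖ ^ 2 ≤ d j * ‖k i j‖ ^ 2 := mul_le_mul_of_nonneg_right (hd j) (sq_nonneg _)
    _ ≤ ∑ j, d j * ‖k i j‖ ^ 2 :=
        Finset.single_le_sum (f := fun j => d j * ‖k i j‖ ^ 2) (fun j _ => h0 i j)
          (Finset.mem_univ j)
    _ ≤ _ := Finset.single_le_sum (f := fun i => ∑ j, d j * ‖k i j‖ ^ 2)
        (fun i _ => Finset.sum_nonneg fun j _ => h0 i j) (Finset.mem_univ i)

variable {a₁ b₁ c₁ : Fin p → ℝ} {a₂ b₂ c₂ : Fin q → ℝ}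

/-- Solutions of the regularized problems accumulate at solutions. -/
theorem sol_of_regularized {c : ℝ} (hc : 0 < c) (pa : ∀ i, c ≤ a₁ i) (pb : ∀ i, c ≤ b₁ i)
    (na : ∀ i, a₂ i ≤ -c) (nb : ∀ i, b₂ i ≤ -c)
    (h : ∀ ε : ℝ, 0 < ε → ∃ kA kB ρ : Frm p q,
      kAᴴ * sgn (Fin p) (Fin q) * kA = sgn (Fin p) (Fin q) ∧
      kBᴴ * sgn (Fin p) (Fin q) * kB = sgn (Fin p) (Fin q) ∧ (∀ i j, ‖ρ i j‖ ≤ 2) ∧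
      kA * dJ a₁ a₂ * kAᴴ + kB * dJ b₁ b₂ * kBᴴ + dJ c₁ c₂ + (ε : ℂ) • ρ = 0) :
    Sol a₁ b₁ c₁ a₂ b₂ c₂ := by
  set n := Fintype.card (Fin p ⊕ Fin q) with hn
  set E : Frm p q × Frm p q → Frm p q := fun k =>
    k.1 * dJ a₁ a₂ * k.1ᴴ + k.2 * dJ b₁ b₂ * k.2ᴴ + dJ c₁ c₂ with hE
  have hEc : Continuous E :=
    (((continuous_fst.matrix_mul continuous_const).matrix_mul
      continuous_fst.matrix_conjTranspose).add ((continuous_snd.matrix_mul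
        continuous_const).matrix_mul continuous_snd.matrix_conjTranspose)).add continuous_const
  set F : Frm p q × Frm p q → ℝ := fun k => ∑ i, ∑ j, ‖E k i j‖ with hF
  have hFc : Continuous F := by
    refine continuous_finsetSum _ fun i _ => continuous_finsetSum _ fun j _ => ?_
    exact (hEc.matrix_elem i j).norm
  set T : ℝ := ‖(dJ c₁ c₂).trace‖ + n * 2 with hT
  set R : ℝ := T / c + 1 with hR
  set S : Set (Frm p q) := {k | ∀ i j, ‖k i j‖ ≤ R} ∩
    {k | kᴴ * sgn (Fin p) (Fin q) * k = sgn (Fin p) (Fin q)} with hS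
  have hScomp : IsCompact S := (isCompact_entries_le R).inter_right
    (isClosed_eq ((continuous_id.matrix_conjTranspose.matrix_mul continuous_const).matrix_mul
      continuous_id) continuous_const)
  have hsmall : ∀ ε : ℝ, 0 < ε → ε ≤ 1 → ∃ k ∈ S ×ˢ S, F k ≤ ε * (n * (n * 2)) := by
    intro ε hε hε1
    obtain ⟨kA, kB, ρ, hA, hB, hρ, he⟩ := h ε hε
    obtain ⟨tA, sA⟩ := mul_sq_le_trace_conj hc (d := Sum.elim a₁ fun i => -a₂ i)
      (by rintro (i | i); exacts [pa i, by simpa using le_neg.1 (na i)]) kA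
    obtain ⟨tB, sB⟩ := mul_sq_le_trace_conj hc (d := Sum.elim b₁ fun i => -b₂ i)
      (by rintro (i | i); exacts [pb i, by simpa using le_neg.1 (nb i)]) kB
    rw [← dJ_eq_diagonal] at tA tB
    simp only [← dJ_eq_diagonal] at sA sB
    have htr := congrArg (fun M => (trace M).re) he
    simp only [trace_add, trace_smul, Complex.add_re, trace_zero, Complex.zero_re] at htr
    have h1 : -‖(dJ c₁ c₂).trace‖ ≤ (dJ c₁ c₂).trace.re :=
      (abs_le.1 (Complex.abs_re_le_norm _)).1
    have h2 : ‖ρ.trace‖ ≤ n * 2 := by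
      rw [trace]
      refine (norm_sum_le _ _).trans ?_
      calc _ ≤ ∑ _i : Fin p ⊕ Fin q, (2 : ℝ) := Finset.sum_le_sum fun i _ => hρ i i
        _ = _ := by rw [Finset.sum_const, nsmul_eq_mul, Finset.card_univ]
    have h3 : -(n * 2 : ℝ) ≤ ((ε : ℂ) • ρ.trace).re := by
      refine (neg_le_neg ?_).trans (abs_le.1 (Complex.abs_re_le_norm _)).1
      rw [norm_smul, Complex.norm_real, Real.norm_eq_abs, abs_of_pos hε]
      calc ε * ‖ρ.trace‖ ≤ 1 * ‖ρ.trace‖ := mul_le_mul_of_nonneg_right hε1 (norm_nonneg _)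
        _ ≤ _ := by rwa [one_mul]
    have hle : ∀ x : ℝ, c * x ^ 2 ≤ T → x ≤ R := by
      intro x hx
      have : x ^ 2 ≤ T / c := by rw [le_div_iff₀ hc]; linarith
      nlinarith [sq_nonneg (x - 1)]
    refine ⟨(kA, kB), ⟨⟨fun i j => hle _ ((sA i j).trans ?_), hA⟩,
      ⟨fun i j => hle _ ((sB i j).trans ?_), hB⟩⟩, ?_⟩
    · linarith
    · linarith
    · have hE' : E (kA, kB) = -((ε : ℂ) • ρ) := eq_neg_of_add_eq_zero_left he
      rw [hF]
      simp only [hE']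
      calc _ ≤ ∑ _i : Fin p ⊕ Fin q, ∑ _j : Fin p ⊕ Fin q, ε * 2 :=
            Finset.sum_le_sum fun i _ => Finset.sum_le_sum fun j _ => by
              rw [Matrix.neg_apply, norm_neg, Matrix.smul_apply, norm_smul, Complex.norm_real,
                Real.norm_eq_abs, abs_of_pos hε]
              exact mul_le_mul_of_nonneg_left (hρ i j) hε.le
        _ = _ := by
              simp only [Finset.sum_const, nsmul_eq_mul, Finset.card_univ]
              rw [hn]; ring
  obtain ⟨k₀, hk₀, -⟩ := hsmall 1 one_pos le_rfl
  obtain ⟨k, hk, hmin⟩ := (hScomp.prod hScomp).exists_isMinOn ⟨k₀, hk₀⟩ hFc.continuousOn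
  have hF0 : F k ≤ 0 := by
    by_contra hpos
    rw [not_le] at hpos
    set δ := min 1 (F k / (n * (n * 2) + 1)) with hδ
    have hN : (0 : ℝ) < n * (n * 2) + 1 := by positivity
    have hδ0 : 0 < δ := lt_min one_pos (div_pos hpos hN)
    obtain ⟨k', hk', hle⟩ := hsmall δ hδ0 (min_le_left _ _)
    have h1 : F k ≤ F k' := hmin hk'
    have h2 : δ * (n * (n * 2) + 1) ≤ F k := by
      rw [← le_div_iff₀ hN]; exact min_le_right _ _
    linarith
  refine ⟨k.1, k.2, hk.1.2, hk.2.2, ?_⟩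
  change E k = 0
  ext i j
  have h1 : ‖E k i j‖ ≤ F k :=
    (Finset.single_le_sum (f := fun j => ‖E k i j‖) (fun j _ => norm_nonneg _)
      (Finset.mem_univ j)).trans (Finset.single_le_sum (f := fun i => ∑ j, ‖E k i j‖)
        (fun i _ => Finset.sum_nonneg fun j _ => norm_nonneg _) (Finset.mem_univ i))
  exact norm_le_zero_iff.1 (h1.trans hF0)

/-- In the definite range the solvable third spectra form a convex set. -/
theorem Sol.convex_combo {c₁' : Fin p → ℝ} {c₂' : Fin q → ℝ} {c : ℝ} (hc : 0 < c)
    (ha₁ : Antitone a₁) (hb₁ : Antitone b₁) (hc₁ : Antitone c₁) (hc₁' : Antitone c₁')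
    (ha₂ : Antitone a₂) (hb₂ : Antitone b₂) (hc₂ : Antitone c₂) (hc₂' : Antitone c₂')
    (pa : ∀ i, c ≤ a₁ i) (pb : ∀ i, c ≤ b₁ i) (na : ∀ i, a₂ i ≤ -c) (nb : ∀ i, b₂ i ≤ -c)
    (nc : ∀ i, c₁ i ≤ 0) (nc' : ∀ i, c₁' i ≤ 0) (pc : ∀ i, 0 ≤ c₂ i) (pc' : ∀ i, 0 ≤ c₂' i)
    (hsum : ∑ i, (a₁ i + b₁ i + c₁ i) + ∑ j, (a₂ j + b₂ j + c₂ j) = 0)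
    (hsum' : ∑ i, (a₁ i + b₁ i + c₁' i) + ∑ j, (a₂ j + b₂ j + c₂' j) = 0)
    (h : Sol a₁ b₁ c₁ a₂ b₂ c₂) (h' : Sol a₁ b₁ c₁' a₂ b₂ c₂') {s t : ℝ} (hs : 0 ≤ s) (ht : 0 ≤ t)
    (hst : s + t = 1) : Sol a₁ b₁ (s • c₁ + t • c₁') a₂ b₂ (s • c₂ + t • c₂') := by
  have pa' : ∀ i, 0 ≤ a₁ i := fun i => hc.le.trans (pa i)
  have pb' : ∀ i, 0 ≤ b₁ i := fun i => hc.le.trans (pb i)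
  have na' : ∀ i, a₂ i ≤ 0 := fun i => (na i).trans (by linarith)
  have nb' : ∀ i, b₂ i ≤ 0 := fun i => (nb i).trans (by linarith)
  obtain ⟨D, hD, hDn⟩ := h.exists_numeric ha₁ hb₁ hc₁ ha₂ hb₂ hc₂ pa' pb' nc na' nb' pc
  obtain ⟨D', hD', hDn'⟩ := h'.exists_numeric ha₁ hb₁ hc₁' ha₂ hb₂ hc₂' pa' pb' nc' na' nb' pc'
  obtain ⟨E, hE, hEn⟩ := exists_numeric_combo ha₁ hb₁ hc₁ hc₁' ha₂ hb₂ hc₂ hc₂' hD hD' hDn hDn'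
    hs ht hst
  refine sol_of_regularized hc pa pb na nb fun ε hε => ?_
  have hsum'' : ∑ i, (a₁ i + b₁ i + (s • c₁ + t • c₁') i) +
      ∑ j, (a₂ j + b₂ j + (s • c₂ + t • c₂') j) = 0 := by
    simp only [Finset.sum_add_distrib, Pi.add_apply, Pi.smul_apply, smul_eq_mul,
      ← Finset.mul_sum] at hsum hsum' ⊢
    have ht' : t = 1 - s := by linarith
    subst ht'
    linear_combination s * hsum + (1 - s) * hsum'
  exact (Config.Stable.mk hE hEn ha₁ hb₁ ((hc₁.const_smul hs).add (hc₁'.const_smul ht)) ha₂ hb₂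
    ((hc₂.const_smul hs).add (hc₂'.const_smul ht)) pa' pb' na nb hsum'' hc hε).exists_regularized

end Limit

section Spectral

variable {m : Type*} [Fintype m] [DecidableEq m]

lemma exists_perm_of_prod_eq {x y : m → ℂ}
    (h : ∏ i, (X - Polynomial.C (y i)) = ∏ i, (X - Polynomial.C (x i))) :
    ∃ σ : Equiv.Perm m, ∀ i, y (σ i) = x i := by
  classical
  have hr : Multiset.map y Finset.univ.val = Multiset.map x Finset.univ.val := by
    have := congrArg roots h
    rw [Finset.prod_eq_multiset_prod, Finset.prod_eq_multiset_prod] at this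
    have e : ∀ z : m → ℂ, Multiset.map (fun i => X - Polynomial.C (z i)) Finset.univ.val =
        Multiset.map (fun a => X - Polynomial.C a) (Multiset.map z Finset.univ.val) := by
      intro z
      rw [Multiset.map_map]
      rfl
    rwa [e, e, roots_multiset_prod_X_sub_C, roots_multiset_prod_X_sub_C] at this
  have hc : ∀ v, Nonempty ({i // x i = v} ≃ {i // y i = v}) := by
    intro v
    rw [← Fintype.card_eq, Fintype.card_subtype, Fintype.card_subtype]
    have := congrArg (Multiset.count v) hr
    rw [Multiset.count_map, Multiset.count_map] at this
    have e : ∀ z : m → ℂ, (Finset.univ.filter fun i => z i = v).card =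
        (Multiset.filter (fun a => v = z a) Finset.univ.val).card := by
      intro z
      rw [Finset.card_def, Finset.filter_val]
      simp only [eq_comm]
    rw [e, e, this]
  have e := fun v => (hc v).some
  exact ⟨Equiv.ofFiberEquiv e, fun i => Equiv.ofFiberEquiv_map e i⟩

lemma IsHermitian.exists_diagonalization {K : Matrix m m ℂ} (hK : K.IsHermitian) {x : m → ℝ}
    (hx : K.charpoly = ∏ i, (X - Polynomial.C (x i : ℂ))) :
    ∃ U : Matrix m m ℂ, Uᴴ * U = 1 ∧ K = U * diagonal (fun i => (x i : ℂ)) * Uᴴ := by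
  set V : Matrix m m ℂ := (hK.eigenvectorUnitary : Matrix m m ℂ) with hV
  have hs : K = V * diagonal (fun i => (hK.eigenvalues i : ℂ)) * Vᴴ := hK.spectral_theorem
  have hVV : V * Vᴴ = 1 := Unitary.mul_star_self_of_mem hK.eigenvectorUnitary.2
  have hVV' : Vᴴ * V = 1 := mul_eq_one_comm.1 hVV
  have hc : K.charpoly = ∏ i, (X - Polynomial.C (hK.eigenvalues i : ℂ)) := by
    conv_lhs => rw [hs]
    rw [charpoly_mul_comm, ← Matrix.mul_assoc, hVV', Matrix.one_mul, charpoly_diagonal]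
  obtain ⟨σ, hσ⟩ := exists_perm_of_prod_eq (hc.symm.trans hx)
  refine ⟨V.submatrix id σ, ?_, ?_⟩
  · rw [conjTranspose_submatrix, ← submatrix_mul _ _ σ id σ Function.bijective_id, hVV',
      submatrix_one_equiv]
  · have hd : diagonal (fun i => (x i : ℂ)) =
        (diagonal fun i => (hK.eigenvalues i : ℂ)).submatrix σ σ := by
      rw [submatrix_diagonal_equiv]
      congr 1
      funext i
      exact (hσ i).symm
    rw [hd, conjTranspose_submatrix, ← submatrix_mul _ _ id σ σ σ.bijective,
      ← submatrix_mul _ _ id σ id σ.bijective, ← hs, submatrix_id_id]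

lemma card_le_of_congruence {ι₁ ι₂ : Type*} [Fintype ι₁] [Fintype ι₂] {V : Matrix m m ℂ}
    (hV : IsUnit V.det) {ε y : m → ℝ}
    (h : V * diagonal (fun i => (ε i : ℂ)) * Vᴴ = diagonal fun i => (y i : ℂ)) (P : ι₁ → m)
    (Q : ι₂ → m) (hy : ∀ i, i ∉ Set.range P → y i ≤ 0) (hε : ∀ i, i ∉ Set.range Q → 0 < ε i) :
    Fintype.card m ≤ Fintype.card ι₁ + Fintype.card ι₂ := by
  by_contra hlt
  rw [not_le] at hlt
  let L : (m → ℂ) →ₗ[ℂ] (ι₁ → ℂ) × (ι₂ → ℂ) :=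
    (LinearMap.funLeft ℂ ℂ P).prod ((LinearMap.funLeft ℂ ℂ Q).comp (Matrix.mulVecLin Vᴴ))
  have hker : LinearMap.ker L ≠ ⊥ := by
    apply LinearMap.ker_ne_bot_of_finrank_lt
    simpa using hlt
  obtain ⟨v, hv, hv0⟩ := Submodule.exists_mem_ne_zero_of_ne_bot hker
  have hL : L v = 0 := hv
  set w := Vᴴ *ᵥ v with hw
  have h1 : ∀ i, v (P i) = 0 := fun i => congrFun (congrArg Prod.fst hL) i
  have h2 : ∀ i, w (Q i) = 0 := fun i => congrFun (congrArg Prod.snd hL) i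
  have hq : ∀ (d : m → ℝ) (u : m → ℂ),
      (star u ⬝ᵥ diagonal (fun i => (d i : ℂ)) *ᵥ u).re = ∑ i, d i * ‖u i‖ ^ 2 := by
    intro d u
    rw [dotProduct, Complex.re_sum]
    refine Finset.sum_congr rfl fun i _ => ?_
    rw [mulVec_diagonal, Pi.star_apply, mul_left_comm, RCLike.star_def,
      ← Complex.normSq_eq_conj_mul_self,
      Complex.normSq_eq_norm_sq, ← Complex.ofReal_mul, Complex.ofReal_re]
  have e : star w ⬝ᵥ diagonal (fun i => (ε i : ℂ)) *ᵥ w =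
      star v ⬝ᵥ diagonal (fun i => (y i : ℂ)) *ᵥ v := by
    rw [← h, hw, star_mulVec, conjTranspose_conjTranspose, ← dotProduct_mulVec, mulVec_mulVec,
      mulVec_mulVec, Matrix.mul_assoc]
  have e' := congrArg Complex.re e
  rw [hq, hq] at e'
  have hle : ∑ i, y i * ‖v i‖ ^ 2 ≤ 0 := Finset.sum_nonpos fun i _ => by
    by_cases hi : i ∈ Set.range P
    · obtain ⟨j, rfl⟩ := hi
      simp [h1]
    · exact mul_nonpos_of_nonpos_of_nonneg (hy i hi) (sq_nonneg _)
  have hnn : ∀ i ∈ Finset.univ, 0 ≤ ε i * ‖w i‖ ^ 2 := fun i _ => by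
    by_cases hi : i ∈ Set.range Q
    · obtain ⟨j, rfl⟩ := hi
      simp [h2]
    · exact mul_nonneg (hε i hi).le (sq_nonneg _)
  have hz := (Finset.sum_eq_zero_iff_of_nonneg hnn).1
    (le_antisymm (e'.trans_le hle) (Finset.sum_nonneg hnn))
  have hw0 : w = 0 := by
    funext i
    by_cases hi : i ∈ Set.range Q
    · obtain ⟨j, rfl⟩ := hi
      exact h2 j
    · have := hz i (Finset.mem_univ i)
      rcases mul_eq_zero.1 this with h3 | h3
      · exact absurd h3 (hε i hi).ne'
      · exact norm_eq_zero.1 (pow_eq_zero_iff two_ne_zero |>.1 h3)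
  have hVu : IsUnit Vᴴ := (isUnit_iff_isUnit_det _).2 (by rw [det_conjTranspose]; exact hV.star)
  exact hv0 (mulVec_injective_iff_isUnit.2 hVu (by rw [mulVec_zero]; exact hw0))

end Spectral

section Glue

variable {p q : ℕ}

lemma sgn_eq_diagonal : sgn (Fin p) (Fin q) =
    diagonal fun x => ((Sum.elim (fun _ => (1 : ℝ)) (fun _ => -1) x : ℝ) : ℂ) := by
  rw [sgn, ← diagonal_one, ← diagonal_one, diagonal_neg, fromBlocks_diagonal]
  congr 1
  funext x
  rcases x with x | x <;> simp

/-- The signature of a form determines the signs of its eigenvalues. -/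
lemma signs_of_congruence {V : Frm p q} (hV : IsUnit V.det) {y : Fin p ⊕ Fin q → ℝ}
    (h : V * sgn (Fin p) (Fin q) * Vᴴ = diagonal fun i => (y i : ℂ))
    (hy : ∀ i j, y (Sum.inr j) < y (Sum.inl i)) :
    (∀ i, 0 < y (Sum.inl i)) ∧ ∀ j, y (Sum.inr j) < 0 := by
  rw [sgn_eq_diagonal] at h
  constructor
  · intro i
    by_contra hi
    rw [not_lt] at hi
    have := card_le_of_congruence hV h (ι₁ := {k : Fin p // k ≠ i}) (ι₂ := Fin q)
      (fun k => Sum.inl k.1) Sum.inr (by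
        rintro (k | k) hk
        · by_cases e : k = i
          · rwa [e]
          · exact absurd ⟨⟨k, e⟩, rfl⟩ hk
        · exact ((hy i k).trans_le hi).le) (by
        rintro (k | k) hk
        · simp
        · exact absurd ⟨k, rfl⟩ hk)
    have hc : Fintype.card {k : Fin p // k ≠ i} = p - 1 := by simp [Fintype.card_subtype_compl]
    rw [Fintype.card_sum, hc, Fintype.card_fin, Fintype.card_fin] at this
    have := i.pos
    omega
  · intro j
    by_contra hj
    rw [not_lt] at hj
    have h' : V * diagonal (fun x => ((-(Sum.elim (fun _ => (1 : ℝ)) (fun _ => -1) x) : ℝ) : ℂ)) *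
        Vᴴ = diagonal fun i => ((-y i : ℝ) : ℂ) := by
      simp only [Complex.ofReal_neg]
      rw [← diagonal_neg, ← diagonal_neg, ← h]
      simp only [Matrix.mul_neg, Matrix.neg_mul]
    have := card_le_of_congruence hV h' (ι₁ := {k : Fin q // k ≠ j}) (ι₂ := Fin p)
      (fun k => Sum.inr k.1) Sum.inl (by
        rintro (k | k) hk
        · linarith [hy k j]
        · by_cases e : k = j
          · rw [e]; linarith
          · exact absurd ⟨⟨k, e⟩, rfl⟩ hk) (by
        rintro (k | k) hk
        · exact absurd ⟨k, rfl⟩ hk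
        · simp)
    have hc : Fintype.card {k : Fin q // k ≠ j} = q - 1 := by simp [Fintype.card_subtype_compl]
    rw [Fintype.card_sum, hc, Fintype.card_fin, Fintype.card_fin] at this
    have := j.pos
    omega

lemma dJ_eq_mul_sgn (w₁ : Fin p → ℝ) (w₂ : Fin q → ℝ) :
    dJ w₁ w₂ = diagonal (fun x => ((Sum.elim w₁ w₂ x : ℝ) : ℂ)) * sgn (Fin p) (Fin q) := by
  rw [dJ_eq_diagonal, sgn_eq_diagonal, diagonal_mul_diagonal]
  congr 1
  funext x
  rcases x with x | x <;> simp

lemma isometry_inv {g : Frm p q} (hg : gᴴ * sgn (Fin p) (Fin q) * g = sgn (Fin p) (Fin q)) :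
    g⁻¹ = sgn (Fin p) (Fin q) * gᴴ * sgn (Fin p) (Fin q) := by
  refine inv_eq_left_inv ?_
  rw [Matrix.mul_assoc, Matrix.mul_assoc, ← Matrix.mul_assoc gᴴ, hg, sgn_mul_sgn]

lemma isometry_conj_mul_sgn {g : Frm p q}
    (hg : gᴴ * sgn (Fin p) (Fin q) * g = sgn (Fin p) (Fin q)) (w₁ : Fin p → ℝ) (w₂ : Fin q → ℝ) :
    g * diagonal (fun x => ((Sum.elim w₁ w₂ x : ℝ) : ℂ)) * g⁻¹ * sgn (Fin p) (Fin q) =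
      g * dJ w₁ w₂ * gᴴ := by
  rw [isometry_inv hg, dJ_eq_mul_sgn]
  calc _ = g * diagonal (fun x => ((Sum.elim w₁ w₂ x : ℝ) : ℂ)) * sgn (Fin p) (Fin q) * gᴴ *
        (sgn (Fin p) (Fin q) * sgn (Fin p) (Fin q)) := by simp only [Matrix.mul_assoc]
    _ = _ := by rw [sgn_mul_sgn, Matrix.mul_one]; simp only [Matrix.mul_assoc]

lemma dJ_posDef {w₁ : Fin p → ℝ} {w₂ : Fin q → ℝ} (h₁ : ∀ i, 0 < w₁ i) (h₂ : ∀ j, w₂ j < 0) :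
    (dJ w₁ w₂).PosDef := by
  rw [dJ_eq_diagonal]
  refine PosDef.diagonal fun x => ?_
  rcases x with x | x
  · exact_mod_cast h₁ x
  · have := h₂ x
    simp only [Sum.elim_inr]
    exact_mod_cast neg_pos.2 this

lemma isometry_conj_posDef {g : Frm p q}
    (hg : gᴴ * sgn (Fin p) (Fin q) * g = sgn (Fin p) (Fin q)) {w₁ : Fin p → ℝ} {w₂ : Fin q → ℝ}
    (h₁ : ∀ i, 0 < w₁ i) (h₂ : ∀ j, w₂ j < 0) : (g * dJ w₁ w₂ * gᴴ).PosDef := by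
  have h := (dJ_posDef h₁ h₂).conjTranspose_mul_mul_same (B := gᴴ)
    (mulVec_injective_iff_isUnit.2 ((isUnit_iff_isUnit_det _).2 (by
      rw [det_conjTranspose]; exact (isUnit_det_of_isometry hg).star)))
  rwa [conjTranspose_conjTranspose] at h

end Glue

section Translation

variable {p q : ℕ}

/-- The diagonal matrix with blocks `w₁` and `w₂`. -/
def dd (w₁ : Fin p → ℝ) (w₂ : Fin q → ℝ) : Frm p q :=
  diagonal fun x => ((Sum.elim w₁ w₂ x : ℝ) : ℂ)

lemma dJ_sub_const (w₁ : Fin p → ℝ) (w₂ : Fin q → ℝ) (t : ℝ) :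
    dJ (fun i => w₁ i - t) (fun i => w₂ i - t) = dJ w₁ w₂ - (t : ℂ) • sgn (Fin p) (Fin q) := by
  rw [dJ_eq_diagonal, dJ_eq_diagonal, sgn_eq_diagonal, ← diagonal_smul, diagonal_sub]
  congr 1
  funext x
  rcases x with x | x <;> simp
  ring

lemma isometry_conj_sub_const {k : Frm p q}
    (hk : kᴴ * sgn (Fin p) (Fin q) * k = sgn (Fin p) (Fin q)) (w₁ : Fin p → ℝ) (w₂ : Fin q → ℝ)
    (t : ℝ) : k * dJ (fun i => w₁ i - t) (fun i => w₂ i - t) * kᴴ =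
      k * dJ w₁ w₂ * kᴴ - (t : ℂ) • sgn (Fin p) (Fin q) := by
  rw [dJ_sub_const, Matrix.mul_sub, Matrix.sub_mul, Matrix.mul_smul, Matrix.smul_mul,
    isometry_conjTranspose hk]

lemma isometry_mul {k l : Frm p q} (hk : kᴴ * sgn (Fin p) (Fin q) * k = sgn (Fin p) (Fin q))
    (hl : lᴴ * sgn (Fin p) (Fin q) * l = sgn (Fin p) (Fin q)) :
    (k * l)ᴴ * sgn (Fin p) (Fin q) * (k * l) = sgn (Fin p) (Fin q) := by
  calc _ = lᴴ * (kᴴ * sgn (Fin p) (Fin q) * k) * l := by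
        rw [conjTranspose_mul]; simp only [Matrix.mul_assoc]
    _ = _ := by rw [hk, hl]

lemma isometry_inv_isometry {k : Frm p q}
    (hk : kᴴ * sgn (Fin p) (Fin q) * k = sgn (Fin p) (Fin q)) :
    (k⁻¹)ᴴ * sgn (Fin p) (Fin q) * k⁻¹ = sgn (Fin p) (Fin q) := by
  have hu := isUnit_det_of_isometry hk
  have h1 : (k⁻¹)ᴴ * kᴴ = 1 := by
    rw [← conjTranspose_mul, mul_nonsing_inv _ hu, conjTranspose_one]
  calc _ = (k⁻¹)ᴴ * (kᴴ * sgn (Fin p) (Fin q) * k) * k⁻¹ := by rw [hk]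
    _ = ((k⁻¹)ᴴ * kᴴ) * sgn (Fin p) (Fin q) * (k * k⁻¹) := by simp only [Matrix.mul_assoc]
    _ = _ := by rw [h1, mul_nonsing_inv _ hu, Matrix.one_mul, Matrix.mul_one]

/-- Positive definite times `J` is diagonalizable in the unitary group of `J`, up to scalars. -/
lemma exists_isometry_of_charpoly {N M : Frm p q} {γ : ℝ} (hN : N.PosDef)
    (hM : M * sgn (Fin p) (Fin q) = N + (γ : ℂ) • sgn (Fin p) (Fin q)) {z₁ : Fin p → ℝ}
    {z₂ : Fin q → ℝ} (hz : ∀ i j, z₂ j < z₁ i)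
    (hc : M.charpoly = ∏ x, (X - Polynomial.C ((Sum.elim z₁ z₂ x : ℝ) : ℂ))) :
    (∀ i, γ < z₁ i) ∧ (∀ j, z₂ j < γ) ∧ ∃ k : Frm p q,
      kᴴ * sgn (Fin p) (Fin q) * k = sgn (Fin p) (Fin q) ∧ M = k * dd z₁ z₂ * k⁻¹ := by
  obtain ⟨B, hB, rfl⟩ := PosDef.exists_isUnit_factor hN
  set J := sgn (Fin p) (Fin q) with hJ
  have hJJ : J * J = 1 := sgn_mul_sgn
  have hBu : IsUnit Bᴴ.det := by rw [det_conjTranspose]; exact hB.star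
  set K : Frm p q := B * J * Bᴴ + (γ : ℂ) • (1 : Frm p q) with hK
  have hMe : M = Bᴴ * B * J + (γ : ℂ) • (1 : Frm p q) := by
    calc M = M * J * J := by rw [Matrix.mul_assoc, hJJ, Matrix.mul_one]
      _ = _ := by rw [hM, Matrix.add_mul, Matrix.smul_mul, hJJ]
  have hMK : M * Bᴴ = Bᴴ * K := by
    rw [hMe, hK, Matrix.add_mul, Matrix.mul_add, Matrix.smul_mul, Matrix.mul_smul, Matrix.one_mul,
      Matrix.mul_one]
    simp only [Matrix.mul_assoc]
  have hKc : K.charpoly = ∏ x, (X - Polynomial.C ((Sum.elim z₁ z₂ x : ℝ) : ℂ)) := by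
    rw [← hc]
    have : M = (Bᴴ * K) * Bᴴ⁻¹ := by
      rw [← hMK, Matrix.mul_assoc, mul_nonsing_inv _ hBu, Matrix.mul_one]
    rw [this, charpoly_mul_comm, ← Matrix.mul_assoc, nonsing_inv_mul _ hBu, Matrix.one_mul]
  have hKh : K.IsHermitian := by
    change Kᴴ = K
    rw [hK, conjTranspose_add, conjTranspose_smul, conjTranspose_one, conjTranspose_mul,
      conjTranspose_mul, conjTranspose_conjTranspose, hJ, sgn_conjTranspose, RCLike.star_def,
      Complex.conj_ofReal, Matrix.mul_assoc]
  obtain ⟨U, hU, hKU⟩ := IsHermitian.exists_diagonalization hKh hKc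
  have hU' : U * Uᴴ = 1 := mul_eq_one_comm.1 hU
  set y : Fin p ⊕ Fin q → ℝ := fun x => Sum.elim z₁ z₂ x - γ with hy
  have hV : (Uᴴ * B) * J * (Uᴴ * B)ᴴ = diagonal fun x => (y x : ℂ) := by
    have e1 : B * J * Bᴴ = U * (diagonal fun x => (y x : ℂ)) * Uᴴ := by
      have e2 : (diagonal fun x => (y x : ℂ)) =
          diagonal (fun x => ((Sum.elim z₁ z₂ x : ℝ) : ℂ)) - (γ : ℂ) • (1 : Frm p q) := by
        rw [← diagonal_one, ← diagonal_smul, diagonal_sub]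
        congr 1
        funext x
        simp [hy]
      rw [e2, Matrix.mul_sub, Matrix.sub_mul, ← hKU, hK, Matrix.mul_smul, Matrix.smul_mul,
        Matrix.mul_one, hU', add_sub_cancel_right]
    calc _ = Uᴴ * (B * J * Bᴴ) * U := by
          rw [conjTranspose_mul, conjTranspose_conjTranspose]; simp only [Matrix.mul_assoc]
      _ = (Uᴴ * U) * (diagonal fun x => (y x : ℂ)) * (Uᴴ * U) := by
          rw [e1]; simp only [Matrix.mul_assoc]
      _ = _ := by rw [hU, Matrix.one_mul, Matrix.mul_one]
  have hUu : IsUnit Uᴴ.det := isUnit_det_of_right_inverse hU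
  obtain ⟨s₁, s₂⟩ := signs_of_congruence (V := Uᴴ * B) (by rw [det_mul]; exact hUu.mul hB) hV
    (fun i j => by simpa [hy] using hz i j)
  refine ⟨fun i => sub_pos.1 (s₁ i), fun j => sub_neg.1 (s₂ j), ?_⟩
  set r : Fin p ⊕ Fin q → ℝ := fun x => (Real.sqrt |y x|)⁻¹ with hr
  set S : Frm p q := diagonal fun x => (r x : ℂ) with hS
  have hSh : Sᴴ = S := by
    rw [hS, diagonal_conjTranspose]
    congr 1
    funext x
    simp
  set k : Frm p q := Bᴴ * U * S with hk
  have hiso : kᴴ * J * k = J := by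
    calc _ = S * ((Uᴴ * B) * J * (Uᴴ * B)ᴴ) * S := by
          rw [hk, conjTranspose_mul, conjTranspose_mul, conjTranspose_mul, hSh,
            conjTranspose_conjTranspose, conjTranspose_conjTranspose]
          simp only [Matrix.mul_assoc]
      _ = _ := by
          rw [hV, hS, diagonal_mul_diagonal, diagonal_mul_diagonal, hJ, sgn_eq_diagonal]
          congr 1
          funext x
          rw [← Complex.ofReal_mul, ← Complex.ofReal_mul]
          congr 1
          have hy0 : y x ≠ 0 := by
            rcases x with x | x
            exacts [(s₁ x).ne', (s₂ x).ne]
          have h1 : Real.sqrt |y x| * Real.sqrt |y x| = |y x| := Real.mul_self_sqrt (abs_nonneg _)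
          have h2 : r x * y x * r x = y x / |y x| := by
            rw [← h1, hr]
            have : Real.sqrt |y x| ≠ 0 := Real.sqrt_ne_zero'.2 (abs_pos.2 hy0)
            field_simp
          rw [h2]
          rcases x with x | x
          · rw [abs_of_pos (s₁ x), div_self hy0, Sum.elim_inl]
          · rw [abs_of_neg (s₂ x), div_neg, div_self hy0, Sum.elim_inr]
  refine ⟨k, hiso, ?_⟩
  have hMk : M * k = k * dd z₁ z₂ := by
    have hcomm : diagonal (fun x => ((Sum.elim z₁ z₂ x : ℝ) : ℂ)) * S = S * dd z₁ z₂ := by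
      rw [hS, dd, diagonal_mul_diagonal, diagonal_mul_diagonal]
      congr 1
      funext x
      rw [mul_comm]
    calc M * k = (M * Bᴴ) * U * S := by rw [hk]; simp only [Matrix.mul_assoc]
      _ = Bᴴ * U * diagonal (fun x => ((Sum.elim z₁ z₂ x : ℝ) : ℂ)) * (Uᴴ * U) * S := by
          rw [hMK, hKU]; simp only [Matrix.mul_assoc]
      _ = _ := by
          rw [hU, Matrix.mul_one, Matrix.mul_assoc, hcomm, hk]; simp only [Matrix.mul_assoc]
  rw [← hMk, Matrix.mul_assoc, mul_nonsing_inv _ (isUnit_det_of_isometry hiso), Matrix.mul_one]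

/-- The spectral problem, shifted into the definite range. -/
lemma sol_of_charpoly {a₁ b₁ z₁ : Fin p → ℝ} {a₂ b₂ z₂ : Fin q → ℝ} {α β : ℝ}
    (ha₁ : ∀ i, α < a₁ i) (ha₂ : ∀ i, a₂ i < α) (hb₁ : ∀ i, β < b₁ i) (hb₂ : ∀ i, b₂ i < β)
    {g h : Frm p q} (hg : gᴴ * sgn (Fin p) (Fin q) * g = sgn (Fin p) (Fin q))
    (hh : hᴴ * sgn (Fin p) (Fin q) * h = sgn (Fin p) (Fin q)) (hz : ∀ i j, z₂ j < z₁ i)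
    (hc : (g * dd a₁ a₂ * g⁻¹ + h * dd b₁ b₂ * h⁻¹).charpoly =
      ∏ x, (X - Polynomial.C ((Sum.elim z₁ z₂ x : ℝ) : ℂ))) :
    (∀ i, α + β < z₁ i) ∧ (∀ j, z₂ j < α + β) ∧
      Sol (fun i => a₁ i - α) (fun i => b₁ i - β) (fun i => α + β - z₁ i)
        (fun i => a₂ i - α) (fun i => b₂ i - β) (fun i => α + β - z₂ i) := by
  have hN := (isometry_conj_posDef hg (w₁ := fun i => a₁ i - α) (w₂ := fun i => a₂ i - α)
    (fun i => sub_pos.2 (ha₁ i)) fun i => sub_neg.2 (ha₂ i)).add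
    (isometry_conj_posDef hh (w₁ := fun i => b₁ i - β) (w₂ := fun i => b₂ i - β)
    (fun i => sub_pos.2 (hb₁ i)) fun i => sub_neg.2 (hb₂ i))
  have hM : (g * dd a₁ a₂ * g⁻¹ + h * dd b₁ b₂ * h⁻¹) * sgn (Fin p) (Fin q) =
      g * dJ a₁ a₂ * gᴴ + h * dJ b₁ b₂ * hᴴ := by
    rw [Matrix.add_mul, dd, dd, isometry_conj_mul_sgn hg, isometry_conj_mul_sgn hh]
  rw [isometry_conj_sub_const hg, isometry_conj_sub_const hh] at hN
  obtain ⟨h1, h2, k, hk, hMk⟩ := exists_isometry_of_charpoly hN (γ := α + β)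
    (by rw [hM]; push_cast; module) hz hc
  refine ⟨h1, h2, k⁻¹ * g, k⁻¹ * h, isometry_mul (isometry_inv_isometry hk) hg,
    isometry_mul (isometry_inv_isometry hk) hh, ?_⟩
  have hku := isUnit_det_of_isometry hk
  have e : g * dJ a₁ a₂ * gᴴ + h * dJ b₁ b₂ * hᴴ = k * dJ z₁ z₂ * kᴴ := by
    rw [← hM, hMk, dd, isometry_conj_mul_sgn hk]
  have hki : kᴴ * (k⁻¹)ᴴ = 1 := by
    rw [← conjTranspose_mul, nonsing_inv_mul _ hku, conjTranspose_one]
  have e' : k⁻¹ * g * dJ a₁ a₂ * (k⁻¹ * g)ᴴ + k⁻¹ * h * dJ b₁ b₂ * (k⁻¹ * h)ᴴ = dJ z₁ z₂ := by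
    calc _ = k⁻¹ * (g * dJ a₁ a₂ * gᴴ + h * dJ b₁ b₂ * hᴴ) * (k⁻¹)ᴴ := by
          rw [conjTranspose_mul, conjTranspose_mul, Matrix.mul_add, Matrix.add_mul]
          simp only [Matrix.mul_assoc]
      _ = (k⁻¹ * k) * dJ z₁ z₂ * (kᴴ * (k⁻¹)ᴴ) := by rw [e]; simp only [Matrix.mul_assoc]
      _ = _ := by rw [hki, nonsing_inv_mul _ hku, Matrix.one_mul, Matrix.mul_one]
  rw [isometry_conj_sub_const (isometry_mul (isometry_inv_isometry hk) hg),
    isometry_conj_sub_const (isometry_mul (isometry_inv_isometry hk) hh)]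
  have e3 : dJ (fun i => α + β - z₁ i) (fun i => α + β - z₂ i) =
      ((α + β : ℝ) : ℂ) • sgn (Fin p) (Fin q) - dJ z₁ z₂ := by
    rw [dJ_eq_diagonal, dJ_eq_diagonal, sgn_eq_diagonal, ← diagonal_smul, diagonal_sub]
    congr 1
    funext x
    rcases x with x | x <;> simp
    ring
  rw [e3, ← e']
  push_cast
  module

/-- Solutions of the shifted problem give matrices with the prescribed spectrum. -/
lemma Sol.exists_charpoly {a₁ b₁ z₁ : Fin p → ℝ} {a₂ b₂ z₂ : Fin q → ℝ} {α β : ℝ}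
    (H : Sol (fun i => a₁ i - α) (fun i => b₁ i - β) (fun i => α + β - z₁ i)
        (fun i => a₂ i - α) (fun i => b₂ i - β) (fun i => α + β - z₂ i)) :
    ∃ g h : Frm p q, gᴴ * sgn (Fin p) (Fin q) * g = sgn (Fin p) (Fin q) ∧
      hᴴ * sgn (Fin p) (Fin q) * h = sgn (Fin p) (Fin q) ∧
      (g * dd a₁ a₂ * g⁻¹ + h * dd b₁ b₂ * h⁻¹).charpoly =
        ∏ x, (X - Polynomial.C ((Sum.elim z₁ z₂ x : ℝ) : ℂ)) := by
  obtain ⟨g, h, hg, hh, e⟩ := H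
  refine ⟨g, h, hg, hh, ?_⟩
  have hM : (g * dd a₁ a₂ * g⁻¹ + h * dd b₁ b₂ * h⁻¹) * sgn (Fin p) (Fin q) =
      dd z₁ z₂ * sgn (Fin p) (Fin q) := by
    rw [Matrix.add_mul, dd, dd, dd, isometry_conj_mul_sgn hg, isometry_conj_mul_sgn hh,
      ← dJ_eq_mul_sgn]
    rw [isometry_conj_sub_const hg, isometry_conj_sub_const hh] at e
    have e3 : dJ (fun i => α + β - z₁ i) (fun i => α + β - z₂ i) =
        ((α + β : ℝ) : ℂ) • sgn (Fin p) (Fin q) - dJ z₁ z₂ := by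
      rw [dJ_eq_diagonal, dJ_eq_diagonal, sgn_eq_diagonal, ← diagonal_smul, diagonal_sub]
      congr 1
      funext x
      rcases x with x | x <;> simp
      ring
    rw [e3] at e
    rw [← sub_eq_zero, ← e]
    push_cast
    module
  have hM' : g * dd a₁ a₂ * g⁻¹ + h * dd b₁ b₂ * h⁻¹ = dd z₁ z₂ := by
    have := congrArg (fun M => M * sgn (Fin p) (Fin q)) hM
    simpa only [Matrix.mul_assoc, sgn_mul_sgn, Matrix.mul_one] using this
  rw [hM', dd, charpoly_diagonal]

lemma Sol.sum_eq_zero {a₁ b₁ c₁ : Fin p → ℝ} {a₂ b₂ c₂ : Fin q → ℝ}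
    (H : Sol a₁ b₁ c₁ a₂ b₂ c₂) :
    ∑ i, (a₁ i + b₁ i + c₁ i) + ∑ j, (a₂ j + b₂ j + c₂ j) = 0 := by
  obtain ⟨g, h, hg, hh, e⟩ := H
  have ht : ∀ (k : Frm p q) (w₁ : Fin p → ℝ) (w₂ : Fin q → ℝ),
      kᴴ * sgn (Fin p) (Fin q) * k = sgn (Fin p) (Fin q) →
      (k * dJ w₁ w₂ * kᴴ * sgn (Fin p) (Fin q)).trace.re = ∑ i, w₁ i + ∑ j, w₂ j := by
    intro k w₁ w₂ hk
    rw [Matrix.mul_assoc, Matrix.mul_assoc, trace_mul_comm, Matrix.mul_assoc, hk, dJ_eq_mul_sgn,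
      Matrix.mul_assoc, sgn_mul_sgn, Matrix.mul_one, trace_diagonal, Complex.re_sum,
      Fintype.sum_sum_type]
    simp
  have h1 := ht 1 c₁ c₂ (by simp)
  rw [conjTranspose_one, Matrix.one_mul, Matrix.mul_one] at h1
  have e' := congrArg (fun M => (trace (M * sgn (Fin p) (Fin q))).re) e
  simp only [Matrix.add_mul, trace_add, Complex.add_re, Matrix.zero_mul, trace_zero,
    Complex.zero_re, ht g a₁ a₂ hg, ht h b₁ b₂ hh, h1] at e'
  simp only [Finset.sum_add_distrib]
  linarith

/-- Solvability does not depend on the order of the eigenvalues within the blocks. -/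
lemma Sol.perm {a₁ b₁ c₁ : Fin p → ℝ} {a₂ b₂ c₂ : Fin q → ℝ} (H : Sol a₁ b₁ c₁ a₂ b₂ c₂)
    (σ₁ σ₂ σ₃ : Equiv.Perm (Fin p)) (τ₁ τ₂ τ₃ : Equiv.Perm (Fin q)) :
    Sol (a₁ ∘ σ₁) (b₁ ∘ σ₂) (c₁ ∘ σ₃) (a₂ ∘ τ₁) (b₂ ∘ τ₂) (c₂ ∘ τ₃) := by
  obtain ⟨g, h, hg, hh, e⟩ := H
  have hd : ∀ (σ : Equiv.Perm (Fin p)) (τ : Equiv.Perm (Fin q)) (w₁ : Fin p → ℝ)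
      (w₂ : Fin q → ℝ), dJ (w₁ ∘ σ) (w₂ ∘ τ) =
        (dJ w₁ w₂).submatrix (Equiv.sumCongr σ τ) (Equiv.sumCongr σ τ) := by
    intro σ τ w₁ w₂
    rw [dJ_eq_diagonal, dJ_eq_diagonal, submatrix_diagonal_equiv]
    congr 1
    funext x
    rcases x with x | x <;> simp
  have hs : ∀ (σ : Equiv.Perm (Fin p)) (τ : Equiv.Perm (Fin q)),
      (sgn (Fin p) (Fin q)).submatrix (Equiv.sumCongr σ τ) (Equiv.sumCongr σ τ) =
        sgn (Fin p) (Fin q) := by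
    intro σ τ
    rw [sgn_eq_diagonal, submatrix_diagonal_equiv]
    congr 1
    funext x
    rcases x with x | x <;> simp
  have hiso : ∀ (k : Frm p q) (σ : Equiv.Perm (Fin p)) (τ : Equiv.Perm (Fin q)),
      kᴴ * sgn (Fin p) (Fin q) * k = sgn (Fin p) (Fin q) →
      (k.submatrix (Equiv.sumCongr σ₃ τ₃) (Equiv.sumCongr σ τ))ᴴ * sgn (Fin p) (Fin q) *
        k.submatrix (Equiv.sumCongr σ₃ τ₃) (Equiv.sumCongr σ τ) = sgn (Fin p) (Fin q) := by
    intro k σ τ hk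
    conv_lhs => rw [← hs σ₃ τ₃]
    rw [conjTranspose_submatrix, submatrix_mul_equiv, submatrix_mul_equiv, hk, hs]
  refine ⟨_, _, hiso g σ₁ τ₁ hg, hiso h σ₂ τ₂ hh, ?_⟩
  rw [hd, hd, hd, conjTranspose_submatrix, conjTranspose_submatrix, submatrix_mul_equiv,
    submatrix_mul_equiv, submatrix_mul_equiv, submatrix_mul_equiv]
  have := congrArg (fun M => M.submatrix (Equiv.sumCongr σ₃ τ₃) (Equiv.sumCongr σ₃ τ₃)) e
  exact this

end Translation

section Reindexing

variable {p q : ℕ}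

/-- Block coordinates of a vector: the first `p` entries. -/
def upper (x : Fin (p + q) → ℝ) : Fin p → ℝ := fun i => x (Fin.castAdd q i)

/-- Block coordinates of a vector: the last `q` entries. -/
def lower (x : Fin (p + q) → ℝ) : Fin q → ℝ := fun j => x (Fin.natAdd p j)

/-- A matrix in block coordinates. -/
def toFrm (M : Matrix (Fin (p + q)) (Fin (p + q)) ℂ) : Frm p q :=
  M.submatrix finSumFinEquiv finSumFinEquiv

lemma elim_upper_lower (x : Fin (p + q) → ℝ) (k : Fin p ⊕ Fin q) :
    Sum.elim (upper x) (lower x) k = x (finSumFinEquiv k) := by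
  rcases k with k | k <;> simp [upper, lower]

lemma toFrm_add (M N : Matrix (Fin (p + q)) (Fin (p + q)) ℂ) :
    toFrm (M + N) = toFrm M + toFrm N := rfl

lemma toFrm_mul (M N : Matrix (Fin (p + q)) (Fin (p + q)) ℂ) :
    toFrm (M * N) = toFrm M * toFrm N :=
  (submatrix_mul_equiv M N _ finSumFinEquiv _).symm

lemma toFrm_inv (M : Matrix (Fin (p + q)) (Fin (p + q)) ℂ) : toFrm M⁻¹ = (toFrm M)⁻¹ :=
  (inv_submatrix_equiv M finSumFinEquiv finSumFinEquiv).symm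

lemma toFrm_conjTranspose (M : Matrix (Fin (p + q)) (Fin (p + q)) ℂ) :
    toFrm Mᴴ = (toFrm M)ᴴ := rfl

lemma toFrm_injective : Function.Injective (toFrm (p := p) (q := q)) :=
  (reindex (finSumFinEquiv (m := p) (n := q)).symm finSumFinEquiv.symm).injective

lemma exists_toFrm_eq (k : Frm p q) : ∃ M, toFrm M = k :=
  (reindex (finSumFinEquiv (m := p) (n := q)).symm finSumFinEquiv.symm).surjective k

lemma toFrm_det (M : Matrix (Fin (p + q)) (Fin (p + q)) ℂ) : (toFrm M).det = M.det :=
  det_submatrix_equiv_self _ _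

lemma toFrm_Jmat : toFrm (Jmat p q) = sgn (Fin p) (Fin q) := by
  rw [toFrm, Jmat, sgn_eq_diagonal, submatrix_diagonal_equiv]
  congr 1
  funext x
  rcases x with x | x <;> simp

lemma toFrm_diagonal (x : Fin (p + q) → ℝ) :
    toFrm (diagonal fun i => (x i : ℂ)) = dd (upper x) (lower x) := by
  rw [toFrm, dd, submatrix_diagonal_equiv]
  congr 1
  funext k
  rw [elim_upper_lower, Function.comp_apply]

lemma toFrm_charpoly (M : Matrix (Fin (p + q)) (Fin (p + q)) ℂ) :
    (toFrm M).charpoly = M.charpoly :=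
  charpoly_reindex finSumFinEquiv.symm M

lemma prod_eq_prod_blocks (x : Fin (p + q) → ℝ) :
    ∏ i, (X - Polynomial.C ((x i : ℝ) : ℂ)) =
      ∏ k, (X - Polynomial.C ((Sum.elim (upper x) (lower x) k : ℝ) : ℂ)) := by
  simp only [elim_upper_lower]
  exact (Equiv.prod_comp finSumFinEquiv fun i => (X - Polynomial.C ((x i : ℝ) : ℂ))).symm

lemma toFrm_isometry {g : Matrix (Fin (p + q)) (Fin (p + q)) ℂ} (hg : g ∈ SUpq p q) :
    (toFrm g)ᴴ * sgn (Fin p) (Fin q) * toFrm g = sgn (Fin p) (Fin q) := by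
  rw [← toFrm_Jmat, ← toFrm_conjTranspose, ← toFrm_mul, ← toFrm_mul]
  exact congrArg toFrm hg.2

/-- Every isometry of the form acts by conjugation like an element of `SU(p,q)`. -/
lemma exists_mem_SUpq (hp : 1 ≤ p) {k : Frm p q}
    (hk : kᴴ * sgn (Fin p) (Fin q) * k = sgn (Fin p) (Fin q)) :
    ∃ g ∈ SUpq p q, ∀ D : Frm p q, toFrm g * D * (toFrm g)⁻¹ = k * D * k⁻¹ := by
  have hu := isUnit_det_of_isometry hk
  have hnorm : ‖k.det‖ = 1 := by
    have h := congrArg (fun M => ‖det M‖) hk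
    have hs : ‖(sgn (Fin p) (Fin q)).det‖ = 1 := by
      have h := congrArg (fun M => ‖det M‖) (sgn_mul_sgn (p := Fin p) (q := Fin q))
      simp only [det_mul, norm_mul, det_one, norm_one] at h
      nlinarith [norm_nonneg (sgn (Fin p) (Fin q)).det]
    simp only [det_mul, norm_mul, det_conjTranspose, norm_star, hs] at h
    nlinarith [norm_nonneg k.det]
  obtain ⟨w, hw⟩ := IsAlgClosed.exists_pow_nat_eq (k.det)⁻¹ (n := p + q) (by omega)
  have hw1 : ‖w‖ = 1 := by
    have h := congrArg norm hw
    rw [norm_pow, norm_inv, hnorm, inv_one] at h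
    exact (pow_eq_one_iff_of_nonneg (norm_nonneg _) (by omega)).1 h
  have hw0 : w ≠ 0 := by
    rintro rfl
    simp at hw1
  have hww : star w * w = 1 := by
    rw [Complex.star_def, ← Complex.normSq_eq_conj_mul_self, Complex.normSq_eq_norm_sq, hw1]
    simp
  obtain ⟨g, hg⟩ := exists_toFrm_eq (w • k)
  refine ⟨g, ⟨?_, toFrm_injective ?_⟩, fun D => ?_⟩
  · rw [← toFrm_det, hg, det_smul, Fintype.card_sum, Fintype.card_fin, Fintype.card_fin, hw,
      inv_mul_cancel₀ hu.ne_zero]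
  · rw [toFrm_mul, toFrm_mul, toFrm_conjTranspose, hg, toFrm_Jmat, conjTranspose_smul,
      Matrix.smul_mul, Matrix.smul_mul, Matrix.mul_smul, smul_smul, hww, one_smul, hk]
  · have hi : (w • k)⁻¹ = w⁻¹ • k⁻¹ := by
      refine inv_eq_left_inv ?_
      rw [Matrix.smul_mul, Matrix.mul_smul, smul_smul, inv_mul_cancel₀ hw0, one_smul,
        nonsing_inv_mul _ hu]
    rw [hg, hi, Matrix.smul_mul, Matrix.smul_mul, Matrix.mul_smul, smul_smul,
      mul_inv_cancel₀ hw0, one_smul]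

end Reindexing

section Convexity

variable {p q : ℕ}

lemma exists_perm_antitone {m : ℕ} (w : Fin m → ℝ) :
    ∃ σ : Equiv.Perm (Fin m), Antitone (w ∘ σ) :=
  ⟨Tuple.sort (-w), fun i j hij => neg_le_neg_iff.1 (Tuple.monotone_sort (-w) hij)⟩

/-- `Sol.convex_combo` for unordered data and increasing third spectrum. -/
lemma Sol.convex_combo_of_monotone {a₁ b₁ c₁ c₁' : Fin p → ℝ} {a₂ b₂ c₂ c₂' : Fin q → ℝ} {c : ℝ}
    (hc : 0 < c) (hc₁ : Monotone c₁) (hc₁' : Monotone c₁') (hc₂ : Monotone c₂)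
    (hc₂' : Monotone c₂') (pa : ∀ i, c ≤ a₁ i) (pb : ∀ i, c ≤ b₁ i) (na : ∀ i, a₂ i ≤ -c)
    (nb : ∀ i, b₂ i ≤ -c) (nc : ∀ i, c₁ i ≤ 0) (nc' : ∀ i, c₁' i ≤ 0) (pc : ∀ i, 0 ≤ c₂ i)
    (pc' : ∀ i, 0 ≤ c₂' i) (h : Sol a₁ b₁ c₁ a₂ b₂ c₂) (h' : Sol a₁ b₁ c₁' a₂ b₂ c₂') {s t : ℝ}
    (hs : 0 ≤ s) (ht : 0 ≤ t) (hst : s + t = 1) :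
    Sol a₁ b₁ (s • c₁ + t • c₁') a₂ b₂ (s • c₂ + t • c₂') := by
  obtain ⟨σ, hσ⟩ := exists_perm_antitone a₁
  obtain ⟨τ, hτ⟩ := exists_perm_antitone b₁
  obtain ⟨σ', hσ'⟩ := exists_perm_antitone a₂
  obtain ⟨τ', hτ'⟩ := exists_perm_antitone b₂
  have H := h.perm σ τ Fin.revPerm σ' τ' Fin.revPerm
  have H' := h'.perm σ τ Fin.revPerm σ' τ' Fin.revPerm
  have hr : ∀ {m : ℕ} {w : Fin m → ℝ}, Monotone w → Antitone (w ∘ Fin.revPerm) :=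
    fun hw i j hij => hw (Fin.rev_le_rev.2 hij)
  have K := H.convex_combo hc hσ hτ (hr hc₁) (hr hc₁') hσ' hτ' (hr hc₂) (hr hc₂')
    (fun i => pa _) (fun i => pb _) (fun i => na _) (fun i => nb _) (fun i => nc _)
    (fun i => nc' _) (fun i => pc _) (fun i => pc' _) H.sum_eq_zero H'.sum_eq_zero H' hs ht hst
  have K' := K.perm σ⁻¹ τ⁻¹ Fin.revPerm σ'⁻¹ τ'⁻¹ Fin.revPerm
  convert K' using 1 <;> funext i <;> simp

lemma exists_gap (hp : 1 ≤ p) (hq : 1 ≤ q) {a : Fin (p + q) → ℝ}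
    (ha : ∀ i j : Fin (p + q), (i : ℕ) < p → p ≤ (j : ℕ) → a j < a i) :
    ∃ α c : ℝ, 0 < c ∧ (∀ i, α + c ≤ upper a i) ∧ ∀ j, lower a j ≤ α - c := by
  have : Nonempty (Fin p) := ⟨⟨0, hp⟩⟩
  have : Nonempty (Fin q) := ⟨⟨0, hq⟩⟩
  obtain ⟨i, hi⟩ := Finite.exists_min (upper a)
  obtain ⟨j, hj⟩ := Finite.exists_max (lower a)
  have h : lower a j < upper a i := ha _ _ (by simp) (by simp)
  exact ⟨(upper a i + lower a j) / 2, (upper a i - lower a j) / 2, by linarith,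
    fun k => by linarith [hi k], fun k => by linarith [hj k]⟩

lemma antitone_upper_of_isOrderedSpectrum {M : Matrix (Fin (p + q)) (Fin (p + q)) ℂ}
    {x : Fin (p + q) → ℝ} (h : IsOrderedSpectrum p q M x) : Antitone (upper x) :=
  fun i j hij => h.1 _ _ (Fin.le_def.2 hij) (Or.inl (by simp))

lemma antitone_lower_of_isOrderedSpectrum {M : Matrix (Fin (p + q)) (Fin (p + q)) ℂ}
    {x : Fin (p + q) → ℝ} (h : IsOrderedSpectrum p q M x) : Antitone (lower x) :=
  fun i j hij => h.1 _ _ (by simpa using hij) (Or.inr (by simp))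

lemma toFrm_conj (g : Matrix (Fin (p + q)) (Fin (p + q)) ℂ) (a : Fin (p + q) → ℝ) :
    toFrm (g * diagonal (fun i => (a i : ℂ)) * g⁻¹) =
      toFrm g * dd (upper a) (lower a) * (toFrm g)⁻¹ := by
  rw [toFrm_mul, toFrm_mul, toFrm_inv, toFrm_diagonal]

lemma sol_of_isOrderedSpectrum {a b x : Fin (p + q) → ℝ} {α β : ℝ}
    (ha₁ : ∀ i, α < upper a i) (ha₂ : ∀ i, lower a i < α) (hb₁ : ∀ i, β < upper b i)
    (hb₂ : ∀ i, lower b i < β) {g h : Matrix (Fin (p + q)) (Fin (p + q)) ℂ} (hg : g ∈ SUpq p q)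
    (hh : h ∈ SUpq p q)
    (hx : IsOrderedSpectrum p q (g * diagonal (fun i => (a i : ℂ)) * g⁻¹ +
      h * diagonal (fun i => (b i : ℂ)) * h⁻¹) x) :
    (∀ i, α + β < upper x i) ∧ (∀ j, lower x j < α + β) ∧
      Sol (fun i => upper a i - α) (fun i => upper b i - β) (fun i => α + β - upper x i)
        (fun i => lower a i - α) (fun i => lower b i - β) (fun i => α + β - lower x i) := by
  refine sol_of_charpoly ha₁ ha₂ hb₁ hb₂ (toFrm_isometry hg) (toFrm_isometry hh)
    (fun i j => hx.2.1 _ _ (by simp) (by simp)) ?_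
  rw [← toFrm_conj, ← toFrm_conj, ← toFrm_add, toFrm_charpoly, hx.2.2, prod_eq_prod_blocks]

lemma Sol.exists_mem_SUpq (hp : 1 ≤ p) {a b x : Fin (p + q) → ℝ} {α β : ℝ}
    (H : Sol (fun i => upper a i - α) (fun i => upper b i - β) (fun i => α + β - upper x i)
      (fun i => lower a i - α) (fun i => lower b i - β) (fun i => α + β - lower x i)) :
    ∃ g ∈ SUpq p q, ∃ h ∈ SUpq p q, (g * diagonal (fun i => (a i : ℂ)) * g⁻¹ +
      h * diagonal (fun i => (b i : ℂ)) * h⁻¹).charpoly =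
        ∏ i, (X - Polynomial.C ((x i : ℝ) : ℂ)) := by
  obtain ⟨k, l, hk, hl, e⟩ := H.exists_charpoly
  obtain ⟨g, hg, hgk⟩ := SpectraConvex.exists_mem_SUpq hp hk
  obtain ⟨h, hh, hhl⟩ := SpectraConvex.exists_mem_SUpq hp hl
  refine ⟨g, hg, h, hh, ?_⟩
  rw [← toFrm_charpoly, toFrm_add, toFrm_conj, toFrm_conj, hgk, hhl, e, prod_eq_prod_blocks]

end Convexity

end SpectraConvex

/-- the set `S` of ordered spectra of sums `g Λ_A g⁻¹ + h Λ_B h⁻¹`,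
`g, h ∈ SU(p,q)`, is convex. -/
theorem spectraSet_convex (p q : ℕ) (hp : 1 ≤ p) (hq : 1 ≤ q)
    (a b : Fin (p + q) → ℝ)
    (ha0 : ∑ i, a i = 0) (hb0 : ∑ i, b i = 0)
    (ha : ∀ i j : Fin (p + q), (i : ℕ) < p → p ≤ (j : ℕ) → a j < a i)
    (hb : ∀ i j : Fin (p + q), (i : ℕ) < p → p ≤ (j : ℕ) → b j < b i) :
    Convex ℝ { x : Fin (p + q) → ℝ |
      ∃ g ∈ SUpq p q, ∃ h ∈ SUpq p q,
        IsOrderedSpectrum p q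
          (g * Matrix.diagonal (fun i => (a i : ℂ)) * g⁻¹ +
            h * Matrix.diagonal (fun i => (b i : ℂ)) * h⁻¹) x } := by
  rintro x ⟨g, hg, h, hh, hx⟩ y ⟨g', hg', h', hh', hy⟩ s t hs ht hst
  obtain ⟨α, c, hc, hα₁, hα₂⟩ := SpectraConvex.exists_gap hp hq ha
  obtain ⟨β, d, hd, hβ₁, hβ₂⟩ := SpectraConvex.exists_gap hp hq hb
  have hcd : 0 < min c d := lt_min hc hd
  have hmc := min_le_left c d
  have hmd := min_le_right c d
  obtain ⟨hx₁, hx₂, Hx⟩ := SpectraConvex.sol_of_isOrderedSpectrum (α := α) (β := β)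
    (fun i => by linarith [hα₁ i]) (fun i => by linarith [hα₂ i]) (fun i => by linarith [hβ₁ i])
    (fun i => by linarith [hβ₂ i]) hg hh hx
  obtain ⟨hy₁, hy₂, Hy⟩ := SpectraConvex.sol_of_isOrderedSpectrum (α := α) (β := β)
    (fun i => by linarith [hα₁ i]) (fun i => by linarith [hα₂ i]) (fun i => by linarith [hβ₁ i])
    (fun i => by linarith [hβ₂ i]) hg' hh' hy
  have H := Hx.convex_combo_of_monotone hcd
    (fun i j hij => sub_le_sub_left (SpectraConvex.antitone_upper_of_isOrderedSpectrum hx hij) _)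
    (fun i j hij => sub_le_sub_left (SpectraConvex.antitone_upper_of_isOrderedSpectrum hy hij) _)
    (fun i j hij => sub_le_sub_left (SpectraConvex.antitone_lower_of_isOrderedSpectrum hx hij) _)
    (fun i j hij => sub_le_sub_left (SpectraConvex.antitone_lower_of_isOrderedSpectrum hy hij) _)
    (fun i => by linarith [hα₁ i]) (fun i => by linarith [hβ₁ i]) (fun i => by linarith [hα₂ i])
    (fun i => by linarith [hβ₂ i]) (fun i => by linarith [hx₁ i]) (fun i => by linarith [hy₁ i])
    (fun i => by linarith [hx₂ i]) (fun i => by linarith [hy₂ i]) Hy hs ht hst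
  have hcomb : ∀ u v : ℝ, s • (α + β - u) + t • (α + β - v) = α + β - (s * u + t * v) := by
    intro u v
    simp only [smul_eq_mul]
    linear_combination (α + β) * hst
  have e₁ : (s • fun i => α + β - SpectraConvex.upper x i) +
      (t • fun i => α + β - SpectraConvex.upper y i) =
      fun i => α + β - SpectraConvex.upper (s • x + t • y) i := funext fun i => hcomb _ _
  have e₂ : (s • fun i => α + β - SpectraConvex.lower x i) +
      (t • fun i => α + β - SpectraConvex.lower y i) =
      fun i => α + β - SpectraConvex.lower (s • x + t • y) i := funext fun i => hcomb _ _
  rw [e₁, e₂] at H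
  obtain ⟨k, hk, l, hl, e⟩ := H.exists_mem_SUpq hp
  refine ⟨k, hk, l, hl, fun i j hij hc => ?_, fun i j hi hj => ?_, e⟩
  · exact add_le_add (mul_le_mul_of_nonneg_left (hx.1 i j hij hc) hs)
      (mul_le_mul_of_nonneg_left (hy.1 i j hij hc) ht)
  · have h₁ := hx.2.1 i j hi hj
    have h₂ := hy.2.1 i j hi hj
    simp only [Pi.add_apply, Pi.smul_apply, smul_eq_mul]
    rcases hs.eq_or_lt with rfl | hs'
    · rw [zero_add] at hst
      simpa [hst] using h₂
    · exact add_lt_add_of_lt_of_le (mul_lt_mul_of_pos_left h₁ hs')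
        (mul_le_mul_of_nonneg_left h₂.le ht)
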